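/- Every Hopf algebra of dimension 27 over k is either semisimple, or pointed, or copointed (i.e., its dual Hopf algebra is pointed). -/

import Mathlib

open TensorProduct

namespace HopfClass

variable (k : Type*) [Field k]

section Wrt

variable {M : Type*} [AddCommGroup M] [Module k M]

/-- A subspace `C` is a subcoalgebra with respect to a comultiplication-like map `Δ`
if `Δ` maps `C` into the image of `C ⊗ C` in `M ⊗ M`. -/
def IsSubcoalgWrt (Δ : M →ₗ[k] M ⊗[k] M) (C : Submodule k M) : Prop :=
  ∀ x ∈ C, Δ x ∈ LinearMap.range (TensorProduct.map C.subtype C.subtype)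

/-- A simple subcoalgebra: a nonzero subcoalgebra with no nonzero proper subcoalgebras. -/
def IsSimpleSubcoalgWrt (Δ : M →ₗ[k] M ⊗[k] M) (C : Submodule k M) : Prop :=
  IsSubcoalgWrt k Δ C ∧ C ≠ ⊥ ∧
    ∀ D : Submodule k M, IsSubcoalgWrt k Δ D → D < C → D = ⊥

/-- Pointedness: every simple subcoalgebra is one-dimensional. -/
def IsPointedWrt (Δ : M →ₗ[k] M ⊗[k] M) : Prop :=
  ∀ C : Submodule k M, IsSimpleSubcoalgWrt k Δ C → Module.finrank k C = 1

/-- Grouplike element with respect to `Δ`. -/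
def IsGrouplikeWrt (Δ : M →ₗ[k] M ⊗[k] M) (g : M) : Prop :=
  g ≠ 0 ∧ Δ g = g ⊗ₜ[k] g

/-- `y` is a `(h, g)`-skew-primitive with respect to `Δ`, i.e. `Δ y = g ⊗ y + y ⊗ h`. -/
def IsSkewPrimitiveWrt (Δ : M →ₗ[k] M ⊗[k] M) (g h y : M) : Prop :=
  Δ y = g ⊗ₜ[k] y + y ⊗ₜ[k] h

/-- There are no nontrivial skew-primitive elements: every skew-primitive between grouplikes
is a scalar multiple of the difference of the grouplikes. -/
def HasNoNontrivialSkewPrimitivesWrt (Δ : M →ₗ[k] M ⊗[k] M) : Prop :=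
  ∀ g h y : M, IsGrouplikeWrt k Δ g → IsGrouplikeWrt k Δ h →
    IsSkewPrimitiveWrt k Δ g h y → ∃ c : k, y = c • (g - h)

end Wrt

section Coalg

variable (H : Type*) [AddCommGroup H] [Module k H] [Coalgebra k H]

/-- The comultiplication of a coalgebra, as a linear map. -/
noncomputable abbrev comulL : H →ₗ[k] H ⊗[k] H := CoalgebraStruct.comul

/-- The coradical of a coalgebra: the sum of all its simple subcoalgebras. -/
noncomputable def coradical : Submodule k H :=
  sSup {C : Submodule k H | IsSimpleSubcoalgWrt k (comulL k H) C}

/-- A coalgebra is cosemisimple if it equals its coradical. -/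
def IsCosemisimple : Prop := coradical k H = ⊤

/-- A coalgebra is pointed if all its simple subcoalgebras are one-dimensional. -/
def IsPointed : Prop := IsPointedWrt k (comulL k H)

/-- The set of grouplike elements. -/
def grouplikes : Set H := {g : H | IsGrouplikeWrt k (comulL k H) g}

/-- `e` is a multiplicative matrix of size `n` spanning the subspace `C`, i.e. a
linearly independent family with `Δ(e i j) = ∑ l, e i l ⊗ e l j` and `ε(e i j) = δ_ij`
whose span is `C`; this says precisely that `C` is a simple matrix subcoalgebra
isomorphic to `M*(n,k)`, the dual of the `n × n` matrix algebra. -/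
def IsMultMatrix (n : ℕ) (C : Submodule k H) (e : Fin n → Fin n → H) : Prop :=
  LinearIndependent k (fun p : Fin n × Fin n => e p.1 p.2) ∧
  C = Submodule.span k (Set.range fun p : Fin n × Fin n => e p.1 p.2) ∧
  (∀ i j, CoalgebraStruct.comul (R := k) (e i j) = ∑ l : Fin n, e i l ⊗ₜ[k] e l j) ∧
  (∀ i j, Coalgebra.counit (R := k) (e i j) = if i = j then (1 : k) else 0)

/-- `C` is a (simple matrix) subcoalgebra isomorphic to the matrix coalgebra `M*(n,k)`. -/
def IsMatrixSubcoalg (n : ℕ) (C : Submodule k H) : Prop :=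
  ∃ e : Fin n → Fin n → H, IsMultMatrix k H n C e

end Coalg

section Dual

variable (H : Type*) [Ring H] [Algebra k H] [FiniteDimensional k H]

/-- The comultiplication on the dual of a finite-dimensional algebra:
the dual map of the multiplication, composed with the canonical identification
`(H ⊗ H)* ≃ H* ⊗ H*`. -/
noncomputable def dualComul :
    Module.Dual k H →ₗ[k] Module.Dual k H ⊗[k] Module.Dual k H :=
  (TensorProduct.dualDistribEquiv k H H).symm.toLinearMap ∘ₗ
    (LinearMap.mul' k H).dualMap

/-- A finite-dimensional Hopf algebra is copointed if its dual is pointed. -/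
def IsCopointed : Prop := IsPointedWrt k (dualComul k H)

/-- The grouplike elements of the dual Hopf algebra. -/
def dualGrouplikes : Set (Module.Dual k H) :=
  {f : Module.Dual k H | IsGrouplikeWrt k (dualComul k H) f}

end Dual

section Taft

variable (p : ℕ) (q : k)

/-- `B` is (isomorphic to) the Taft Hopf algebra `T_q` of dimension `p²`: `q` is a primitive
`p`-th root of unity, `B` has dimension `p²` and is generated as an algebra by a grouplike `g`
and a `(1,g)`-skew-primitive `x` with `g^p = 1`, `x^p = 0` and `g x = q x g`. -/
def IsTaftAlgebra (B : Type*) [Ring B] [Bialgebra k B] : Prop :=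
  IsPrimitiveRoot q p ∧ Module.finrank k B = p ^ 2 ∧
  ∃ g x : B,
    IsGrouplikeWrt k (comulL k B) g ∧
    CoalgebraStruct.comul (R := k) x = x ⊗ₜ[k] (1 : B) + g ⊗ₜ[k] x ∧
    g ^ p = 1 ∧ x ^ p = 0 ∧ g * x = q • (x * g) ∧
    Algebra.adjoin k {g, x} = (⊤ : Subalgebra k B)

variable {H : Type*} [Ring H] [Bialgebra k H]

/-- The subalgebra `T` of `H` is a sub-Hopf algebra isomorphic to the Taft algebra `T_q` of
dimension `p²`, generated by a grouplike `g` and a `(1,g)`-skew-primitive `x` satisfying the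
Taft relations. -/
def IsTaftSubalgebra (T : Subalgebra k H) : Prop :=
  IsPrimitiveRoot q p ∧ Module.finrank k T = p ^ 2 ∧
  ∃ g x : H,
    IsGrouplikeWrt k (comulL k H) g ∧
    CoalgebraStruct.comul (R := k) x = x ⊗ₜ[k] (1 : H) + g ⊗ₜ[k] x ∧
    g ^ p = 1 ∧ x ^ p = 0 ∧ g * x = q • (x * g) ∧
    Algebra.adjoin k {g, x} = T

/-- The right coinvariants `H^{co π}` of a linear map `π : H → B` on a bialgebra `H`:
elements `h` with `(id ⊗ π)(Δ h) = h ⊗ 1`. -/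
def rightCoinvariants {B : Type*} [Ring B] [Bialgebra k B] (π : H →ₗ[k] B) : Set H :=
  {h : H | (TensorProduct.map LinearMap.id π) (CoalgebraStruct.comul (R := k) h)
      = h ⊗ₜ[k] (1 : B)}

end Taft

end HopfClass

set_option linter.unusedSectionVars false

namespace HopfClass

section Separation
variable {k : Type*} [Field k] {V W : Type*} [AddCommGroup V] [Module k V] [AddCommGroup W] [Module k W]

/-- The functional `v ⊗ w ↦ f v * g w`. -/
noncomputable def tmulFun (f : V →ₗ[k] k) (g : W →ₗ[k] k) : V ⊗[k] W →ₗ[k] k :=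
  LinearMap.mul' k k ∘ₗ TensorProduct.map f g

@[simp] lemma tmulFun_tmul (f : V →ₗ[k] k) (g : W →ₗ[k] k) (v : V) (w : W) :
    tmulFun f g (v ⊗ₜ w) = f v * g w := by simp [tmulFun]

lemma eq_zero_of_rTensor_eq_zero (u : V ⊗[k] W)
    (h : ∀ f : V →ₗ[k] k, f.rTensor W u = 0) : u = 0 := by
  classical
  let b := Module.Basis.ofVectorSpace k V
  apply (TensorProduct.equivFinsuppOfBasisLeft (N := W) b).injective
  ext i
  have h2 : ∀ u : V ⊗[k] W, (TensorProduct.equivFinsuppOfBasisLeft (N := W) b u) i =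
      TensorProduct.lid k W ((b.coord i).rTensor W u) := by
    intro u
    induction u with
    | zero => simp
    | tmul v w => simp
    | add x y hx hy => simp [hx, hy]
  rw [h2, h]; simp

lemma eq_zero_of_lTensor_eq_zero (u : V ⊗[k] W)
    (h : ∀ f : W →ₗ[k] k, f.lTensor V u = 0) : u = 0 := by
  apply (TensorProduct.comm k V W).injective
  rw [map_zero]
  apply eq_zero_of_rTensor_eq_zero
  intro f
  have h2 : ∀ u : V ⊗[k] W, f.rTensor V (TensorProduct.comm k V W u) =
      TensorProduct.comm k V k (f.lTensor V u) := by
    intro u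
    induction u with
    | zero => simp
    | tmul v w => simp
    | add x y hx hy => simp only [map_add, hx, hy]
  rw [h2, h]; simp

lemma eq_zero_of_tmulFun_eq_zero (u : V ⊗[k] W)
    (h : ∀ (f : V →ₗ[k] k) (g : W →ₗ[k] k), tmulFun f g u = 0) : u = 0 := by
  apply eq_zero_of_rTensor_eq_zero
  intro f
  apply eq_zero_of_lTensor_eq_zero
  intro g
  have := h f g
  apply (TensorProduct.lid k k).injective
  rw [map_zero, ← this]
  induction u with
  | zero => simp
  | tmul v w => simp
  | add x y hx hy => 
    have h2 : ∀ u : V ⊗[k] W, TensorProduct.lid k k (g.lTensor k (f.rTensor W u)) = tmulFun f g u := by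
      intro u
      induction u with
      | zero => simp
      | tmul v w => simp
      | add x y hx hy => simp only [map_add, hx, hy]
    exact h2 _

lemma linear_field_apply (x : k →ₗ[k] k) (c : k) : x c = c * x 1 := by
  conv_lhs => rw [← mul_one c, ← smul_eq_mul, map_smul, smul_eq_mul]

section
variable {U V' W' : Type*} [AddCommGroup U] [Module k U] [AddCommGroup V'] [Module k V']
  [AddCommGroup W'] [Module k W']

lemma tmulFun_map (f : V →ₗ[k] k) (g : W →ₗ[k] k) (p : V' →ₗ[k] V) (q : W' →ₗ[k] W)
    (u : V' ⊗[k] W') : tmulFun f g (TensorProduct.map p q u) = tmulFun (f ∘ₗ p) (g ∘ₗ q) u := by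
  induction u with
  | zero => simp
  | tmul v w => simp
  | add x y hx hy => simp only [map_add, hx, hy]

lemma tmulFun_lTensor (f : V →ₗ[k] k) (g : W →ₗ[k] k) (q : W' →ₗ[k] W)
    (u : V ⊗[k] W') : tmulFun f g (q.lTensor V u) = tmulFun f (g ∘ₗ q) u :=
  tmulFun_map f g LinearMap.id q u

lemma tmulFun_rTensor (f : V →ₗ[k] k) (g : W →ₗ[k] k) (p : V' →ₗ[k] V)
    (u : V' ⊗[k] W) : tmulFun f g (p.rTensor W u) = tmulFun (f ∘ₗ p) g u :=
  tmulFun_map f g p LinearMap.id u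

lemma tmulFun_assoc (f : U →ₗ[k] k) (g : V →ₗ[k] k) (h : W →ₗ[k] k) (u : (U ⊗[k] V) ⊗[k] W) :
    tmulFun f (tmulFun g h) (TensorProduct.assoc k U V W u) = tmulFun (tmulFun f g) h u := by
  induction u with
  | zero => simp
  | tmul v w =>
    induction v with
    | zero => simp
    | tmul v w => simp [mul_assoc]
    | add x y hx hy => simp only [add_tmul, map_add, hx, hy]
  | add x y hx hy => simp only [map_add, hx, hy]

lemma eq_zero_of_tmulFun₃_eq_zero (u : U ⊗[k] (V ⊗[k] W))
    (h : ∀ (e : U →ₗ[k] k) (f : V →ₗ[k] k) (g : W →ₗ[k] k), tmulFun e (tmulFun f g) u = 0) :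
    u = 0 := by
  apply eq_zero_of_rTensor_eq_zero
  intro e
  apply (TensorProduct.lid k _).injective
  rw [map_zero]
  apply eq_zero_of_tmulFun_eq_zero
  intro f g
  have h2 : ∀ u : U ⊗[k] (V ⊗[k] W), tmulFun f g (TensorProduct.lid k _ (e.rTensor _ u)) =
      tmulFun e (tmulFun f g) u := by
    intro u
    induction u with
    | zero => simp
    | tmul v w => simp
    | add x y hx hy => simp only [map_add, hx, hy]
  rw [h2, h]

end

end Separation

section DualHopf
variable (k : Type*) [Field k] (H : Type*) [Ring H] [HopfAlgebra k H] [FiniteDimensional k H]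
open WithConv Coalgebra HopfAlgebra

/-- The dual Hopf algebra: the convolution algebra of functionals. -/
def DualHopf := WithConv (H →ₗ[k] k)

noncomputable instance : Ring (DualHopf k H) := inferInstanceAs (Ring (WithConv (H →ₗ[k] k)))

noncomputable instance : Algebra k (DualHopf k H) :=
  inferInstanceAs (Algebra k (WithConv (H →ₗ[k] k)))

/-- An element of the dual Hopf algebra as a functional. -/
noncomputable def dualFun : DualHopf k H ≃ₗ[k] (H →ₗ[k] k) :=
  WithConv.linearEquiv k (H →ₗ[k] k)

instance : FiniteDimensional k (DualHopf k H) :=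
  Module.Finite.equiv (dualFun k H).symm

/-- Evaluation at an element, as a functional on the dual. -/
noncomputable def evalDual (a : H) : DualHopf k H →ₗ[k] k :=
  LinearMap.applyₗ a ∘ₗ (dualFun k H).toLinearMap

@[simp] lemma evalDual_apply (a : H) (f : DualHopf k H) : evalDual k H a f = (dualFun k H f) a := rfl

lemma exists_evalDual_eq (φ : DualHopf k H →ₗ[k] k) : ∃ a : H, evalDual k H a = φ := by
  obtain ⟨a, ha⟩ := (Module.evalEquiv k H).surjective
    (φ ∘ₗ (dualFun k H).symm.toLinearMap)
  refine ⟨a, ?_⟩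
  ext f
  have := LinearMap.congr_fun ha (dualFun k H f)
  simpa using this

lemma dualHopf_tensor_ext {u v : DualHopf k H ⊗[k] DualHopf k H}
    (h : ∀ a b, tmulFun (evalDual k H a) (evalDual k H b) u =
      tmulFun (evalDual k H a) (evalDual k H b) v) : u = v := by
  rw [← sub_eq_zero]
  apply eq_zero_of_tmulFun_eq_zero
  intro f g
  obtain ⟨a, rfl⟩ := exists_evalDual_eq k H f
  obtain ⟨b, rfl⟩ := exists_evalDual_eq k H g
  rw [map_sub, h, sub_self]

/-- Comultiplication of the dual Hopf algebra. -/
noncomputable def comulD : DualHopf k H →ₗ[k] DualHopf k H ⊗[k] DualHopf k H :=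
  TensorProduct.map (dualFun k H).symm.toLinearMap
    (dualFun k H).symm.toLinearMap ∘ₗ
  (TensorProduct.dualDistribEquiv k H H).symm.toLinearMap ∘ₗ
    (LinearMap.mul' k H).dualMap ∘ₗ (dualFun k H).toLinearMap

lemma tmulFun_comulD (a b : H) (f : DualHopf k H) :
    tmulFun (evalDual k H a) (evalDual k H b) (comulD k H f) = (dualFun k H f) (a * b) := by
  have h : ∀ u : Module.Dual k H ⊗[k] Module.Dual k H,
      tmulFun (evalDual k H a) (evalDual k H b)
        (TensorProduct.map (dualFun k H).symm.toLinearMap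
          (dualFun k H).symm.toLinearMap u) =
      TensorProduct.dualDistribEquiv k H H u (a ⊗ₜ b) := by
    intro u
    induction u with
    | zero => simp
    | tmul v w => simp [TensorProduct.dualDistribEquiv]
    | add x y hx hy => simp only [map_add, hx, hy, LinearMap.add_apply]
  simp only [comulD, LinearMap.comp_apply, LinearEquiv.coe_coe, h, LinearEquiv.apply_symm_apply]
  simp

lemma evalDual_comp_comulD (a b : H) :
    tmulFun (evalDual k H a) (evalDual k H b) ∘ₗ comulD k H = evalDual k H (a * b) :=
  LinearMap.ext fun f => tmulFun_comulD k H a b f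

noncomputable instance : Coalgebra k (DualHopf k H) where
  comul := comulD k H
  counit := evalDual k H 1
  coassoc := by
    ext1 f
    rw [← sub_eq_zero]
    apply eq_zero_of_tmulFun₃_eq_zero
    intro x y z
    obtain ⟨a, rfl⟩ := exists_evalDual_eq k H x
    obtain ⟨b, rfl⟩ := exists_evalDual_eq k H y
    obtain ⟨c, rfl⟩ := exists_evalDual_eq k H z
    rw [map_sub, sub_eq_zero]
    simp only [LinearMap.comp_apply, LinearEquiv.coe_coe, tmulFun_assoc, tmulFun_lTensor,
      tmulFun_rTensor, evalDual_comp_comulD, tmulFun_comulD, mul_assoc]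
  rTensor_counit_comp_comul := by
    ext1 f
    rw [← sub_eq_zero]
    apply eq_zero_of_tmulFun_eq_zero
    intro x y
    obtain ⟨b, rfl⟩ := exists_evalDual_eq k H y
    rw [map_sub, sub_eq_zero]
    simp only [LinearMap.comp_apply, tmulFun_rTensor]
    have : x ∘ₗ evalDual k H 1 = x 1 • evalDual k H 1 := by
      ext f
      rw [LinearMap.comp_apply, linear_field_apply, LinearMap.smul_apply, smul_eq_mul, mul_comm]
    rw [this]
    have h3 : ∀ u, tmulFun (x 1 • evalDual k H 1) (evalDual k H b) u =
      x 1 * tmulFun (evalDual k H 1) (evalDual k H b) u := by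
      intro u
      induction u with
      | zero => simp
      | tmul v w => simp only [tmulFun_tmul, LinearMap.smul_apply, smul_eq_mul]; ring
      | add x y hx hy => simp only [map_add, hx, hy, mul_add]
    rw [h3, tmulFun_comulD]
    simp
  lTensor_counit_comp_comul := by
    ext1 f
    rw [← sub_eq_zero]
    apply eq_zero_of_tmulFun_eq_zero
    intro y x
    obtain ⟨b, rfl⟩ := exists_evalDual_eq k H y
    rw [map_sub, sub_eq_zero]
    simp only [LinearMap.comp_apply, tmulFun_lTensor]
    have : x ∘ₗ evalDual k H 1 = x 1 • evalDual k H 1 := by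
      ext f
      rw [LinearMap.comp_apply, linear_field_apply, LinearMap.smul_apply, smul_eq_mul, mul_comm]
    rw [this]
    have h3 : ∀ u, tmulFun (evalDual k H b) (x 1 • evalDual k H 1) u =
      x 1 * tmulFun (evalDual k H b) (evalDual k H 1) u := by
      intro u
      induction u with
      | zero => simp
      | tmul v w => simp only [tmulFun_tmul, LinearMap.smul_apply, smul_eq_mul]; ring
      | add x y hx hy => simp only [map_add, hx, hy, mul_add]
    rw [h3, tmulFun_comulD]
    simp [mul_comm]

lemma dualHopf_mul_apply (f g : DualHopf k H) (a : H) :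
    dualFun k H (f * g) a = tmulFun (dualFun k H f) (dualFun k H g) (comul a) := rfl

lemma dualHopf_mul_apply_repr (f g : DualHopf k H) {a : H} {ι : Type*} (r : Coalgebra.Repr k a ι) :
    dualFun k H (f * g) a =
      ∑ i ∈ r.index, dualFun k H f (r.left i) * dualFun k H g (r.right i) := by
  rw [dualHopf_mul_apply, ← r.eq]
  simp

lemma tmulFun_comul_dual (a b : H) (f : DualHopf k H) :
    tmulFun (evalDual k H a) (evalDual k H b) (comul f) = (dualFun k H f) (a * b) :=
  tmulFun_comulD k H a b f

lemma dualHopf_counit_apply (f : DualHopf k H) : counit (R := k) f = (dualFun k H f) 1 := rfl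

lemma dualHopf_one_apply (a : H) : dualFun k H 1 a = counit (R := k) a := rfl

/-- Pairing of tensor squares is multiplicative in the dual variable. -/
lemma tmulFun_evalDual_mul (a b : H) (u v : DualHopf k H ⊗[k] DualHopf k H) :
    tmulFun (evalDual k H a) (evalDual k H b) (u * v) =
    ∑ i ∈ (ℛ k a).index, ∑ j ∈ (ℛ k b).index,
      tmulFun (evalDual k H ((ℛ k a).left i)) (evalDual k H ((ℛ k b).left j)) u *
      tmulFun (evalDual k H ((ℛ k a).right i)) (evalDual k H ((ℛ k b).right j)) v := by
  induction u with
  | zero => simp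
  | add x y hx hy => simp only [add_mul, map_add, hx, hy, Finset.sum_add_distrib]
  | tmul p q =>
    induction v with
    | zero => simp
    | add x y hx hy => simp only [mul_add, map_add, hx, hy, Finset.sum_add_distrib]
    | tmul r s =>
      simp only [Algebra.TensorProduct.tmul_mul_tmul, tmulFun_tmul, evalDual_apply]
      rw [dualHopf_mul_apply_repr k H p r (ℛ k a), dualHopf_mul_apply_repr k H q s (ℛ k b), Finset.sum_mul_sum]
      refine Finset.sum_congr rfl fun i _ => Finset.sum_congr rfl fun j _ => ?_
      ring

noncomputable instance : Bialgebra k (DualHopf k H) := Bialgebra.mk' _ _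
  (by simp [dualHopf_counit_apply, dualHopf_one_apply])
  (by
    intro f g
    rw [dualHopf_counit_apply, dualHopf_mul_apply]
    simp [dualHopf_counit_apply, Algebra.TensorProduct.one_def])
  (by
    apply dualHopf_tensor_ext
    intro a b
    rw [tmulFun_comul_dual, Algebra.TensorProduct.one_def]
    simp [dualHopf_one_apply])
  (by
    intro f g
    apply dualHopf_tensor_ext
    intro a b
    rw [tmulFun_comul_dual, tmulFun_evalDual_mul, dualHopf_mul_apply, Bialgebra.comul_mul]
    conv_lhs => rw [← (ℛ k a).eq, ← (ℛ k b).eq, Finset.sum_mul_sum]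
    simp [tmulFun_comul_dual])

/-- The antipode of the dual Hopf algebra. -/
noncomputable def antipodeD : DualHopf k H →ₗ[k] DualHopf k H :=
  (dualFun k H).symm.toLinearMap ∘ₗ
    LinearMap.lcomp k k (antipode k (A := H)) ∘ₗ (dualFun k H).toLinearMap

lemma antipodeD_apply (f : DualHopf k H) (a : H) :
    dualFun k H (antipodeD k H f) a = dualFun k H f (antipode k a) := by
  simp [antipodeD]

lemma dualFun_algebraMap (c : k) (a : H) :
    dualFun k H (algebraMap k (DualHopf k H) c) a = c * counit (R := k) a := by
  rw [Algebra.algebraMap_eq_smul_one, map_smul]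
  simp [dualHopf_one_apply]

noncomputable instance : HopfAlgebra k (DualHopf k H) where
  antipode := antipodeD k H
  mul_antipode_rTensor_comul := by
    ext1 f
    apply (dualFun k H).injective
    ext a
    have h : ∀ u, dualFun k H (LinearMap.mul' k _ ((antipodeD k H).rTensor _ u)) a =
        ∑ i ∈ (ℛ k a).index, tmulFun (evalDual k H (antipode k ((ℛ k a).left i)))
          (evalDual k H ((ℛ k a).right i)) u := by
      intro u
      induction u with
      | zero => simp
      | tmul v w =>
        simp [dualHopf_mul_apply_repr k H _ _ (ℛ k a), antipodeD_apply]
      | add x y hx hy => simp only [map_add, LinearMap.add_apply, hx, hy, Finset.sum_add_distrib]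
    simp only [LinearMap.comp_apply, h, tmulFun_comul_dual, Algebra.linearMap_apply,
      dualFun_algebraMap, dualHopf_counit_apply]
    rw [← map_sum, sum_antipode_mul_eq_smul (ℛ k a), map_smul, smul_eq_mul, mul_comm]
  mul_antipode_lTensor_comul := by
    ext1 f
    apply (dualFun k H).injective
    ext a
    have h : ∀ u, dualFun k H (LinearMap.mul' k _ ((antipodeD k H).lTensor _ u)) a =
        ∑ i ∈ (ℛ k a).index, tmulFun (evalDual k H ((ℛ k a).left i))
          (evalDual k H (antipode k ((ℛ k a).right i))) u := by
      intro u
      induction u with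
      | zero => simp
      | tmul v w =>
        simp [dualHopf_mul_apply_repr k H _ _ (ℛ k a), antipodeD_apply]
      | add x y hx hy => simp only [map_add, LinearMap.add_apply, hx, hy, Finset.sum_add_distrib]
    simp only [LinearMap.comp_apply, h, tmulFun_comul_dual, Algebra.linearMap_apply,
      dualFun_algebraMap, dualHopf_counit_apply]
    rw [← map_sum, sum_mul_antipode_eq_smul (ℛ k a), map_smul, smul_eq_mul, mul_comm]

end DualHopf

section Pairing
open Coalgebra HopfAlgebra

/-- A perfect pairing of Hopf algebras. -/
structure HopfPairing (k : Type*) [Field k] (A B : Type*) [Ring A] [HopfAlgebra k A]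
    [Ring B] [HopfAlgebra k B] where
  /-- The underlying bilinear form. -/
  P : A →ₗ[k] B →ₗ[k] k
  mul_left : ∀ a a' b, P (a * a') b = tmulFun (P a) (P a') (comul b)
  mul_right : ∀ a b b', P a (b * b') = tmulFun (P.flip b) (P.flip b') (comul a)
  one_left : ∀ b, P 1 b = counit b
  one_right : ∀ a, P a 1 = counit a
  left_inj : ∀ a, (∀ b, P a b = 0) → a = 0
  right_inj : ∀ b, (∀ a, P a b = 0) → b = 0

/-- The pairing with sides exchanged. -/
def HopfPairing.symm {k : Type*} [Field k] {A B : Type*} [Ring A] [HopfAlgebra k A]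
    [Ring B] [HopfAlgebra k B] (p : HopfPairing k A B) : HopfPairing k B A where
  P := p.P.flip
  mul_left b b' a := p.mul_right a b b'
  mul_right b a a' := p.mul_left a a' b
  one_left := p.one_right
  one_right := p.one_left
  left_inj := p.right_inj
  right_inj := p.left_inj

/-- The evaluation pairing between a Hopf algebra and its dual. -/
noncomputable def dualPairing (k : Type*) [Field k] (H : Type*) [Ring H] [HopfAlgebra k H]
    [FiniteDimensional k H] : HopfPairing k H (DualHopf k H) where
  P := (dualFun k H).toLinearMap.flip
  mul_left a a' b := (tmulFun_comul_dual k H a a' b).symm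
  mul_right a b b' := rfl
  one_left b := rfl
  one_right a := rfl
  left_inj a h := by
    rw [← Module.forall_dual_apply_eq_zero_iff k]
    intro φ
    simpa using h ((dualFun k H).symm φ)
  right_inj b h := by
    apply (dualFun k H).injective
    ext a
    simpa using h a

end Pairing
end HopfClass

namespace HopfClass

section Sweedler
open WithConv Coalgebra HopfAlgebra
variable {k : Type*} [Field k] {A : Type*} [Ring A] [HopfAlgebra k A]

/-- The map `a ↦ a ⊗ 1`. -/
noncomputable abbrev inl : A →ₐ[k] A ⊗[k] A := Algebra.TensorProduct.includeLeft
/-- The map `a ↦ 1 ⊗ a`. -/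
noncomputable abbrev inr : A →ₐ[k] A ⊗[k] A := Algebra.TensorProduct.includeRight

variable {R : Type*} [Ring R] [Algebra k R]

lemma conv_algHom_mul_antipode (Φ : A →ₐ[k] R) :
    toConv Φ.toLinearMap * toConv (Φ.toLinearMap ∘ₗ antipode k) = 1 := by
  have h := LinearMap.algHom_comp_convMul_distrib Φ (toConv LinearMap.id)
    (toConv (antipode k (A := A)))
  rw [LinearMap.id_mul_antipode] at h
  rw [show Φ.toLinearMap = Φ.toLinearMap ∘ₗ LinearMap.id from rfl, LinearMap.comp_assoc,
    LinearMap.id_comp]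
  apply WithConv.ofConv_injective
  refine Eq.trans h.symm ?_
  ext a; simp

lemma conv_antipode_mul_algHom (Φ : A →ₐ[k] R) :
    toConv (Φ.toLinearMap ∘ₗ antipode k) * toConv Φ.toLinearMap = 1 := by
  have h := LinearMap.algHom_comp_convMul_distrib Φ (toConv (antipode k (A := A)))
    (toConv LinearMap.id)
  rw [LinearMap.antipode_mul_id] at h
  conv_lhs => rw [show toConv Φ.toLinearMap = toConv (Φ.toLinearMap ∘ₗ LinearMap.id) from rfl]
  apply WithConv.ofConv_injective
  refine Eq.trans h.symm ?_
  ext a; simp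

lemma conv_inl_mul_inr : toConv (inl (k := k) (A := A)).toLinearMap * toConv inr.toLinearMap =
    toConv (comul (R := k)) := by
  ext a
  rw [(ℛ k a).convMul_apply]
  simp [(ℛ k a).eq]

lemma conv_comul_mul_inr_antipode :
    toConv (comul (R := k)) * toConv ((inr (k := k) (A := A)).toLinearMap ∘ₗ antipode k) =
    toConv inl.toLinearMap := by
  rw [← conv_inl_mul_inr, mul_assoc, conv_algHom_mul_antipode, mul_one]

lemma comul_antipode_eq_conv :
    toConv (comul ∘ₗ antipode k (A := A)) =
      toConv ((inr (k := k) (A := A)).toLinearMap ∘ₗ antipode k) *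
      toConv (inl.toLinearMap ∘ₗ antipode k) := by
  refine (left_inv_eq_right_inv (a := toConv (comul (R := k) (A := A))) ?_
    LinearMap.comul_right_inv).symm
  rw [← conv_inl_mul_inr]
  simp only [mul_assoc]
  rw [← mul_assoc (toConv (inl.toLinearMap ∘ₗ antipode k)), conv_antipode_mul_algHom, one_mul,
    conv_antipode_mul_algHom]

lemma sum_conv_eq {f g F : A →ₗ[k] R} (h : toConv f * toConv g = toConv F) {a : A} {ι : Type*}
    (r : Coalgebra.Repr k a ι) : ∑ i ∈ r.index, f (r.left i) * g (r.right i) = F a := by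
  have := congrArg (fun f : WithConv (A →ₗ[k] R) => f.ofConv a) h
  simpa only [r.convMul_apply] using this

lemma conv_eq_of_sum {f g F : A →ₗ[k] R}
    (h : ∀ a, ∑ i ∈ (ℛ k a).index, f ((ℛ k a).left i) * g ((ℛ k a).right i) = F a) :
    toConv f * toConv g = toConv F := by
  ext a
  rw [(ℛ k a).convMul_apply]
  exact h a

/-- If `F * Φ = G` then `F = G * (Φ ∘ S)`. -/
lemma conv_solve_right (Φ : A →ₐ[k] R) {F G : A →ₗ[k] R}
    (h : ∀ a, ∑ i ∈ (ℛ k a).index, F ((ℛ k a).left i) * Φ ((ℛ k a).right i) = G a)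
    {a : A} {ι : Type*} (r : Coalgebra.Repr k a ι) :
    ∑ i ∈ r.index, G (r.left i) * Φ (antipode k (r.right i)) = F a := by
  have h1 : toConv F * toConv Φ.toLinearMap = toConv G := conv_eq_of_sum h
  refine sum_conv_eq (g := Φ.toLinearMap ∘ₗ antipode k) ?_ r
  rw [← h1, mul_assoc, conv_algHom_mul_antipode, mul_one]

/-- If `F * (Φ ∘ S) = G` then `F = G * Φ`. -/
lemma conv_solve_right' (Φ : A →ₐ[k] R) {F G : A →ₗ[k] R}
    (h : ∀ a, ∑ i ∈ (ℛ k a).index, F ((ℛ k a).left i) * Φ (antipode k ((ℛ k a).right i)) = G a)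
    {a : A} {ι : Type*} (r : Coalgebra.Repr k a ι) :
    ∑ i ∈ r.index, G (r.left i) * Φ (r.right i) = F a := by
  have h1 : toConv F * toConv (Φ.toLinearMap ∘ₗ antipode k) = toConv G := conv_eq_of_sum h
  refine sum_conv_eq (g := Φ.toLinearMap) ?_ r
  rw [← h1, mul_assoc, conv_antipode_mul_algHom, mul_one]

/-- If `Φ * F = G` then `F = (Φ ∘ S) * G`. -/
lemma conv_solve_left (Φ : A →ₐ[k] R) {F G : A →ₗ[k] R}
    (h : ∀ a, ∑ i ∈ (ℛ k a).index, Φ ((ℛ k a).left i) * F ((ℛ k a).right i) = G a)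
    {a : A} {ι : Type*} (r : Coalgebra.Repr k a ι) :
    ∑ i ∈ r.index, Φ (antipode k (r.left i)) * G (r.right i) = F a := by
  have h1 : toConv Φ.toLinearMap * toConv F = toConv G := conv_eq_of_sum h
  refine sum_conv_eq (f := Φ.toLinearMap ∘ₗ antipode k) ?_ r
  rw [← h1, ← mul_assoc, conv_antipode_mul_algHom, one_mul]

lemma comul_antipode {a : A} {ι : Type*} (r : Coalgebra.Repr k a ι) :
    comul (R := k) (antipode k a) =
      ∑ i ∈ r.index, antipode k (r.right i) ⊗ₜ antipode k (r.left i) := by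
  have h := sum_conv_eq (f := (inr (k := k) (A := A)).toLinearMap ∘ₗ antipode k)
    (g := inl.toLinearMap ∘ₗ antipode k) (F := comul ∘ₗ antipode k (A := A))
    (comul_antipode_eq_conv (k := k) (A := A)).symm r
  rw [LinearMap.comp_apply] at h
  rw [← h]
  refine Finset.sum_congr rfl fun i _ => ?_
  simp only [LinearMap.comp_apply, AlgHom.toLinearMap_apply,
    Algebra.TensorProduct.includeLeft_apply, Algebra.TensorProduct.includeRight_apply,
    Algebra.TensorProduct.tmul_mul_tmul, one_mul, mul_one]

lemma sum_comul_mul_inr_antipode {a : A} {ι : Type*} (r : Coalgebra.Repr k a ι) :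
    ∑ i ∈ r.index, comul (R := k) (r.left i) * (1 ⊗ₜ antipode k (r.right i)) = a ⊗ₜ 1 := by
  have h := sum_conv_eq (f := comul (R := k))
    (g := (inr (k := k) (A := A)).toLinearMap ∘ₗ antipode k) (F := inl.toLinearMap)
    conv_comul_mul_inr_antipode r
  exact h

end Sweedler

section Existence
open WithConv Coalgebra HopfAlgebra
variable (k : Type*) [Field k] (A : Type*) [Ring A] [HopfAlgebra k A]

/-- The left dual action of `A` on its functionals. -/
noncomputable def dualAction : A →ₐ[k] Module.End k (A →ₗ[k] k) :=
  AlgHom.ofLinearMap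
    { toFun := fun a => LinearMap.lcomp k k (LinearMap.mulLeft k (antipode k a))
      map_add' := fun a b => by ext f x; simp [add_mul]
      map_smul' := fun c a => by ext f x; simp }
    (by ext f x; simp)
    (fun a b => by ext f x; simp [antipode_mul_antidistrib])

@[simp] lemma dualAction_apply (a : A) (f : A →ₗ[k] k) (x : A) :
    dualAction k A a f x = f (antipode k a * x) := rfl

/-- `A ⊗ A` acting on `A ⊗ A*`. -/
noncomputable def tensorAction : A ⊗[k] A →ₐ[k] Module.End k (A ⊗[k] (A →ₗ[k] k)) :=
  (Module.endTensorEndAlgHom (R := k) (A := k) (M := A) (N := A →ₗ[k] k)).comp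
    (Algebra.TensorProduct.map (Algebra.lmul k A) (dualAction k A))

@[simp] lemma tensorAction_tmul (a b x : A) (f : A →ₗ[k] k) :
    tensorAction k A (a ⊗ₜ b) (x ⊗ₜ f) = (a * x) ⊗ₜ dualAction k A b f := by
  simp only [tensorAction, AlgHom.comp_apply, Algebra.TensorProduct.map_tmul]
  erw [Module.endTensorEndAlgHom_apply]
  simp

/-- The map `x ↦ x₁ ⊗ S(x₂)`. -/
noncomputable def comulAntipode : A →ₗ[k] A ⊗[k] A :=
  (antipode k (A := A)).lTensor A ∘ₗ comul

lemma comulAntipode_mul (a x : A) {ι : Type*} (r : Coalgebra.Repr k a ι) :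
    comulAntipode k A (a * x) =
      ∑ i ∈ r.index, inl (r.left i) * comulAntipode k A x * inr (antipode k (r.right i)) := by
  simp only [comulAntipode, LinearMap.comp_apply, Bialgebra.comul_mul]
  rw [← r.eq, ← (ℛ k x).eq]
  simp only [map_sum, Algebra.TensorProduct.tmul_mul_tmul, Finset.mul_sum,
    LinearMap.lTensor_tmul, antipode_mul_antidistrib, Finset.sum_mul,
    Algebra.TensorProduct.includeLeft_apply, Algebra.TensorProduct.includeRight_apply, one_mul,
    mul_one]
  exact Finset.sum_comm

lemma sum_comulAntipode_mul (a x : A) {ι : Type*} (r : Coalgebra.Repr k a ι) :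
    ∑ i ∈ r.index, comulAntipode k A (r.left i * x) * inr (r.right i) =
      inl a * comulAntipode k A x := by
  refine conv_solve_right' inr (G := comulAntipode k A ∘ₗ LinearMap.mulRight k x)
    (F := LinearMap.mulRight k (comulAntipode k A x) ∘ₗ inl.toLinearMap) (fun a => ?_) r
  exact (comulAntipode_mul k A a x (ℛ k a)).symm

/-- The map `x ⊗ f ↦ x₁ ⊗ S(x₂) f`. -/
noncomputable def untwist : A ⊗[k] (A →ₗ[k] k) →ₗ[k] A ⊗[k] (A →ₗ[k] k) :=
  TensorProduct.lift (LinearMap.lcomp k _ (TensorProduct.mk k A (A →ₗ[k] k) 1) ∘ₗ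
    (tensorAction k A).toLinearMap ∘ₗ comulAntipode k A)

/-- The map `x ⊗ f ↦ x₁ ⊗ x₂ f`. -/
noncomputable def twist : A ⊗[k] (A →ₗ[k] k) →ₗ[k] A ⊗[k] (A →ₗ[k] k) :=
  TensorProduct.lift (LinearMap.lcomp k _ (TensorProduct.mk k A (A →ₗ[k] k) 1) ∘ₗ
    (tensorAction k A).toLinearMap ∘ₗ comul)

lemma untwist_tmul (x : A) (f : A →ₗ[k] k) :
    untwist k A (x ⊗ₜ f) = tensorAction k A (comulAntipode k A x) (1 ⊗ₜ f) := rfl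

lemma twist_tmul (x : A) (f : A →ₗ[k] k) :
    twist k A (x ⊗ₜ f) = tensorAction k A (comul x) (1 ⊗ₜ f) := rfl

lemma twist_untwist (t : A ⊗[k] (A →ₗ[k] k)) : twist k A (untwist k A t) = t := by
  induction t with
  | zero => simp
  | add x y hx hy => simp only [map_add, hx, hy]
  | tmul x f =>
    have h : untwist k A (x ⊗ₜ f) = ∑ i ∈ (ℛ k x).index,
        (ℛ k x).left i ⊗ₜ dualAction k A (antipode k ((ℛ k x).right i)) f := by
      rw [untwist_tmul, comulAntipode, LinearMap.comp_apply]
      conv_lhs => rw [← (ℛ k x).eq]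
      simp
    have h2 : ∀ i, twist k A ((ℛ k x).left i ⊗ₜ dualAction k A (antipode k ((ℛ k x).right i)) f) =
        tensorAction k A (comul ((ℛ k x).left i) * (1 ⊗ₜ antipode k ((ℛ k x).right i)))
          (1 ⊗ₜ f) := by
      intro i
      rw [twist_tmul, map_mul, Module.End.mul_apply, tensorAction_tmul, one_mul]
    rw [h, map_sum]
    simp only [h2]
    rw [← LinearMap.sum_apply, ← map_sum, sum_comul_mul_inr_antipode]
    simp

lemma untwist_comul (a : A) (t : A ⊗[k] (A →ₗ[k] k)) :
    untwist k A (tensorAction k A (comul a) t) = tensorAction k A (a ⊗ₜ 1) (untwist k A t) := by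
  induction t with
  | zero => simp
  | add x y hx hy => simp only [map_add, hx, hy]
  | tmul x f =>
    conv_lhs => rw [← (ℛ k a).eq]
    have h2 : ∀ i, untwist k A (((ℛ k a).left i * x) ⊗ₜ dualAction k A ((ℛ k a).right i) f) =
        tensorAction k A (comulAntipode k A ((ℛ k a).left i * x) * inr ((ℛ k a).right i))
          (1 ⊗ₜ f) := by
      intro i
      rw [untwist_tmul, map_mul (tensorAction k A), Module.End.mul_apply,
        Algebra.TensorProduct.includeRight_apply,
        tensorAction_tmul, one_mul]
    simp only [map_sum, LinearMap.sum_apply, tensorAction_tmul, h2]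
    rw [← LinearMap.sum_apply, ← map_sum, sum_comulAntipode_mul, map_mul (tensorAction k A), Module.End.mul_apply,
      untwist_tmul]
    rfl

variable [FiniteDimensional k A]

lemma exists_comul_invariant [Nontrivial A] : ∃ w : A ⊗[k] (A →ₗ[k] k), w ≠ 0 ∧
    ∀ a, tensorAction k A (comul a) w = counit (R := k) a • w := by
  let κ : A ⊗[k] (A →ₗ[k] k) ≃ₗ[k] Module.End k A :=
    (TensorProduct.comm k A (A →ₗ[k] k)).trans (dualTensorHomEquiv k A A)
  have hκ : ∀ (x : A) (f : A →ₗ[k] k) (y : A), κ (x ⊗ₜ f) y = f y • x := by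
    intro x f y
    simp [κ]
  have hact : ∀ (a b : A) (t), κ (tensorAction k A (a ⊗ₜ b) t) =
      LinearMap.mulLeft k a ∘ₗ κ t ∘ₗ LinearMap.mulLeft k (antipode k b) := by
    intro a b t
    induction t with
    | zero => simp
    | add x y hx hy => simp only [map_add, hx, hy, LinearMap.comp_add, LinearMap.add_comp]
    | tmul x f => ext y; simp [hκ]
  refine ⟨κ.symm LinearMap.id, ?_, fun a => ?_⟩
  · intro h
    have h1 : (LinearMap.id : A →ₗ[k] A) = 0 := by
      rw [← κ.apply_symm_apply LinearMap.id, h, map_zero]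
    obtain ⟨a, ha⟩ := exists_ne (0 : A)
    exact ha (LinearMap.congr_fun h1 a)
  · apply κ.injective
    ext y
    conv_lhs => rw [← (ℛ k a).eq]
    simp only [map_sum, LinearMap.sum_apply, hact, map_smul, LinearEquiv.apply_symm_apply]
    simp only [LinearMap.comp_apply, LinearMap.id_apply, LinearMap.mulLeft_apply,
      LinearMap.smul_apply, ← mul_assoc]
    rw [← Finset.sum_mul, sum_mul_antipode_eq_smul (ℛ k a), smul_mul_assoc, one_mul]

lemma exists_left_integral [Nontrivial A] :
    ∃ Λ : A, Λ ≠ 0 ∧ ∀ a, a * Λ = counit (R := k) a • Λ := by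
  obtain ⟨w, hw0, hw⟩ := exists_comul_invariant k A
  have ht0 : untwist k A w ≠ 0 := fun h => hw0 (by rw [← twist_untwist k A w, h, map_zero])
  have ht : ∀ a, tensorAction k A (a ⊗ₜ 1) (untwist k A w) = counit (R := k) a • untwist k A w := by
    intro a
    rw [← untwist_comul, hw, map_smul]
  obtain ⟨h, hh⟩ : ∃ h : (A →ₗ[k] k) →ₗ[k] k, h.lTensor A (untwist k A w) ≠ 0 := by
    by_contra! hcon
    exact ht0 (eq_zero_of_lTensor_eq_zero _ hcon)
  refine ⟨TensorProduct.rid k A (h.lTensor A (untwist k A w)), fun h0 => hh ?_, fun a => ?_⟩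
  · rwa [LinearEquiv.map_eq_zero_iff] at h0
  · have h1 : ∀ t, TensorProduct.rid k A (h.lTensor A (tensorAction k A (a ⊗ₜ 1) t)) =
        a * TensorProduct.rid k A (h.lTensor A t) := by
      intro t
      induction t with
      | zero => simp
      | add x y hx hy => simp only [map_add, hx, hy, mul_add]
      | tmul x f => simp
    rw [← h1, ht]
    simp

end Existence
end HopfClass

namespace HopfClass

section Integrals
open WithConv Coalgebra HopfAlgebra
variable {k : Type*} [Field k] {A : Type*} [Ring A] [HopfAlgebra k A]

/-- The slice map `x ⊗ y ↦ f y • x`. -/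
noncomputable def sliceL (f : A →ₗ[k] k) : A ⊗[k] A →ₗ[k] A :=
  (TensorProduct.rid k A).toLinearMap ∘ₗ f.lTensor A

/-- The slice map `x ⊗ y ↦ f x • y`. -/
noncomputable def sliceR (f : A →ₗ[k] k) : A ⊗[k] A →ₗ[k] A :=
  (TensorProduct.lid k A).toLinearMap ∘ₗ f.rTensor A

@[simp] lemma sliceL_tmul (f : A →ₗ[k] k) (x y : A) : sliceL f (x ⊗ₜ y) = f y • x := by
  simp [sliceL]

@[simp] lemma sliceR_tmul (f : A →ₗ[k] k) (x y : A) : sliceR f (x ⊗ₜ y) = f x • y := by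
  simp [sliceR]

/-- `f` is a left integral in the dual algebra. -/
def IsLeftCoint (f : A →ₗ[k] k) : Prop := ∀ x, sliceL f (comul x) = f x • (1 : A)

/-- `f` is a right integral in the dual algebra. -/
def IsRightCoint (f : A →ₗ[k] k) : Prop := ∀ x, sliceR f (comul x) = f x • (1 : A)

lemma sliceL_mul_tmul (f : A →ₗ[k] k) (x y : A) (u : A ⊗[k] A) :
    sliceL f ((x ⊗ₜ y) * u) = x * sliceL (f ∘ₗ LinearMap.mulLeft k y) u := by
  induction u with
  | zero => simp
  | add u v hu hv => simp only [mul_add, map_add, hu, hv]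
  | tmul a b => simp

lemma sliceL_tmul_mul (f : A →ₗ[k] k) (x y : A) (u : A ⊗[k] A) :
    sliceL f (u * (x ⊗ₜ y)) = sliceL (f ∘ₗ LinearMap.mulRight k y) u * x := by
  induction u with
  | zero => simp
  | add u v hu hv => simp only [add_mul, map_add, hu, hv]
  | tmul a b => simp

lemma sliceR_tmul_mul (f : A →ₗ[k] k) (x y : A) (u : A ⊗[k] A) :
    sliceR f (u * (x ⊗ₜ y)) = sliceR (f ∘ₗ LinearMap.mulRight k x) u * y := by
  induction u with
  | zero => simp
  | add u v hu hv => simp only [add_mul, map_add, hu, hv]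
  | tmul a b => simp

/-- The slices of `u` as a linear map in the functional argument twisted by multiplication. -/
noncomputable def sliceLmul (f : A →ₗ[k] k) (u : A ⊗[k] A) : A →ₗ[k] A where
  toFun a := sliceL (f ∘ₗ LinearMap.mulLeft k a) u
  map_add' a b := by
    induction u with
    | zero => simp
    | add u v hu hv => simp only [map_add, hu, hv]; abel
    | tmul x y => simp [add_mul, add_smul]
  map_smul' c a := by
    induction u with
    | zero => simp
    | add u v hu hv => simp only [map_add, hu, hv, smul_add]
    | tmul x y => simp [mul_smul]

/-- `b₁ λ(a b₂) = S(a₁) λ(a₂ b)` for a left integral `λ`. -/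
lemma IsLeftCoint.sliceL_mulLeft {f : A →ₗ[k] k} (hf : IsLeftCoint f) (b : A) {a : A} {ι : Type*}
    (r : Coalgebra.Repr k a ι) :
    sliceL (f ∘ₗ LinearMap.mulLeft k a) (comul b) =
      ∑ i ∈ r.index, f (r.right i * b) • antipode k (r.left i) := by
  have h := conv_solve_left (AlgHom.id k A) (F := sliceLmul f (comul b))
    (G := (LinearMap.toSpanSingleton k A 1) ∘ₗ f ∘ₗ LinearMap.mulRight k b) ?_ r
  · rw [show sliceL (f ∘ₗ LinearMap.mulLeft k a) (comul b) = sliceLmul f (comul b) a from rfl, ← h]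
    simp
  · intro a
    simp only [sliceLmul, LinearMap.coe_mk, AddHom.coe_mk, AlgHom.id_apply, ← sliceL_mul_tmul]
    rw [← map_sum, ← Finset.sum_mul, (ℛ k a).eq, ← Bialgebra.comul_mul, hf]
    simp

/-- `x₁ λ(x₂ S(h)) = λ(x S(h₁)) h₂` for a left integral `λ`. -/
lemma IsLeftCoint.sliceL_mulRight_antipode {f : A →ₗ[k] k} (hf : IsLeftCoint f) (x : A) {h : A}
    {ι : Type*} (r : Coalgebra.Repr k h ι) :
    sliceL (f ∘ₗ LinearMap.mulRight k (antipode k h)) (comul x) =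
      ∑ i ∈ r.index, f (x * antipode k (r.left i)) • r.right i := by
  let F : A →ₗ[k] A :=
    { toFun := fun h => sliceL (f ∘ₗ LinearMap.mulRight k (antipode k h)) (comul x)
      map_add' := fun a b => by
        generalize comul (R := k) x = u
        induction u with
        | zero => simp
        | add u v hu hv => simp only [map_add (sliceL _), hu, hv]; abel
        | tmul x y => simp [mul_add, add_smul]
      map_smul' := fun c a => by
        generalize comul (R := k) x = u
        induction u with
        | zero => simp
        | add u v hu hv => simp only [map_add, hu, hv, smul_add]
        | tmul x y => simp [mul_smul] }
  have h1 := conv_solve_right' (AlgHom.id k A) (F := F)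
    (G := (LinearMap.toSpanSingleton k A 1) ∘ₗ f ∘ₗ LinearMap.mulLeft k x ∘ₗ antipode k) ?_ r
  · rw [show sliceL (f ∘ₗ LinearMap.mulRight k (antipode k h)) (comul x) = F h from rfl, ← h1]
    simp
  · intro a
    simp only [F, LinearMap.coe_mk, AddHom.coe_mk, AlgHom.id_apply, ← sliceL_tmul_mul]
    rw [← map_sum, ← Finset.mul_sum, ← comul_antipode, ← Bialgebra.comul_mul, hf]
    simp

/-- `λ(b₁ a) b₂ = λ(b a₁) S(a₂)` for a right integral `λ`. -/
lemma IsRightCoint.sliceR_mulRight {f : A →ₗ[k] k} (hf : IsRightCoint f) (b : A) {a : A}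
    {ι : Type*} (r : Coalgebra.Repr k a ι) :
    sliceR (f ∘ₗ LinearMap.mulRight k a) (comul b) =
      ∑ i ∈ r.index, f (b * r.left i) • antipode k (r.right i) := by
  let F : A →ₗ[k] A :=
    { toFun := fun h => sliceR (f ∘ₗ LinearMap.mulRight k h) (comul b)
      map_add' := fun a c => by
        generalize comul (R := k) b = u
        induction u with
        | zero => simp
        | add u v hu hv => simp only [map_add, hu, hv]; abel
        | tmul x y => simp [mul_add, add_smul]
      map_smul' := fun c a => by
        generalize comul (R := k) b = u
        induction u with
        | zero => simp
        | add u v hu hv => simp only [map_add, hu, hv, smul_add]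
        | tmul x y => simp [mul_smul] }
  have h1 := conv_solve_right (AlgHom.id k A) (F := F)
    (G := (LinearMap.toSpanSingleton k A 1) ∘ₗ f ∘ₗ LinearMap.mulLeft k b) ?_ r
  · rw [show sliceR (f ∘ₗ LinearMap.mulRight k a) (comul b) = F a from rfl, ← h1]
    simp
  · intro a
    simp only [F, LinearMap.coe_mk, AddHom.coe_mk, AlgHom.id_apply, ← sliceR_tmul_mul]
    rw [← map_sum, ← Finset.mul_sum, (ℛ k a).eq, ← Bialgebra.comul_mul, hf]
    simp

/-- A left integral `Λ` of `A`. -/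
def IsLeftInt (k : Type*) [Field k] {A : Type*} [Ring A] [HopfAlgebra k A] (Λ : A) : Prop :=
  ∀ a, a * Λ = counit (R := k) a • Λ

/-- A right integral `Λ` of `A`. -/
def IsRightInt (k : Type*) [Field k] {A : Type*} [Ring A] [HopfAlgebra k A] (Λ : A) : Prop :=
  ∀ a, Λ * a = counit (R := k) a • Λ

/-- The left integrals are two-sided. -/
def Unimodular (k : Type*) [Field k] (A : Type*) [Ring A] [HopfAlgebra k A] : Prop :=
  ∀ Λ : A, IsLeftInt k Λ → IsRightInt k Λ

lemma sum_counit_right_smul {a : A} {ι : Type*} (r : Coalgebra.Repr k a ι) :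
    ∑ i ∈ r.index, counit (R := k) (r.right i) • r.left i = a := by
  have h := congrArg (TensorProduct.rid k A) (sum_tmul_counit_eq r)
  simpa only [map_sum, TensorProduct.rid_tmul, one_smul] using h

lemma sum_counit_smul_map {V : Type*} [AddCommGroup V] [Module k V] (f : A →ₗ[k] V) {a : A}
    {ι : Type*} (r : Coalgebra.Repr k a ι) :
    ∑ i ∈ r.index, counit (R := k) (r.left i) • f (r.right i) = f a := by
  simp only [← map_smul, ← map_sum, Coalgebra.sum_counit_smul r]

lemma sum_counit_right_smul_map {V : Type*} [AddCommGroup V] [Module k V] (f : A →ₗ[k] V) {a : A}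
    {ι : Type*} (r : Coalgebra.Repr k a ι) :
    ∑ i ∈ r.index, counit (R := k) (r.right i) • f (r.left i) = f a := by
  simp only [← map_smul, ← map_sum, sum_counit_right_smul r]

lemma sliceL_mulLeft_integral {f : A →ₗ[k] k} (hf : IsLeftCoint f) {Λ : A} (hΛ : IsLeftInt k Λ)
    (a : A) : sliceL (f ∘ₗ LinearMap.mulLeft k a) (comul Λ) = f Λ • antipode k a := by
  rw [hf.sliceL_mulLeft Λ (ℛ k a)]
  simp only [hΛ _, map_smul, smul_eq_mul, mul_comm _ (f Λ), mul_smul, ← Finset.smul_sum]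
  rw [sum_counit_right_smul_map]

lemma sliceR_mulRight_integral {f : A →ₗ[k] k} (hf : IsRightCoint f) {Λ : A} (hΛ : IsRightInt k Λ)
    (a : A) : sliceR (f ∘ₗ LinearMap.mulRight k a) (comul Λ) = f Λ • antipode k a := by
  rw [hf.sliceR_mulRight Λ (ℛ k a)]
  simp only [hΛ _, map_smul, smul_eq_mul, mul_comm _ (f Λ), mul_smul, ← Finset.smul_sum]
  rw [sum_counit_smul_map]

lemma counit_antipode' (a : A) : counit (R := k) (antipode k a) = counit (R := k) a := by
  simp

lemma sliceL_mulRight_antipode_integral {f : A →ₗ[k] k} (hf : IsLeftCoint f) {Λ : A}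
    (hΛ : IsRightInt k Λ) (a : A) :
    sliceL (f ∘ₗ LinearMap.mulRight k (antipode k a)) (comul Λ) = f Λ • a := by
  rw [hf.sliceL_mulRight_antipode Λ (ℛ k a)]
  simp only [hΛ _, map_smul, smul_eq_mul, counit_antipode', mul_comm _ (f Λ), mul_smul,
    ← Finset.smul_sum]
  rw [Coalgebra.sum_counit_smul]

lemma apply_sliceL_eq (f g : A →ₗ[k] k) (u : A ⊗[k] A) :
    g (sliceL f u) = tmulFun g f u := by
  induction u with
  | zero => simp
  | add u v hu hv => simp only [map_add, hu, hv]
  | tmul x y => simp [mul_comm]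

lemma apply_sliceR_eq (f g : A →ₗ[k] k) (u : A ⊗[k] A) :
    g (sliceR f u) = tmulFun f g u := by
  induction u with
  | zero => simp
  | add u v hu hv => simp only [map_add, hu, hv]
  | tmul x y => simp

/-- `λ(S(a) x) = λ(a S(x))` when the integrals are two-sided. -/
lemma antipode_transpose {f : A →ₗ[k] k} (hfl : IsLeftCoint f) (hfr : IsRightCoint f) {Λ : A}
    (hl : IsLeftInt k Λ) (hr : IsRightInt k Λ) (hΛ : f Λ = 1) (a x : A) :
    f (antipode k a * x) = f (a * antipode k x) := by
  have h1 : antipode k a = sliceL (f ∘ₗ LinearMap.mulLeft k a) (comul Λ) := by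
    rw [sliceL_mulLeft_integral hfl hl, hΛ, one_smul]
  have h2 : antipode k x = sliceR (f ∘ₗ LinearMap.mulRight k x) (comul Λ) := by
    rw [sliceR_mulRight_integral hfr hr, hΛ, one_smul]
  have e1 : f (antipode k a * x) = tmulFun (f ∘ₗ LinearMap.mulRight k x)
      (f ∘ₗ LinearMap.mulLeft k a) (comul Λ) := by
    rw [h1]; exact apply_sliceL_eq _ (f ∘ₗ LinearMap.mulRight k x) _
  have e2 : f (a * antipode k x) = tmulFun (f ∘ₗ LinearMap.mulRight k x)
      (f ∘ₗ LinearMap.mulLeft k a) (comul Λ) := by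
    rw [h2]; exact apply_sliceR_eq _ (f ∘ₗ LinearMap.mulLeft k a) _
  rw [e1, e2]

lemma nakayama {f : A →ₗ[k] k} (hfl : IsLeftCoint f) (hfr : IsRightCoint f) {Λ : A}
    (hl : IsLeftInt k Λ) (hr : IsRightInt k Λ) (hΛ : f Λ = 1) (a x : A) :
    f (x * a) = f (a * antipode k (antipode k x)) := by
  have h1 : x = sliceL (f ∘ₗ LinearMap.mulRight k (antipode k x)) (comul Λ) := by
    rw [sliceL_mulRight_antipode_integral hfl hr, hΛ, one_smul]
  have h2 : antipode k a = sliceR (f ∘ₗ LinearMap.mulRight k a) (comul Λ) := by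
    rw [sliceR_mulRight_integral hfr hr, hΛ, one_smul]
  rw [← antipode_transpose hfl hfr hl hr hΛ]
  have e1 : f (x * a) = tmulFun (f ∘ₗ LinearMap.mulRight k a)
      (f ∘ₗ LinearMap.mulRight k (antipode k x)) (comul Λ) := by
    conv_lhs => rw [h1]
    exact apply_sliceL_eq _ (f ∘ₗ LinearMap.mulRight k a) _
  have e2 : f (antipode k a * antipode k x) = tmulFun (f ∘ₗ LinearMap.mulRight k a)
      (f ∘ₗ LinearMap.mulRight k (antipode k x)) (comul Λ) := by
    rw [h2]; exact apply_sliceR_eq _ (f ∘ₗ LinearMap.mulRight k (antipode k x)) _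
  rw [e1, e2]

section FD
variable [FiniteDimensional k A]

lemma IsLeftCoint.eq_zero_of_mul_antipode {f : A →ₗ[k] k} (hf : IsLeftCoint f) (hf0 : f ≠ 0) {h : A}
    (hh : ∀ x, f (x * antipode k h) = 0) : h = 0 := by
  have key : ∀ h : A, (∀ x, f (x * antipode k h) = 0) → ∀ φ : A →ₗ[k] k, ∀ x,
      f (x * antipode k (sliceL φ (comul h))) = 0 := by
    intro h hh φ x
    have h1 := hf.sliceL_mulRight_antipode x (ℛ k h)
    have h0 : f ∘ₗ LinearMap.mulRight k (antipode k h) = 0 := by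
      ext y
      simpa using hh y
    have h2 := congrArg φ h1
    rw [h0, apply_sliceL_eq] at h2
    rw [← (ℛ k h).eq]
    simp only [map_sum, sliceL_tmul, map_smul, Finset.mul_sum, mul_smul_comm, smul_eq_mul]
    simp only [map_sum, map_smul, smul_eq_mul] at h2
    rw [← (ℛ k x).eq] at h2
    simp only [map_sum, tmulFun_tmul, LinearMap.zero_apply, mul_zero, Finset.sum_const_zero] at h2
    rw [h2]
    exact Finset.sum_congr rfl fun _ _ => mul_comm _ _
  have hε : ∀ h : A, (∀ x, f (x * antipode k h) = 0) → counit (R := k) h = 0 := by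
    intro h hh
    let b := Module.finBasis k A
    have h1 : ∀ u : A ⊗[k] A, ∑ i, sliceL (b.coord i) u * antipode k (b i) =
        LinearMap.mul' k A ((antipode k (A := A)).lTensor A u) := by
      intro u
      induction u with
      | zero => simp
      | add u v hu hv => simp only [map_add, add_mul, Finset.sum_add_distrib, hu, hv]
      | tmul x y =>
        simp only [sliceL_tmul, LinearMap.lTensor_tmul, LinearMap.mul'_apply, smul_mul_assoc]
        conv_rhs => rw [← b.sum_repr y]
        simp only [map_sum, map_smul, Finset.mul_sum, mul_smul_comm]
        rfl
    have h2 := h1 (comul h)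
    rw [mul_antipode_lTensor_comul_apply] at h2
    by_contra hne
    apply hf0
    ext x
    have h3 : f (x * antipode k (algebraMap k A (counit (R := k) h))) = 0 := by
      rw [← h2]
      simp only [map_sum, antipode_mul_antidistrib, Finset.mul_sum, ← mul_assoc]
      exact Finset.sum_eq_zero fun i _ => key h hh _ _
    rw [Algebra.algebraMap_eq_smul_one, map_smul, antipode_one, mul_smul_comm, mul_one, map_smul,
      smul_eq_mul] at h3
    simpa [hne] using h3
  rw [← Module.forall_dual_apply_eq_zero_iff k]
  intro φ
  have h1 := hε _ (key h hh φ)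
  rw [apply_sliceL_eq, ← (ℛ k h).eq] at h1
  simp only [map_sum, tmulFun_tmul] at h1
  rw [← h1]
  conv_lhs => rw [← sum_counit_smul_map φ (ℛ k h)]
  simp

lemma antipode_injective_of_coint {f : A →ₗ[k] k} (hf : IsLeftCoint f) (hf0 : f ≠ 0) :
    Function.Injective (antipode k (A := A)) := by
  rw [injective_iff_map_eq_zero]
  intro a ha
  exact hf.eq_zero_of_mul_antipode hf0 (fun x => by simp [ha])

lemma IsLeftCoint.eq_zero_of_mul {f : A →ₗ[k] k} (hf : IsLeftCoint f) (hf0 : f ≠ 0) {b : A}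
    (hb : ∀ x, f (x * b) = 0) : b = 0 := by
  obtain ⟨h, rfl⟩ := (LinearMap.injective_iff_surjective.1 (antipode_injective_of_coint hf hf0)) b
  rw [hf.eq_zero_of_mul_antipode hf0 hb, map_zero]

lemma IsLeftCoint.apply_integral_ne_zero {f : A →ₗ[k] k} (hf : IsLeftCoint f) (hf0 : f ≠ 0) {Λ : A}
    (hΛ : IsLeftInt k Λ) (h0 : Λ ≠ 0) : f Λ ≠ 0 := fun h =>
  h0 (hf.eq_zero_of_mul hf0 fun x => by rw [hΛ, map_smul, h, smul_zero])

lemma IsLeftCoint.integral_unique {f : A →ₗ[k] k} (hf : IsLeftCoint f) (hf0 : f ≠ 0) {Λ Λ' : A}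
    (hΛ : IsLeftInt k Λ) (hΛ' : IsLeftInt k Λ') : f Λ • Λ' = f Λ' • Λ := by
  rw [← sub_eq_zero]
  refine hf.eq_zero_of_mul hf0 fun x => ?_
  simp only [mul_sub, mul_smul_comm, hΛ x, hΛ' x, map_sub, map_smul, smul_eq_mul]
  ring

end FD
end Integrals
end HopfClass

namespace HopfClass

section Radford
open WithConv Coalgebra HopfAlgebra
variable {k : Type*} [Field k] {A : Type*} [Ring A] [HopfAlgebra k A]

/-- Averaging with an integral. -/
noncomputable def average (Λ : A) (p : A →ₗ[k] A) (x : A) : A :=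
  LinearMap.mul' k A ((p ∘ₗ LinearMap.mulRight k x).lTensor A (comulAntipode k A Λ))

lemma inl_mul_comulAntipode {Λ : A} (hΛ : IsLeftInt k Λ) (a : A) :
    inl a * comulAntipode k A Λ = comulAntipode k A Λ * inr a := by
  rw [← sum_comulAntipode_mul k A a Λ (ℛ k a)]
  simp only [hΛ _, map_smul, smul_mul_assoc]
  conv_rhs => rw [← Coalgebra.sum_counit_smul (ℛ k a)]
  simp only [map_sum, map_smul, Finset.mul_sum, mul_smul_comm]

lemma average_mul {Λ : A} (hΛ : IsLeftInt k Λ) (p : A →ₗ[k] A) (a x : A) :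
    average Λ p (a * x) = a * average Λ p x := by
  have h1 : ∀ u : A ⊗[k] A, LinearMap.mul' k A ((p ∘ₗ LinearMap.mulRight k (a * x)).lTensor A u) =
      LinearMap.mul' k A ((p ∘ₗ LinearMap.mulRight k x).lTensor A (u * inr a)) := by
    intro u
    induction u with
    | zero => simp
    | add u v hu hv => simp only [map_add, add_mul, hu, hv]
    | tmul y z => simp [mul_assoc]
  have h2 : ∀ u : A ⊗[k] A, a * LinearMap.mul' k A ((p ∘ₗ LinearMap.mulRight k x).lTensor A u) =
      LinearMap.mul' k A ((p ∘ₗ LinearMap.mulRight k x).lTensor A (inl a * u)) := by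
    intro u
    induction u with
    | zero => simp
    | add u v hu hv => simp only [map_add, mul_add, hu, hv]
    | tmul y z => simp [mul_assoc]
  rw [average, average, h1, h2, inl_mul_comulAntipode hΛ]

lemma average_add (Λ : A) (p : A →ₗ[k] A) (x y : A) :
    average Λ p (x + y) = average Λ p x + average Λ p y := by
  unfold average
  generalize comulAntipode k A Λ = u
  induction u with
  | zero => simp
  | add u v hu hv => simp only [map_add (LinearMap.lTensor _ _), map_add (LinearMap.mul' k A), hu, hv]; abel
  | tmul y z => simp [mul_add]

lemma average_mem (Λ : A) (p : A →ₗ[k] A) (I : Submodule A A) (hp : ∀ x, p x ∈ I) (x : A) :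
    average Λ p x ∈ I := by
  unfold average
  generalize comulAntipode k A Λ = u
  induction u with
  | zero => simp
  | add u v hu hv =>
    simp only [map_add (LinearMap.lTensor _ _), map_add (LinearMap.mul' k A)]
    exact I.add_mem hu hv
  | tmul y z => simpa using I.smul_mem y (hp (z * x))

lemma average_eq (Λ : A) (p : A →ₗ[k] A) (I : Submodule A A) (hp : ∀ x ∈ I, p x = x) (x : A)
    (hx : x ∈ I) : average Λ p x = counit (R := k) Λ • x := by
  have h1 : ∀ u : A ⊗[k] A, LinearMap.mul' k A ((p ∘ₗ LinearMap.mulRight k x).lTensor A u) =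
      LinearMap.mul' k A u * x := by
    intro u
    induction u with
    | zero => simp
    | add u v hu hv => simp only [map_add, add_mul, hu, hv]
    | tmul y z =>
      have : p (z * x) = z * x := hp _ (I.smul_mem z hx)
      simp [this, mul_assoc]
  rw [average, h1, comulAntipode, LinearMap.comp_apply, mul_antipode_lTensor_comul_apply,
    Algebra.smul_def]

/-- Maschke's theorem for Hopf algebras. -/
lemma isSemisimpleRing_of_counit_ne_zero {Λ : A} (hΛ : IsLeftInt k Λ)
    (h0 : counit (R := k) Λ ≠ 0) : IsSemisimpleRing A := by
  refine (isSemisimpleModule_iff A A).2 ⟨fun I => ?_⟩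
  obtain ⟨g, hg⟩ := LinearMap.exists_leftInverse_of_injective (I.restrictScalars k).subtype
    (Submodule.ker_subtype _)
  let p : A →ₗ[k] A := (I.restrictScalars k).subtype ∘ₗ g
  have hp1 : ∀ x, p x ∈ I := fun x => (g x).2
  have hp2 : ∀ x ∈ I, p x = x := fun x hx => by
    have := LinearMap.congr_fun hg ⟨x, hx⟩
    simp only [LinearMap.comp_apply, Submodule.subtype_apply, LinearMap.id_apply] at this
    simp [p, this]
  have hΛ' : IsLeftInt k ((counit (R := k) Λ)⁻¹ • Λ) := fun a => by
    rw [mul_smul_comm, hΛ, smul_comm]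
  let q : A →ₗ[A] I :=
    { toFun := fun x => ⟨average ((counit (R := k) Λ)⁻¹ • Λ) p x, average_mem _ _ I hp1 x⟩
      map_add' := fun x y => Subtype.ext (average_add _ _ _ _)
      map_smul' := fun a x => Subtype.ext (average_mul hΛ' _ _ _) }
  refine ⟨LinearMap.ker q, LinearMap.isCompl_of_proj (f := q) fun x => Subtype.ext ?_⟩
  change average _ p x = x
  rw [average_eq _ p I hp2 _ x.2]
  simp [h0]

lemma trace_antipode_sq [FiniteDimensional k A] {f : A →ₗ[k] k} (hf : IsLeftCoint f) {Λ : A}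
    (hl : IsLeftInt k Λ) (hΛ : f Λ = 1) :
    LinearMap.trace k A (antipode k ∘ₗ antipode k) = counit (R := k) Λ * f 1 := by
  have h1 : ∀ u : A ⊗[k] A, LinearMap.trace k A (sliceLmul f u ∘ₗ antipode k) =
      f (LinearMap.mul' k A ((antipode k (A := A)).rTensor A u)) := by
    intro u
    induction u with
    | zero =>
      have : sliceLmul f (0 : A ⊗[k] A) = 0 := by ext; simp [sliceLmul]
      simp [this]
    | add u v hu hv =>
      have : sliceLmul f (u + v) = sliceLmul f u + sliceLmul f v := by ext; simp [sliceLmul]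
      simp only [map_add, this, LinearMap.add_comp, hu, hv]
    | tmul x y =>
      have : sliceLmul f (x ⊗ₜ[k] y) ∘ₗ antipode k =
          (f ∘ₗ LinearMap.mulRight k y ∘ₗ antipode k).smulRight x := by ext; simp [sliceLmul]
      rw [this, LinearMap.trace_smulRight]
      simp
  have h2 : antipode k ∘ₗ antipode k = sliceLmul f (comul Λ) ∘ₗ antipode k := by
    ext a
    simp only [LinearMap.comp_apply]
    rw [show sliceLmul f (comul Λ) (antipode k a) = sliceL (f ∘ₗ LinearMap.mulLeft k (antipode k a))
      (comul Λ) from rfl, sliceL_mulLeft_integral hf hl, hΛ, one_smul]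
  rw [h2, h1, mul_antipode_rTensor_comul_apply, Algebra.algebraMap_eq_smul_one, map_smul, smul_eq_mul]

lemma antipode_pow_four [FiniteDimensional k A] {f : A →ₗ[k] k} (hfl : IsLeftCoint f)
    (hfr : IsRightCoint f) {Λ : A} (hl : IsLeftInt k Λ) (hr : IsRightInt k Λ) (hΛ : f Λ = 1) (a : A) :
    antipode k (antipode k (antipode k (antipode k a))) = a := by
  have hf0 : f ≠ 0 := fun h => by simp [h] at hΛ
  rw [← sub_eq_zero]
  refine hfl.eq_zero_of_mul hf0 fun x => ?_
  rw [mul_sub, map_sub, sub_eq_zero]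
  exact (nakayama hfl hfr hl hr hΛ x _).symm.trans
    ((antipode_transpose hfl hfr hl hr hΛ _ _).trans
      ((antipode_transpose hfl hfr hl hr hΛ _ _).trans (nakayama hfl hfr hl hr hΛ a x).symm))

lemma exists_trace_eq_natCast {V : Type*} [AddCommGroup V] [Module k V] [FiniteDimensional k V]
    (e : V →ₗ[k] V) (he : e * e = e) :
    LinearMap.trace k V e = (Module.finrank k (LinearMap.range e) : k) :=
  LinearMap.IsProj.trace ((LinearMap.isProj_range_iff_isIdempotentElem e).2 he)

lemma trace_ne_zero_of_sq_eq_one [CharZero k] {V : Type*} [AddCommGroup V] [Module k V]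
    [FiniteDimensional k V] (hodd : Odd (Module.finrank k V)) (T : V →ₗ[k] V) (hT : T * T = 1) :
    LinearMap.trace k V T ≠ 0 := by
  intro h0
  have h2 : (2 : k) ≠ 0 := two_ne_zero
  let e : V →ₗ[k] V := (2⁻¹ : k) • (1 + T)
  have he : e * e = e := by
    simp only [e, smul_mul_smul_comm, add_mul, mul_add, hT, one_mul, mul_one]
    rw [show (1 : V →ₗ[k] V) + T + (T + 1) = (2 : k) • (1 + T) by rw [two_smul]; abel, smul_smul]
    congr 1
    field_simp
  have h := exists_trace_eq_natCast e he
  simp only [e, map_smul, map_add, LinearMap.trace_one, h0, add_zero, smul_eq_mul] at h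
  have h3 : (Module.finrank k V : k) = (2 * Module.finrank k (LinearMap.range e) : ℕ) := by
    push_cast
    rw [← h]
    field_simp
  have h4 := Nat.cast_injective h3
  rw [h4] at hodd
  exact (Nat.not_odd_iff_even.2 (even_two_mul _)) hodd

section Dual
variable (k A) [FiniteDimensional k A]

lemma isLeftCoint_of_isLeftInt {β : DualHopf k A} (h : IsLeftInt k β) :
    IsLeftCoint (dualFun k A β) := by
  intro x
  rw [← sub_eq_zero, ← Module.forall_dual_apply_eq_zero_iff k]
  intro φ
  have h1 := congrArg (fun b => dualFun k A b x) (h ((dualFun k A).symm φ))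
  simp only [dualHopf_mul_apply, LinearEquiv.apply_symm_apply, map_smul, dualHopf_counit_apply,
    LinearMap.smul_apply, smul_eq_mul] at h1
  rw [map_sub, apply_sliceL_eq, h1, map_smul, smul_eq_mul]
  ring

lemma isRightCoint_of_isRightInt {β : DualHopf k A} (h : IsRightInt k β) :
    IsRightCoint (dualFun k A β) := by
  intro x
  rw [← sub_eq_zero, ← Module.forall_dual_apply_eq_zero_iff k]
  intro φ
  have h1 := congrArg (fun b => dualFun k A b x) (h ((dualFun k A).symm φ))
  simp only [dualHopf_mul_apply, LinearEquiv.apply_symm_apply, map_smul, dualHopf_counit_apply,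
    LinearMap.smul_apply, smul_eq_mul] at h1
  rw [map_sub, apply_sliceR_eq, h1, map_smul, smul_eq_mul]
  ring

instance [Nontrivial A] : Nontrivial (DualHopf k A) :=
  (dualFun k A).toEquiv.nontrivial

lemma exists_isLeftCoint [Nontrivial A] : ∃ f : A →ₗ[k] k, f ≠ 0 ∧ IsLeftCoint f := by
  obtain ⟨β, h0, h⟩ := exists_left_integral k (DualHopf k A)
  exact ⟨dualFun k A β, by simpa using h0, isLeftCoint_of_isLeftInt k A h⟩

/-- Integrals of unimodular-counimodular Hopf algebras of odd dimension have nonzero counit. -/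
lemma counit_ne_zero_of_unimodular [CharZero k] [Nontrivial A] (hA : Unimodular k A)
    (hB : Unimodular k (DualHopf k A)) (hodd : Odd (Module.finrank k A)) {Λ : A}
    (hl : IsLeftInt k Λ) (h0 : Λ ≠ 0) : counit (R := k) Λ ≠ 0 := by
  obtain ⟨β, hβ0, hβ⟩ := exists_left_integral k (DualHopf k A)
  set f := dualFun k A β with hf
  have hf0 : f ≠ 0 := by simpa [hf] using hβ0
  have hfl : IsLeftCoint f := isLeftCoint_of_isLeftInt k A hβ
  have hfr : IsRightCoint f := isRightCoint_of_isRightInt k A (hB β hβ)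
  have hne := hfl.apply_integral_ne_zero hf0 hl h0
  intro hε
  set Λ' := (f Λ)⁻¹ • Λ with hΛ'
  have hl' : IsLeftInt k Λ' := fun a => by rw [hΛ', mul_smul_comm, hl, smul_comm]
  have h1 : f Λ' = 1 := by simp [hΛ', hne]
  have ht := trace_antipode_sq hfl hl' h1
  rw [hΛ', map_smul, hε, smul_zero, zero_mul] at ht
  refine trace_ne_zero_of_sq_eq_one hodd _ ?_ ht
  ext a
  exact antipode_pow_four hfl hfr hl' (hA _ hl') h1 a

/-- The distinguished character of a left integral. -/
lemma exists_distinguished [Nontrivial A] {Λ : A} (hl : IsLeftInt k Λ) (h0 : Λ ≠ 0) :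
    ∃ α : A →ₐ[k] k, ∀ a, Λ * a = α a • Λ := by
  obtain ⟨f, hf0, hf⟩ := exists_isLeftCoint k A
  have hne := hf.apply_integral_ne_zero hf0 hl h0
  have key : ∀ a, Λ * a = ((f Λ)⁻¹ * f (Λ * a)) • Λ := by
    intro a
    have h1 : IsLeftInt k (Λ * a) := fun b => by rw [← mul_assoc, hl, smul_mul_assoc]
    have h2 := hf.integral_unique hf0 hl h1
    rw [mul_smul, ← h2, smul_smul, inv_mul_cancel₀ hne, one_smul]
  have inj : ∀ c d : k, c • Λ = d • Λ → c = d := fun c d h => smul_left_injective k h0 h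
  refine ⟨AlgHom.ofLinearMap ((f Λ)⁻¹ • (f ∘ₗ LinearMap.mulLeft k Λ)) ?_ ?_, fun a => key a⟩
  · simp [hne]
  · intro a b
    apply inj
    simp only [LinearMap.smul_apply, LinearMap.comp_apply, LinearMap.mulLeft_apply, smul_eq_mul]
    refine (key _).symm.trans ?_
    rw [← mul_assoc]
    refine (congrArg (· * b) (key a)).trans ?_
    refine (smul_mul_assoc _ _ _).trans ?_
    exact (congrArg _ (key b)).trans (mul_smul _ _ _).symm

lemma isRightInt_of_counit_ne_zero [Nontrivial A] {Λ : A} (hl : IsLeftInt k Λ)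
    (h0 : counit (R := k) Λ ≠ 0) : IsRightInt k Λ := by
  have hΛ : Λ ≠ 0 := fun h => h0 (by simp [h])
  obtain ⟨α, hα⟩ := exists_distinguished k A hl hΛ
  intro a
  rw [hα]
  congr 1
  have h1 := congrArg (counit (R := k)) (hα a)
  rw [Bialgebra.counit_mul, map_smul, smul_eq_mul] at h1
  exact (mul_left_cancel₀ h0 (h1.trans (mul_comm _ _))).symm

lemma unimodular_of_counit_ne_zero [Nontrivial A] {Λ : A} (hl : IsLeftInt k Λ)
    (h0 : counit (R := k) Λ ≠ 0) : Unimodular k A := by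
  intro Λ' h'
  obtain ⟨f, hf0, hf⟩ := exists_isLeftCoint k A
  have hΛ : Λ ≠ 0 := fun h => h0 (by simp [h])
  have hne := hf.apply_integral_ne_zero hf0 hl hΛ
  have h2 := hf.integral_unique hf0 hl h'
  have h3 : Λ' = ((f Λ)⁻¹ * f Λ') • Λ := by rw [mul_smul, ← h2, smul_smul, inv_mul_cancel₀ hne, one_smul]
  intro a
  rw [h3, smul_mul_assoc, isRightInt_of_counit_ne_zero k A hl h0, smul_comm]

lemma unimodular_of_unique_character [Nontrivial A]
    (h : ∀ α : A →ₐ[k] k, ∀ a, α a = counit (R := k) a) : Unimodular k A := by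
  intro Λ hl
  by_cases h0 : Λ = 0
  · intro a; simp [h0]
  obtain ⟨α, hα⟩ := exists_distinguished k A hl h0
  intro a
  rw [hα, h]

end Dual
end Radford
end HopfClass

namespace HopfClass

section MatrixData

/-- The simple quotients of a finite dimensional algebra over an algebraically closed field,
together with primitive idempotents lifting diagonal matrix units. -/
structure MatrixData (k : Type*) [Field k] (A : Type*) [Ring A] [Algebra k A] where
  /-- The number of simple quotients. -/
  r : ℕ
  /-- The sizes of the matrix algebras. -/
  n : Fin r → ℕ
  pos : ∀ t, NeZero (n t)
  /-- The irreducible matrix representations. -/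
  π : ∀ t, A →ₐ[k] Matrix (Fin (n t)) (Fin (n t)) k
  surj : ∀ M : (∀ t, Matrix (Fin (n t)) (Fin (n t)) k), ∃ a, ∀ t, π t a = M t
  jac : ∀ x, x ∈ Ring.jacobson A ↔ ∀ t, π t x = 0
  nil : IsNilpotent (Ring.jacobson A)
  /-- Primitive idempotents. -/
  e : Fin r → A
  e_mul : ∀ t, e t * e t = e t
  π_e : ∀ t, π t (e t) = Matrix.single 0 0 1
  π_e_ne : ∀ s t, s ≠ t → π s (e t) = 0

attribute [instance] MatrixData.pos

lemma isNilpotent_of_mem_jacobson {A : Type*} [Ring A] (h : IsNilpotent (Ring.jacobson A)) {x : A}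
    (hx : x ∈ Ring.jacobson A) : IsNilpotent x := by
  obtain ⟨m, hm⟩ := h
  refine ⟨m, ?_⟩
  have := Ideal.pow_mem_pow hx m
  rwa [hm] at this

lemma exists_matrixData (k : Type*) [Field k] [IsAlgClosed k] (A : Type*) [Ring A] [Algebra k A]
    [FiniteDimensional k A] : Nonempty (MatrixData k A) := by
  have : IsArtinianRing A := IsArtinianRing.of_finite k A
  have hsp : IsSemiprimaryRing A := inferInstance
  obtain ⟨r, n, hn, ⟨φ⟩⟩ := IsSemisimpleRing.exists_algEquiv_pi_matrix_of_isAlgClosed k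
    (A ⧸ Ring.jacobson A)
  let q : A →ₐ[k] A ⧸ Ring.jacobson A := Ideal.Quotient.mkₐ k (Ring.jacobson A)
  have hq : Function.Surjective q := Ideal.Quotient.mkₐ_surjective k _
  let F : A →ₐ[k] (∀ i, Matrix (Fin (n i)) (Fin (n i)) k) := (φ : _ →ₐ[k] _).comp q
  have hF : Function.Surjective F := φ.surjective.comp hq
  have hker : ∀ x, F x = 0 ↔ x ∈ Ring.jacobson A := by
    intro x
    have h1 : F x = φ (q x) := rfl
    rw [h1, map_eq_zero_iff φ φ.injective]
    exact Ideal.Quotient.eq_zero_iff_mem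
  have hlift : ∀ t : Fin r, ∃ e : A, IsIdempotentElem e ∧
      F e = Pi.single t (Matrix.single 0 0 1 : Matrix (Fin (n t)) (Fin (n t)) k) := by
    intro t
    refine exists_isIdempotentElem_eq_of_ker_isNilpotent F.toRingHom ?_ _ ?_ ?_
    · intro x hx
      exact isNilpotent_of_mem_jacobson hsp.isNilpotent ((hker x).1 hx)
    · obtain ⟨a, ha⟩ := hF (Pi.single t (Matrix.single 0 0 1))
      exact ⟨a, ha⟩
    · unfold IsIdempotentElem
      rw [← Pi.single_mul]
      simp
  choose e he hFe using hlift
  refine ⟨⟨r, n, hn, fun t => (Pi.evalAlgHom k _ t).comp F, ?_, ?_, hsp.isNilpotent, e, he, ?_, ?_⟩⟩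
  · intro M
    obtain ⟨a, ha⟩ := hF M
    exact ⟨a, fun t => by simp [ha]⟩
  · intro x
    rw [← hker, funext_iff]
    rfl
  · intro t
    simp [hFe]
  · intro s t hst
    simp [hFe, hst]

variable {k : Type*} [Field k] {A : Type*} [Ring A] [Algebra k A]

/-- The irreducible characters. -/
noncomputable def MatrixData.χ (w : MatrixData k A) (t : Fin w.r) : A →ₗ[k] k :=
  Matrix.traceLinearMap _ k k ∘ₗ (w.π t).toLinearMap

lemma MatrixData.χ_apply (w : MatrixData k A) (t : Fin w.r) (a : A) :
    w.χ t a = (w.π t a).trace := rfl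

lemma MatrixData.χ_one (w : MatrixData k A) (t : Fin w.r) : w.χ t 1 = w.n t := by
  simp [χ_apply]

lemma MatrixData.χ_e (w : MatrixData k A) (t : Fin w.r) : w.χ t (w.e t) = 1 := by
  simp [χ_apply, w.π_e]

lemma MatrixData.χ_e_ne (w : MatrixData k A) {s t : Fin w.r} (h : s ≠ t) : w.χ s (w.e t) = 0 := by
  simp [χ_apply, w.π_e_ne s t h]

lemma MatrixData.χ_e_eq (w : MatrixData k A) (s t : Fin w.r) :
    w.χ s (w.e t) = if s = t then 1 else 0 := by
  split_ifs with h
  · rw [h, χ_e]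
  · exact w.χ_e_ne h

lemma MatrixData.exists_single (w : MatrixData k A) (t : Fin w.r)
    (M : Matrix (Fin (w.n t)) (Fin (w.n t)) k) :
    ∃ a, w.π t a = M ∧ ∀ s, s ≠ t → w.π s a = 0 := by
  obtain ⟨a, ha⟩ := w.surj (Pi.single t M)
  exact ⟨a, by simp [ha], fun s hs => by simp [ha, hs]⟩

/-- A trace-like functional vanishing on the radical is a combination of irreducible characters. -/
lemma MatrixData.eq_sum_χ (w : MatrixData k A) (θ : A →ₗ[k] k) (hθ : ∀ a b, θ (a * b) = θ (b * a))
    (hJ : ∀ x, (∀ t, w.π t x = 0) → θ x = 0) (a : A) :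
    θ a = ∑ t, θ (w.e t) * w.χ t a := by
  classical
  have hlift : ∀ t : Fin w.r, ∀ i j : Fin (w.n t), ∃ a, w.π t a = Matrix.single i j 1 ∧
      ∀ s, s ≠ t → w.π s a = 0 := fun t i j => w.exists_single t _
  choose E hE hE' using hlift
  have hcongr : ∀ x y, (∀ t, w.π t x = w.π t y) → θ x = θ y := by
    intro x y h
    rw [← sub_eq_zero, ← map_sub]
    exact hJ _ fun t => by rw [map_sub, h, sub_self]
  have hval : ∀ t i j, θ (E t i j) = if i = j then θ (w.e t) else 0 := by
    intro t i j
    have h1 : θ (E t i j) = θ (E t i 0 * E t 0 j) := by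
      apply hcongr
      intro s
      by_cases hs : s = t
      · subst hs; simp [hE]
      · simp [hE' _ _ _ s hs]
    rw [h1, hθ]
    split_ifs with hij
    · apply hcongr
      intro s
      by_cases hs : s = t
      · subst hs; simp [hE, hij, w.π_e]
      · simp [hE' _ _ _ s hs, w.π_e_ne s t hs]
    · apply hJ
      intro s
      by_cases hs : s = t
      · subst hs; simp [hE, Ne.symm hij]
      · simp [hE' _ _ _ s hs]
  have h2 : θ a = θ (∑ t, ∑ i, ∑ j, w.π t a i j • E t i j) := by
    apply hcongr
    intro s
    simp only [map_sum, map_smul]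
    rw [Finset.sum_eq_single s]
    · simp only [hE]
      conv_lhs => rw [Matrix.matrix_eq_sum_single (w.π s a)]
      simp
    · intro t _ hts
      simp [hE' _ _ _ s (Ne.symm hts)]
    · simp
  rw [h2]
  simp only [map_sum, map_smul, hval, smul_eq_mul, mul_ite, mul_zero, Finset.sum_ite_eq,
    Finset.mem_univ, if_true]
  refine Finset.sum_congr rfl fun t _ => ?_
  rw [← Finset.sum_mul, mul_comm, χ_apply]
  rfl

/-- Functionals behaving like characters of representations. -/
structure IsCharLike (f : A →ₗ[k] k) : Prop where
  mul_comm : ∀ a b, f (a * b) = f (b * a)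
  nilp : ∀ x, IsNilpotent x → f x = 0
  idem : ∀ e, e * e = e → ∃ m : ℕ, f e = m

lemma isCharLike_of_alghom {V : Type*} [AddCommGroup V] [Module k V] [FiniteDimensional k V]
    (ρ : A →ₐ[k] (V →ₗ[k] V)) : IsCharLike (LinearMap.trace k V ∘ₗ ρ.toLinearMap) where
  mul_comm a b := by
    simp only [LinearMap.comp_apply, AlgHom.toLinearMap_apply, map_mul]
    exact LinearMap.trace_mul_comm k _ _
  nilp x hx := by
    have h1 : IsNilpotent (ρ x) := hx.map ρ
    exact (LinearMap.isNilpotent_trace_of_isNilpotent h1).eq_zero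
  idem e he := ⟨_, exists_trace_eq_natCast (ρ e) (by rw [← map_mul, he])⟩

lemma isCharLike_of_matrix {m : Type*} [Fintype m] [DecidableEq m] (ρ : A →ₐ[k] Matrix m m k) :
    IsCharLike (Matrix.traceLinearMap _ k k ∘ₗ ρ.toLinearMap) := by
  have h := isCharLike_of_alghom ((Matrix.toLinAlgEquiv' : Matrix m m k ≃ₐ[k] _).toAlgHom.comp ρ)
  convert h using 1
  ext a
  exact (Matrix.trace_toLin'_eq (ρ a)).symm

lemma MatrixData.isNilpotent_of_π (w : MatrixData k A) {x : A} (h : ∀ t, w.π t x = 0) :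
    IsNilpotent x := isNilpotent_of_mem_jacobson w.nil ((w.jac x).2 h)

lemma MatrixData.charLike_eq (w : MatrixData k A) {f : A →ₗ[k] k} (hf : IsCharLike f) :
    ∃ N : Fin w.r → ℕ, (∀ t, f (w.e t) = N t) ∧ ∀ a, f a = ∑ t, (N t : k) * w.χ t a := by
  choose N hN using fun t => hf.idem (w.e t) (w.e_mul t)
  refine ⟨N, hN, fun a => ?_⟩
  rw [w.eq_sum_χ f hf.mul_comm (fun x hx => hf.nilp x (w.isNilpotent_of_π hx))]
  simp [hN]

lemma matrix_ideal_eq_top {m : ℕ} (M : Matrix (Fin m) (Fin m) k) (hM : M ≠ 0)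
    (I : Submodule k (Matrix (Fin m) (Fin m) k)) (hI : ∀ X Y, ∀ Z ∈ I, X * Z * Y ∈ I) (hMI : M ∈ I) :
    (1 : Matrix (Fin m) (Fin m) k) ∈ I := by
  obtain ⟨i, j, hij⟩ : ∃ i j, M i j ≠ 0 := by
    by_contra! h
    exact hM (Matrix.ext h)
  have h1 : (1 : Matrix (Fin m) (Fin m) k) =
      ∑ l, (M i j)⁻¹ • (Matrix.single l i 1 * M * Matrix.single j l 1) := by
    simp only [Matrix.single_mul_mul_single, one_mul, mul_one, Matrix.smul_single, smul_eq_mul,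
      inv_mul_cancel₀ hij]
    exact (Matrix.sum_single_one).symm
  rw [h1]
  exact I.sum_mem fun l _ => I.smul_mem _ (hI _ _ _ hMI)

/-- A surjection onto a matrix algebra is one of the irreducible representations up to
conjugation. -/
lemma MatrixData.exists_of_surjective [CharZero k] (w : MatrixData k A) {m : ℕ} (hm : 0 < m)
    (ρ : A →ₐ[k] Matrix (Fin m) (Fin m) k) (hρ : Function.Surjective ρ) :
    ∃ t, m = w.n t ∧ (∀ a, (ρ a).trace = w.χ t a) ∧ ∀ a, ρ a = 0 ↔ w.π t a = 0 := by
  obtain ⟨N, hN, hsum⟩ := w.charLike_eq (isCharLike_of_matrix ρ)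
  have hsum' : ∀ a, (ρ a).trace = ∑ t, (N t : k) * w.χ t a := hsum
  have h1 : m = ∑ t, N t * w.n t := by
    have := hsum' 1
    simp only [map_one, Matrix.trace_one, Fintype.card_fin, χ_one] at this
    exact_mod_cast this
  obtain ⟨t, ht⟩ : ∃ t, N t ≠ 0 := by
    by_contra! h
    simp [h] at h1
    omega
  have hker1 : ∀ a, ρ a = 0 → w.π t a = 0 := by
    intro a ha
    rw [Matrix.ext_iff_trace_mul_right]
    intro M
    rw [zero_mul, Matrix.trace_zero]
    obtain ⟨b, hb, hb'⟩ := w.exists_single t M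
    have h2 := hsum' (a * b)
    rw [map_mul, ha, zero_mul, Matrix.trace_zero, Finset.sum_eq_single t] at h2
    · rw [χ_apply, map_mul, hb] at h2
      have h3 : (N t : k) ≠ 0 := by exact_mod_cast ht
      exact (mul_eq_zero.1 h2.symm).resolve_left h3
    · intro s _ hs
      rw [χ_apply, map_mul, hb' s hs]; simp
    · simp
  have hker2 : ∀ a, w.π t a = 0 → ρ a = 0 := by
    intro a ha
    by_contra hne
    have h1 := matrix_ideal_eq_top (ρ a) hne ((LinearMap.ker (w.π t).toLinearMap).map ρ.toLinearMap)
      (by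
        rintro X Y _ ⟨z, hz, rfl⟩
        obtain ⟨x, rfl⟩ := hρ X
        obtain ⟨y, rfl⟩ := hρ Y
        refine ⟨x * z * y, ?_, by simp⟩
        have hz' : w.π t z = 0 := hz
        simp [hz']) ⟨a, ha, rfl⟩
    obtain ⟨z, hz, hz1⟩ := h1
    have hz' : w.π t z = 0 := hz
    have hz1' : ρ z = 1 := hz1
    have h2 := hker1 (1 - z) (by rw [map_sub, hz1', map_one, sub_self])
    rw [map_sub, hz', map_one, sub_zero] at h2
    exact one_ne_zero h2
  have hdim : m = w.n t := by
    have hsurj : Function.Surjective (w.π t) := fun M => (w.exists_single t M).imp fun a h => h.1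
    have e1 := (Submodule.quotEquivOfEq _ _ (show LinearMap.ker ρ.toLinearMap =
      LinearMap.ker (w.π t).toLinearMap from Submodule.ext fun a => ⟨hker1 a, hker2 a⟩))
    have e2 := LinearMap.quotKerEquivOfSurjective ρ.toLinearMap hρ
    have e3 := LinearMap.quotKerEquivOfSurjective (w.π t).toLinearMap hsurj
    have h4 := ((e2.symm.trans e1).trans e3).finrank_eq
    simp only [Module.finrank_matrix, Fintype.card_fin, Module.finrank_self, mul_one] at h4
    nlinarith [h4]
  refine ⟨t, hdim, ?_, fun a => ⟨hker1 a, hker2 a⟩⟩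
  have hpos : ∀ s, 0 < w.n s := fun s => Nat.pos_of_ne_zero (w.pos s).out
  have hle : ∀ s, s ≠ t → N s = 0 := by
    intro s hs
    by_contra h0
    have h5 : N t * w.n t + N s * w.n s ≤ m := by
      rw [h1, ← Finset.add_sum_erase _ _ (Finset.mem_univ t)]
      gcongr
      exact Finset.single_le_sum (f := fun s => N s * w.n s) (fun _ _ => Nat.zero_le _)
        (Finset.mem_erase.2 ⟨hs, Finset.mem_univ s⟩)
    have h6 : 0 < N s * w.n s := Nat.mul_pos (Nat.pos_of_ne_zero h0) (hpos s)
    have h7 : 1 * w.n t ≤ N t * w.n t := Nat.mul_le_mul_right _ (Nat.one_le_iff_ne_zero.2 ht)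
    omega
  have hN1 : N t = 1 := by
    rw [Finset.sum_eq_single t (fun s _ hs => by rw [hle s hs, zero_mul]) (by simp), hdim] at h1
    have := hpos t
    nlinarith
  intro a
  rw [hsum', Finset.sum_eq_single t (fun s _ hs => by rw [hle s hs]; simp) (by simp), hN1]
  simp

lemma MatrixData.χ_injective (w : MatrixData k A) {s t : Fin w.r} (h : ∀ a, w.χ s a = w.χ t a) :
    s = t := by
  by_contra hne
  have := h (w.e t)
  rw [w.χ_e, w.χ_e_ne hne] at this
  exact zero_ne_one this

lemma MatrixData.π_surjective (w : MatrixData k A) (t : Fin w.r) : Function.Surjective (w.π t) :=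
  fun M => (w.exists_single t M).imp fun _ h => h.1

end MatrixData
end HopfClass

namespace HopfClass

section PairingChars
open WithConv Coalgebra HopfAlgebra
variable {k : Type*} [Field k] {A : Type*} [Ring A] [HopfAlgebra k A] [FiniteDimensional k A]
  {B : Type*} [Ring B] [HopfAlgebra k B] [FiniteDimensional k B]

namespace HopfPairing
variable (p : HopfPairing k A B)

/-- The algebra map from `A` to the dual of `B`. -/
noncomputable def toDual : A →ₐ[k] DualHopf k B :=
  AlgHom.ofLinearMap ((dualFun k B).symm.toLinearMap ∘ₗ p.P)
    (by
      apply (dualFun k B).injective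
      ext b
      simp [dualHopf_one_apply, p.one_left])
    (fun x y => by
      apply (dualFun k B).injective
      ext b
      simp [dualHopf_mul_apply, p.mul_left])

lemma dualFun_toDual (a : A) : dualFun k B (p.toDual a) = p.P a := by
  simp [toDual]

lemma sum_mul_right {a : A} {ι : Type*} (r : Coalgebra.Repr k a ι) (b b' : B) :
    p.P a (b * b') = ∑ i ∈ r.index, p.P (r.left i) b * p.P (r.right i) b' := by
  rw [p.mul_right, ← r.eq]
  simp

lemma sum_mul_left {b : B} {ι : Type*} (r : Coalgebra.Repr k b ι) (a a' : A) :
    p.P (a * a') b = ∑ i ∈ r.index, p.P a (r.left i) * p.P a' (r.right i) := by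
  rw [p.mul_left, ← r.eq]
  simp

lemma antipode_apply (a : A) (b : B) : p.P (antipode k a) b = p.P a (antipode k b) := by
  have h := conv_solve_right p.toDual
    (F := (dualFun k B).symm.toLinearMap ∘ₗ LinearMap.lcomp k k (antipode k (A := B)) ∘ₗ p.P)
    (G := Algebra.linearMap k (DualHopf k B) ∘ₗ counit)
    (fun a => by
      apply (dualFun k B).injective
      ext b
      simp only [map_sum, LinearMap.sum_apply, dualHopf_mul_apply_repr k B _ _ (ℛ k b), dualFun_toDual]
      rw [Finset.sum_comm]
      simp only [LinearMap.comp_apply, LinearEquiv.coe_coe, LinearEquiv.apply_symm_apply,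
        LinearMap.lcomp_apply]
      simp only [← p.sum_mul_right (ℛ k a), ← map_sum, sum_antipode_mul_eq_smul (ℛ k b)]
      simp [dualFun_algebraMap, p.one_right, mul_comm]) (ℛ k a)
  have h2 := congrArg (fun f => dualFun k B f b) h
  simp only [LinearMap.comp_apply, Algebra.linearMap_apply, ← Algebra.smul_def, ← map_smul,
    ← map_sum, Coalgebra.sum_counit_smul, dualFun_toDual] at h2
  simpa using h2


lemma finrank_eq (p : HopfPairing k A B) : Module.finrank k A = Module.finrank k B := by
  apply le_antisymm
  · have h : Function.Injective p.P := (injective_iff_map_eq_zero p.P).2 fun a ha =>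
      p.left_inj a fun b => by rw [ha]; rfl
    have := LinearMap.finrank_le_finrank_of_injective h
    rwa [Subspace.dual_finrank_eq] at this
  · have h : Function.Injective p.P.flip := (injective_iff_map_eq_zero p.P.flip).2 fun b hb =>
      p.right_inj b fun a => by rw [← p.P.flip_apply, hb]; rfl
    have := LinearMap.finrank_le_finrank_of_injective h
    rwa [Subspace.dual_finrank_eq] at this

/-- Functionals on `A` as elements of `B`. -/
noncomputable def funEquiv : B ≃ₗ[k] (A →ₗ[k] k) :=
  LinearMap.linearEquivOfInjective p.P.flip
    ((injective_iff_map_eq_zero p.P.flip).2 fun b hb =>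
      p.right_inj b fun a => by rw [← p.P.flip_apply, hb]; rfl)
    (by rw [← p.finrank_eq]; exact Subspace.dual_finrank_eq.symm)

/-- The element of `B` representing a functional on `A`. -/
noncomputable def ofFun (f : A →ₗ[k] k) : B := p.funEquiv.symm f

@[simp] lemma P_ofFun (f : A →ₗ[k] k) (a : A) : p.P a (p.ofFun f) = f a := by
  have : p.funEquiv (p.ofFun f) = f := p.funEquiv.apply_symm_apply f
  exact congrArg (fun f => f a) this

lemma ext_right {b b' : B} (h : ∀ a, p.P a b = p.P a b') : b = b' := by
  rw [← sub_eq_zero]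
  exact p.right_inj _ fun a => by rw [map_sub, h, sub_self]

lemma ext_left {a a' : A} (h : ∀ b, p.P a b = p.P a' b) : a = a' :=
  p.symm.ext_right h

/-- Elements of `B` which are characters of representations of `A`. -/
def IsRep (b : B) : Prop :=
  ∃ (m : ℕ) (ρ : A →ₐ[k] Matrix (Fin m) (Fin m) k), ∀ a, p.P a b = (ρ a).trace

variable {p}

lemma isRep_of_matrix {m : Type*} [Fintype m] [DecidableEq m] (ρ : A →ₐ[k] Matrix m m k) {b : B}
    (h : ∀ a, p.P a b = (ρ a).trace) : p.IsRep b := by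
  refine ⟨Fintype.card m, (Matrix.reindexAlgEquiv k k (Fintype.equivFin m)).toAlgHom.comp ρ,
    fun a => ?_⟩
  rw [h]
  simp [Matrix.trace, ← (Fintype.equivFin m).symm.sum_comp]

lemma IsRep.mul {b c : B} (hb : p.IsRep b) (hc : p.IsRep c) : p.IsRep (b * c) := by
  obtain ⟨m, ρ, hρ⟩ := hb
  obtain ⟨l, σ, hσ⟩ := hc
  let F : A →ₐ[k] Matrix (Fin m × Fin l) (Fin m × Fin l) (k ⊗[k] k) :=
    ((Matrix.kroneckerTMulAlgEquiv (Fin m) (Fin l) k k k k).toAlgHom.comp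
      (Algebra.TensorProduct.map ρ σ)).comp (Bialgebra.comulAlgHom k A)
  refine isRep_of_matrix ((Algebra.TensorProduct.lid k k).toAlgHom.mapMatrix.comp F) fun a => ?_
  have key : ∀ u : A ⊗[k] A, tmulFun (p.P.flip b) (p.P.flip c) u =
      ((Algebra.TensorProduct.lid k k).toAlgHom.mapMatrix
        (Matrix.kroneckerTMulAlgEquiv (Fin m) (Fin l) k k k k
          (Algebra.TensorProduct.map ρ σ u))).trace := by
    intro u
    induction u with
    | zero => simp
    | add x y hx hy => simp only [map_add, Matrix.trace_add, hx, hy]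
    | tmul x y =>
      simp only [tmulFun_tmul, LinearMap.flip_apply, hρ, hσ, Algebra.TensorProduct.map_tmul]
      simp [Matrix.trace, Fintype.sum_prod_type, Finset.sum_mul_sum]
  rw [p.mul_right, key]
  rfl

lemma IsRep.antipode {b : B} (hb : p.IsRep b) : p.IsRep (antipode k b) := by
  obtain ⟨m, ρ, hρ⟩ := hb
  refine ⟨m, AlgHom.ofLinearMap ((Matrix.transposeLinearEquiv _ _ k k).toLinearMap ∘ₗ ρ.toLinearMap ∘ₗ
    HopfAlgebra.antipode k) ?_ ?_, fun a => ?_⟩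
  · simp
  · intro x y
    simp [antipode_mul_antidistrib]
  · simp [← p.antipode_apply, hρ]

lemma IsRep.isCharLike {b : B} (hb : p.IsRep b) : IsCharLike (p.P.flip b) := by
  obtain ⟨m, ρ, hρ⟩ := hb
  convert isCharLike_of_matrix ρ using 1
  ext a
  simp [hρ]

end HopfPairing
end PairingChars
end HopfClass

namespace HopfClass

section Cartan
variable {k : Type*} [Field k] {A : Type*} [Ring A] [Algebra k A] [FiniteDimensional k A]

/-- The trace of the operator `x ↦ a x b`. -/
noncomputable def biTrace (k : Type*) [Field k] {A : Type*} [Ring A] [Algebra k A] (a b : A) : k :=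
  LinearMap.trace k A (LinearMap.mulLeft k a ∘ₗ LinearMap.mulRight k b)

lemma biTrace_mul_left_comm (a a' b : A) : biTrace k (a * a') b = biTrace k (a' * a) b := by
  have h1 : LinearMap.mulLeft k (a * a') ∘ₗ LinearMap.mulRight k b =
      LinearMap.mulLeft k a * (LinearMap.mulLeft k a' ∘ₗ LinearMap.mulRight k b) := by
    ext x; simp
  have h2 : LinearMap.mulLeft k (a' * a) ∘ₗ LinearMap.mulRight k b =
      (LinearMap.mulLeft k a' ∘ₗ LinearMap.mulRight k b) * LinearMap.mulLeft k a := by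
    ext x; simp [mul_assoc]
  rw [biTrace, biTrace, h1, h2, LinearMap.trace_mul_comm]

lemma biTrace_mul_right_comm (a b b' : A) : biTrace k a (b * b') = biTrace k a (b' * b) := by
  have h1 : LinearMap.mulLeft k a ∘ₗ LinearMap.mulRight k (b * b') =
      LinearMap.mulRight k b' * (LinearMap.mulLeft k a ∘ₗ LinearMap.mulRight k b) := by
    ext x; simp [mul_assoc]
  have h2 : LinearMap.mulLeft k a ∘ₗ LinearMap.mulRight k (b' * b) =
      (LinearMap.mulLeft k a ∘ₗ LinearMap.mulRight k b) * LinearMap.mulRight k b' := by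
    ext x; simp [mul_assoc]
  rw [biTrace, biTrace, h1, h2, LinearMap.trace_mul_comm]

lemma isNilpotent_mulLeft {x : A} (hx : IsNilpotent x) :
    IsNilpotent (LinearMap.mulLeft k x) := by
  obtain ⟨m, hm⟩ := hx
  exact ⟨m, by rw [LinearMap.pow_mulLeft, hm]; ext; simp⟩

lemma isNilpotent_mulRight {x : A} (hx : IsNilpotent x) :
    IsNilpotent (LinearMap.mulRight k x) := by
  obtain ⟨m, hm⟩ := hx
  exact ⟨m, by rw [LinearMap.pow_mulRight, hm]; ext; simp⟩

lemma biTrace_nil_left {x : A} (hx : IsNilpotent x) (b : A) : biTrace k x b = 0 := by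
  have h : Commute (LinearMap.mulLeft k x) (LinearMap.mulRight k b) := by
    ext y; simp [mul_assoc]
  exact (LinearMap.isNilpotent_trace_of_isNilpotent
    (h.isNilpotent_mul_right (isNilpotent_mulLeft hx))).eq_zero

lemma biTrace_nil_right {x : A} (hx : IsNilpotent x) (a : A) : biTrace k a x = 0 := by
  have h : Commute (LinearMap.mulLeft k a) (LinearMap.mulRight k x) := by
    ext y; simp [mul_assoc]
  exact (LinearMap.isNilpotent_trace_of_isNilpotent
    (h.isNilpotent_mul_left (isNilpotent_mulRight hx))).eq_zero

/-- `biTrace` as a linear functional of its first argument. -/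
noncomputable def biTraceL (b : A) : A →ₗ[k] k :=
  LinearMap.trace k A ∘ₗ LinearMap.lcomp k A (LinearMap.mulRight k b) ∘ₗ LinearMap.mul k A

/-- `biTrace` as a linear functional of its second argument. -/
noncomputable def biTraceR (a : A) : A →ₗ[k] k :=
  LinearMap.trace k A ∘ₗ LinearMap.llcomp k A A A (LinearMap.mulLeft k a) ∘ₗ (LinearMap.mul k A).flip

lemma biTraceL_apply (a b : A) : biTraceL b a = biTrace k a b := rfl
lemma biTraceR_apply (a b : A) : biTraceR a b = biTrace k a b := rfl

lemma biTrace_idem {e f : A} (he : e * e = e) (hf : f * f = f) : biTrace k e f =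
    (Module.finrank k (LinearMap.range (LinearMap.mulLeft k e ∘ₗ LinearMap.mulRight k f)) : k) := by
  apply exists_trace_eq_natCast
  ext x
  simp only [Module.End.mul_apply, LinearMap.comp_apply, LinearMap.mulLeft_apply,
    LinearMap.mulRight_apply]
  simp only [← mul_assoc, he]
  simp only [mul_assoc, hf]

namespace MatrixData
variable (w : MatrixData k A)

/-- The Cartan numbers. -/
noncomputable def c (t s : Fin w.r) : ℕ :=
  Module.finrank k (LinearMap.range
    (LinearMap.mulLeft k (w.e t) ∘ₗ LinearMap.mulRight k (w.e s)))

lemma biTrace_e (t s : Fin w.r) : biTrace k (w.e t) (w.e s) = w.c t s :=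
  biTrace_idem (w.e_mul t) (w.e_mul s)

lemma biTrace_left (a b : A) : biTrace k a b = ∑ t, biTrace k (w.e t) b * w.χ t a :=
  w.eq_sum_χ (biTraceL b) (fun x y => biTrace_mul_left_comm x y b)
    (fun _ hx => biTrace_nil_left (w.isNilpotent_of_π hx) b) a

lemma biTrace_right (a b : A) : biTrace k a b = ∑ s, biTrace k a (w.e s) * w.χ s b :=
  w.eq_sum_χ (biTraceR a) (fun x y => biTrace_mul_right_comm a x y)
    (fun _ hx => biTrace_nil_right (w.isNilpotent_of_π hx) a) b

lemma biTrace_eq (a b : A) : biTrace k a b = ∑ t, ∑ s, (w.c t s : k) * w.χ t a * w.χ s b := by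
  rw [w.biTrace_left]
  refine Finset.sum_congr rfl fun t _ => ?_
  rw [w.biTrace_right, Finset.sum_mul]
  refine Finset.sum_congr rfl fun s _ => ?_
  rw [w.biTrace_e]
  ring

lemma e_ne_zero (t : Fin w.r) : w.e t ≠ 0 := by
  intro h
  have := w.χ_e t
  rw [h, map_zero] at this
  exact zero_ne_one this

lemma c_pos (t : Fin w.r) : 0 < w.c t t := by
  rw [c, Module.finrank_pos_iff_exists_ne_zero]
  exact ⟨⟨w.e t, w.e t, by simp [w.e_mul]⟩, fun h => w.e_ne_zero t (congrArg Subtype.val h)⟩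

/-- The dimension of the principal indecomposable module. -/
noncomputable def pd (s : Fin w.r) : ℕ := ∑ t, w.n t * w.c t s

lemma sum_n_pd [CharZero k] : ∑ s, w.n s * w.pd s = Module.finrank k A := by
  have h := w.biTrace_eq (1 : A) 1
  have h1 : biTrace k (1 : A) 1 = Module.finrank k A := by
    rw [biTrace, LinearMap.mulLeft_one, LinearMap.mulRight_one, LinearMap.comp_id]
    exact LinearMap.trace_id k A
  rw [h1] at h
  simp only [χ_one] at h
  have h2 : Module.finrank k A = ∑ t, ∑ s, w.c t s * w.n t * w.n s := by exact_mod_cast h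
  rw [h2, Finset.sum_comm]
  simp only [pd, Finset.mul_sum]
  exact Finset.sum_congr rfl fun s _ => Finset.sum_congr rfl fun t _ => by ring

lemma c_perm [CharZero k] (w' : MatrixData k A) {σ τ : Fin w.r → Fin w'.r}
    (hσ : Function.Injective σ) (hτ : Function.Injective τ)
    (h : ∀ a b, ∑ t, ∑ s, (w.c t s : k) * w'.χ (σ t) a * w'.χ (τ s) b = biTrace k a b)
    (t s : Fin w.r) : w.c t s = w'.c (σ t) (τ s) := by
  have h1 := h (w'.e (σ t)) (w'.e (τ s))
  rw [biTrace_e] at h1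
  simp only [χ_e_eq, hσ.eq_iff, hτ.eq_iff] at h1
  simpa using h1

lemma biTrace_equiv (f : A ≃ₗ[k] A) (hf : ∀ x y, f (x * y) = f x * f y) (a b : A) :
    biTrace k (f a) (f b) = biTrace k a b := by
  conv_rhs => rw [biTrace, ← LinearMap.trace_conj' _ f]
  rw [biTrace]
  congr 1
  ext x
  simp [LinearEquiv.conj_apply, hf]

lemma biTrace_antiEquiv (f : A ≃ₗ[k] A) (hf : ∀ x y, f (x * y) = f y * f x) (a b : A) :
    biTrace k (f a) (f b) = biTrace k b a := by
  conv_rhs => rw [biTrace, ← LinearMap.trace_conj' _ f]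
  rw [biTrace]
  congr 1
  ext x
  simp [LinearEquiv.conj_apply, hf, mul_assoc]

end MatrixData
end Cartan
end HopfClass

namespace HopfClass

section Tensor
open WithConv Coalgebra HopfAlgebra
variable {k : Type*} [Field k] {A : Type*} [Ring A] [HopfAlgebra k A] [FiniteDimensional k A]
  {V : Type*} [AddCommGroup V] [Module k V] [FiniteDimensional k V]
  (ρ : A →ₐ[k] Module.End k V)

/-- The action of `A ⊗ A` on `A ⊗ V`. -/
noncomputable def tensorRep : A ⊗[k] A →ₐ[k] Module.End k (A ⊗[k] V) :=
  (Module.endTensorEndAlgHom (R := k) (A := k) (M := A) (N := V)).comp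
    (Algebra.TensorProduct.map (Algebra.lmul k A) ρ)

lemma tensorRep_tmul (a b : A) :
    tensorRep ρ (a ⊗ₜ b) = TensorProduct.map (LinearMap.mulLeft k a) (ρ b) := by
  ext x v; simp [tensorRep, Module.endTensorEndAlgHom_apply]

/-- The map `x ⊗ v ↦ x₁ ⊗ x₂ v`. -/
noncomputable def fuse : A ⊗[k] V →ₗ[k] A ⊗[k] V :=
  TensorProduct.lift (LinearMap.lcomp k _ (TensorProduct.mk k A V 1) ∘ₗ
    (tensorRep ρ).toLinearMap ∘ₗ comul)

lemma fuse_tmul (x : A) (v : V) : fuse ρ (x ⊗ₜ v) = tensorRep ρ (comul x) (1 ⊗ₜ v) := rfl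

lemma tensorRep_mul_inl (u : A ⊗[k] A) (b : A) (v : V) : tensorRep ρ (u * (b ⊗ₜ 1)) (1 ⊗ₜ v) =
    TensorProduct.map (LinearMap.mulRight k b) LinearMap.id (tensorRep ρ u (1 ⊗ₜ v)) := by
  induction u with
  | zero => simp
  | add x y hx hy => simp only [add_mul, map_add, LinearMap.add_apply, hx, hy]
  | tmul x y => simp [tensorRep_tmul]

lemma tensorRep_mul_inr (u : A ⊗[k] A) (b : A) (v : V) : tensorRep ρ (u * (1 ⊗ₜ b)) (1 ⊗ₜ v) =
    tensorRep ρ u (1 ⊗ₜ ρ b v) := by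
  rw [map_mul, tensorRep_tmul ρ 1 b]
  simp

lemma fuse_surjective : Function.Surjective (fuse ρ) := by
  intro t
  induction t with
  | zero => exact ⟨0, map_zero _⟩
  | add x y hx hy =>
    obtain ⟨a, rfl⟩ := hx
    obtain ⟨b, rfl⟩ := hy
    exact ⟨a + b, map_add _ _ _⟩
  | tmul x v =>
    refine ⟨∑ i ∈ (ℛ k x).index, (ℛ k x).left i ⊗ₜ ρ (antipode k ((ℛ k x).right i)) v, ?_⟩
    simp only [map_sum, fuse_tmul, ← tensorRep_mul_inr]
    rw [← LinearMap.sum_apply, ← map_sum, sum_comul_mul_inr_antipode]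
    simp [tensorRep_tmul]

lemma tensorRep_comul_fuse (a : A) (t : A ⊗[k] V) : tensorRep ρ (comul a) (fuse ρ t) =
    fuse ρ (TensorProduct.map (LinearMap.mulLeft k a) LinearMap.id t) := by
  induction t with
  | zero => simp
  | add x y hx hy => simp only [map_add, hx, hy]
  | tmul x v => simp [fuse_tmul, Bialgebra.comul_mul]

lemma mulRight_fuse {b : A} {ι : Type*} (r : Coalgebra.Repr k b ι) (t : A ⊗[k] V) :
    TensorProduct.map (LinearMap.mulRight k b) LinearMap.id (fuse ρ t) =
    fuse ρ (∑ i ∈ r.index, TensorProduct.map (LinearMap.mulRight k (r.left i))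
      (ρ (antipode k (r.right i))) t) := by
  induction t with
  | zero => simp
  | add x y hx hy => simp only [map_add, hx, hy, Finset.sum_add_distrib]
  | tmul x v =>
    simp only [map_sum, fuse_tmul, TensorProduct.map_tmul, ← tensorRep_mul_inl, ← tensorRep_mul_inr,
      LinearMap.mulRight_apply, Bialgebra.comul_mul, mul_assoc]
    rw [← LinearMap.sum_apply, ← map_sum, ← Finset.mul_sum, sum_comul_mul_inr_antipode]

lemma sum_biTrace_mul_trace (a b : A) {ι κ : Type*} (ra : Coalgebra.Repr k a ι)
    (rb : Coalgebra.Repr k b κ) :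
    ∑ i ∈ ra.index, biTrace k (ra.left i) b * LinearMap.trace k V (ρ (ra.right i)) =
    ∑ i ∈ rb.index, biTrace k a (rb.left i) *
      LinearMap.trace k V (ρ (antipode k (rb.right i))) := by
  let Φ : (A ⊗[k] V) ≃ₗ[k] (A ⊗[k] V) := LinearEquiv.ofBijective (fuse ρ)
    ⟨LinearMap.injective_iff_surjective.2 (fuse_surjective ρ), fuse_surjective ρ⟩
  let M : Module.End k (A ⊗[k] V) := ∑ i ∈ rb.index,
    TensorProduct.map (LinearMap.mulRight k (rb.left i)) (ρ (antipode k (rb.right i)))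
  let N : Module.End k (A ⊗[k] V) :=
    tensorRep ρ (comul a) ∘ₗ TensorProduct.map (LinearMap.mulRight k b) LinearMap.id
  have hN : N = Φ.conj (TensorProduct.map (LinearMap.mulLeft k a) LinearMap.id ∘ₗ M) := by
    apply LinearMap.ext
    intro t
    obtain ⟨t, rfl⟩ := Φ.surjective t
    have h1 : ∀ t, Φ t = fuse ρ t := fun t => rfl
    have h2 : N (fuse ρ t) = tensorRep ρ (comul a)
      (TensorProduct.map (LinearMap.mulRight k b) LinearMap.id (fuse ρ t)) := rfl
    rw [LinearEquiv.conj_apply_apply, LinearEquiv.symm_apply_apply, h1, h1, h2, mulRight_fuse ρ rb,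
      tensorRep_comul_fuse]
    simp [M]
  have h3 := congrArg (LinearMap.trace k (A ⊗[k] V)) hN
  rw [LinearMap.trace_conj'] at h3
  simp only [N, M, ← ra.eq, map_sum, tensorRep_tmul, ← Module.End.mul_eq_comp, Finset.sum_mul,
    Finset.mul_sum] at h3
  simp only [Module.End.mul_eq_comp, ← TensorProduct.map_comp, LinearMap.trace_tensorProduct', LinearMap.id_comp,
    LinearMap.comp_id] at h3
  exact h3

variable (k A) in
lemma surjective_antipode : Function.Surjective (antipode k : A →ₗ[k] A) := by
  by_cases hA : Nontrivial A
  · obtain ⟨f, h0, hf⟩ := exists_isLeftCoint k A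
    exact LinearMap.injective_iff_surjective.1 (antipode_injective_of_coint hf h0)
  · rw [not_nontrivial_iff_subsingleton] at hA
    exact fun b => ⟨0, Subsingleton.elim _ _⟩

end Tensor

section PairingData
open WithConv Coalgebra HopfAlgebra
variable {k : Type*} [Field k] {A : Type*} [Ring A] [HopfAlgebra k A] [FiniteDimensional k A]
  {B : Type*} [Ring B] [HopfAlgebra k B] [FiniteDimensional k B]

namespace HopfPairing
variable (p : HopfPairing k A B) (w : MatrixData k A)

/-- The irreducible characters as elements of the dual. -/
noncomputable def X (t : Fin w.r) : B := p.ofFun (w.χ t)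

@[simp] lemma P_X (t : Fin w.r) (a : A) : p.P a (p.X w t) = w.χ t a := p.P_ofFun _ _

lemma isRep_X (t : Fin w.r) : p.IsRep (p.X w t) := ⟨w.n t, w.π t, fun a => p.P_X w t a⟩

lemma X_injective : Function.Injective (p.X w) := fun s t h =>
  w.χ_injective fun a => by rw [← p.P_X, h, P_X]

variable {p}

lemma tensor_identity (b : A) {W : B} (hW : p.IsRep W) :
    (∑ t, ∑ s, ((w.c t s : k) * w.χ s b) • p.X w t) * W =
    ∑ t, ∑ s, ((w.c t s : k) * p.P b (p.X w s * antipode k W)) • p.X w t := by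
  obtain ⟨m, ρ, hρ⟩ := hW
  apply p.ext_right
  intro a
  have h := sum_biTrace_mul_trace ((Matrix.toLinAlgEquiv' : Matrix (Fin m) (Fin m) k ≃ₐ[k] _).toAlgHom.comp ρ)
    a b (ℛ k a) (ℛ k b)
  have htr : ∀ x, LinearMap.trace k (Fin m → k)
      (((Matrix.toLinAlgEquiv' : Matrix (Fin m) (Fin m) k ≃ₐ[k] _).toAlgHom.comp ρ) x) = p.P x W := by
    intro x
    rw [hρ]
    exact Matrix.trace_toLin'_eq (ρ x)
  simp only [htr, w.biTrace_eq, p.antipode_apply] at h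
  rw [p.sum_mul_right (ℛ k a)]
  simp only [map_sum, map_smul, P_X, smul_eq_mul]
  have e1 : ∀ x y : A, ∑ t, ∑ s, (w.c t s : k) * w.χ s y * w.χ t x =
    ∑ t, ∑ s, (w.c t s : k) * w.χ t x * w.χ s y := fun x y =>
      Finset.sum_congr rfl fun t _ => Finset.sum_congr rfl fun s _ => by ring
  simp only [e1]
  rw [h]
  simp only [p.sum_mul_right (ℛ k b), P_X, Finset.mul_sum, Finset.sum_mul]
  rw [Finset.sum_comm]
  refine Finset.sum_congr rfl fun t _ => ?_
  rw [Finset.sum_comm]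
  refine Finset.sum_congr rfl fun s _ => Finset.sum_congr rfl fun i _ => ?_
  ring

lemma IsRep.exists_eq_sum {b : B} (hb : p.IsRep b) : ∃ N : Fin w.r → ℕ,
    (∀ t, p.P (w.e t) b = N t) ∧ b = ∑ t, (N t : k) • p.X w t := by
  obtain ⟨N, h1, h2⟩ := w.charLike_eq hb.isCharLike
  refine ⟨N, h1, p.ext_right fun a => ?_⟩
  simpa using h2 a

variable (p)

/-- The adjoint of an operator. -/
noncomputable def adj (T : B →ₗ[k] B) : A →ₗ[k] A :=
  p.symm.funEquiv.symm.toLinearMap ∘ₗ LinearMap.lcomp k k T ∘ₗ p.P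

lemma P_adj (T : B →ₗ[k] B) (a : A) (b : B) : p.P (p.adj T a) b = p.P a (T b) :=
  p.symm.P_ofFun (p.P a ∘ₗ T) b

lemma adj_bijective {T : B →ₗ[k] B} (hT : Function.Surjective T) :
    Function.Bijective (p.adj T) := by
  have h : Function.Injective (p.adj T) := by
    rw [injective_iff_map_eq_zero]
    intro a ha
    refine p.left_inj a fun b => ?_
    obtain ⟨b, rfl⟩ := hT b
    rw [← P_adj, ha]
    simp
  exact ⟨h, LinearMap.injective_iff_surjective.1 h⟩

lemma adj_mul {T : B →ₗ[k] B} (hT : ∀ b, comul (T b) = TensorProduct.map T T (comul b)) (a a' : A) :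
    p.adj T (a * a') = p.adj T a * p.adj T a' := by
  refine p.ext_left fun b => ?_
  rw [P_adj, p.mul_left, p.mul_left, hT, tmulFun_map]
  congr 2 <;> ext b <;> simp [P_adj]

lemma adj_one {T : B →ₗ[k] B} (hT : ∀ b, counit (R := k) (T b) = counit (R := k) b) :
    p.adj T 1 = 1 := by
  refine p.ext_left fun b => ?_
  rw [P_adj, p.one_left, p.one_left, hT]

variable {w}
variable [CharZero k]

lemma exists_translate {T : B →ₗ[k] B} (hs : Function.Surjective T)
    (hT : ∀ b, comul (T b) = TensorProduct.map T T (comul b))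
    (hT1 : ∀ b, counit (R := k) (T b) = counit (R := k) b) :
    ∃ σ : Equiv.Perm (Fin w.r), (∀ t, T (p.X w t) = p.X w (σ t)) ∧ (∀ t, w.n (σ t) = w.n t) ∧
      ∀ t s, w.c (σ t) (σ s) = w.c t s := by
  let τ : A →ₐ[k] A := AlgHom.ofLinearMap (p.adj T) (p.adj_one hT1) (p.adj_mul hT)
  have hτ : ∀ a b, p.P (τ a) b = p.P a (T b) := p.P_adj T
  have hbij : Function.Bijective τ := p.adj_bijective hs
  have key : ∀ t, ∃ t', w.n t' = w.n t ∧ T (p.X w t) = p.X w t' := by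
    intro t
    obtain ⟨t', h1, h2, -⟩ := w.exists_of_surjective (Nat.pos_of_ne_zero (w.pos t).out)
      ((w.π t).comp τ) ((w.π_surjective t).comp hbij.2)
    refine ⟨t', h1.symm, p.ext_right fun a => ?_⟩
    rw [← hτ, P_X, P_X, ← h2]
    rfl
  choose σ h1 h2 using key
  have hTinj : Function.Injective T := LinearMap.injective_iff_surjective.2 hs
  have hσ : Function.Injective σ := fun s t h => p.X_injective w (hTinj (by rw [h2, h2, h]))
  refine ⟨Equiv.ofBijective σ ⟨hσ, Finite.injective_iff_surjective.1 hσ⟩, h2, h1, fun t s => ?_⟩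
  refine (w.c_perm w hσ hσ (fun a b => ?_) t s).symm
  rw [← MatrixData.biTrace_equiv (LinearEquiv.ofBijective τ.toLinearMap hbij) (map_mul τ), w.biTrace_eq]
  have e : ∀ t a, w.χ (σ t) a = w.χ t (τ a) := fun t a => by
    rw [← p.P_X w (σ t), ← h2, ← hτ, P_X]
  simp only [e]
  rfl

lemma exists_dual : ∃ σ : Equiv.Perm (Fin w.r), (∀ t, antipode k (p.X w t) = p.X w (σ t)) ∧
    (∀ t, w.n (σ t) = w.n t) ∧ ∀ t s, w.c (σ s) (σ t) = w.c t s := by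
  have hbij : Function.Bijective (antipode k : A →ₗ[k] A) := by
    have := surjective_antipode k A
    exact ⟨LinearMap.injective_iff_surjective.2 this, this⟩
  have key : ∀ t, ∃ t', w.n t' = w.n t ∧ antipode k (p.X w t) = p.X w t' := by
    intro t
    obtain ⟨t', h1, h2, -⟩ := w.exists_of_surjective (Nat.pos_of_ne_zero (w.pos t).out)
      (AlgHom.ofLinearMap ((Matrix.transposeLinearEquiv _ _ k k).toLinearMap ∘ₗ
        (w.π t).toLinearMap ∘ₗ HopfAlgebra.antipode k) (by simp)
        (by intro x y; simp [antipode_mul_antidistrib]))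
      ((Matrix.transposeLinearEquiv _ _ k k).surjective.comp ((w.π_surjective t).comp hbij.2))
    refine ⟨t', h1.symm, p.ext_right fun a => ?_⟩
    rw [← p.antipode_apply, P_X, P_X, ← h2]
    simp [w.χ_apply]
  choose σ h1 h2 using key
  have hTinj : Function.Injective (antipode k : B →ₗ[k] B) :=
    LinearMap.injective_iff_surjective.2 (surjective_antipode k B)
  have hσ : Function.Injective σ := fun s t h => p.X_injective w (hTinj (by rw [h2, h2, h]))
  have hgoal : ∀ t s, w.c (σ s) (σ t) = w.c t s := by
    intro t s
    have e : ∀ t a, w.χ (σ t) a = w.χ t (antipode k a) := fun t a => by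
      rw [← p.P_X w (σ t), ← h2, ← p.antipode_apply, P_X]
    have h3 : ∀ a b, ∑ t, ∑ s, (w.c t s : k) * w.χ (σ t) a * w.χ (σ s) b = biTrace k b a := by
      intro a b
      simp only [e]
      rw [← MatrixData.biTrace_antiEquiv (LinearEquiv.ofBijective (antipode k : A →ₗ[k] A) hbij)
        (fun x y => antipode_mul_antidistrib x y), w.biTrace_eq]
      rfl
    have h4 := h3 (w.e (σ t)) (w.e (σ s))
    rw [w.biTrace_e] at h4
    simp only [w.χ_e_eq, hσ.eq_iff] at h4
    symm
    simpa using h4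
  exact ⟨Equiv.ofBijective σ ⟨hσ, Finite.injective_iff_surjective.1 hσ⟩, h2, h1, hgoal⟩

end HopfPairing
end PairingData
end HopfClass

namespace HopfClass

section Characters
open WithConv Coalgebra HopfAlgebra
variable {k : Type*} [Field k] {A : Type*} [Ring A] [HopfAlgebra k A] [FiniteDimensional k A]
  {B : Type*} [Ring B] [HopfAlgebra k B] [FiniteDimensional k B]

namespace HopfPairing
variable (p : HopfPairing k A B) (w : MatrixData k A)

/-- The character defined by a grouplike element of the dual. -/
noncomputable def charHom (g : GroupLike k B) : A →ₐ[k] k :=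
  AlgHom.ofLinearMap (p.P.flip g.val) (by simp [p.one_left, g.2.counit_eq_one])
    (by intro x y; simp [p.mul_left, g.2.comul_eq_tmul_self])

lemma charHom_apply (g : GroupLike k B) (a : A) : p.charHom g a = p.P a g.val := rfl

lemma exists_groupLike {α : A →ₗ[k] k} (h1 : α 1 = 1) (hm : ∀ a b, α (a * b) = α a * α b) :
    ∃ g : GroupLike k B, ∀ a, p.P a g.val = α a := by
  refine ⟨⟨p.ofFun α, ?_, ?_⟩, fun a => p.P_ofFun _ _⟩
  · rw [← p.one_left, P_ofFun, h1]
  · rw [← sub_eq_zero]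
    have hP : ∀ f : B →ₗ[k] k, ∃ a, p.P a = f := fun f => by
      obtain ⟨a, ha⟩ := p.symm.funEquiv.surjective f
      exact ⟨a, ha⟩
    apply eq_zero_of_tmulFun_eq_zero
    intro f g
    obtain ⟨a, rfl⟩ := hP f
    obtain ⟨b, rfl⟩ := hP g
    rw [map_sub, ← p.mul_left]
    simp [hm]

variable [CharZero k]

lemma exists_ch (g : GroupLike k B) : ∃ t, w.n t = 1 ∧ p.X w t = g.val := by
  obtain ⟨t, h1, h2, -⟩ := w.exists_of_surjective one_pos
    ((Algebra.ofId k (Matrix (Fin 1) (Fin 1) k)).comp (p.charHom g)) (fun M => by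
      refine ⟨algebraMap k A (M 0 0), ?_⟩
      rw [AlgHom.commutes]
      ext i j
      fin_cases i; fin_cases j
      simp [Matrix.algebraMap_eq_diagonal])
  refine ⟨t, h1.symm, p.ext_right fun a => ?_⟩
  rw [P_X, ← h2]
  simp [Algebra.ofId_apply, charHom_apply, Matrix.trace, Matrix.algebraMap_eq_diagonal]

/-- The index of the one-dimensional representation given by a grouplike element. -/
noncomputable def ch (g : GroupLike k B) : Fin w.r := Classical.choose (p.exists_ch w g)

@[simp] lemma n_ch (g : GroupLike k B) : w.n (p.ch w g) = 1 :=
  (Classical.choose_spec (p.exists_ch w g)).1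

@[simp] lemma X_ch (g : GroupLike k B) : p.X w (p.ch w g) = g.val :=
  (Classical.choose_spec (p.exists_ch w g)).2

lemma ch_injective : Function.Injective (p.ch w) := fun g h e =>
  GroupLike.val_injective (by rw [← p.X_ch w g, e, X_ch])

lemma exists_ch_eq {t : Fin w.r} (ht : w.n t = 1) : ∃ g, p.ch w g = t := by
  have hs : Subsingleton (Fin (w.n t)) := by rw [ht]; infer_instance
  obtain ⟨g, hg⟩ := p.exists_groupLike (α := w.χ t) (by simp [w.χ_one, ht]) (fun a b => by
    simp [w.χ_apply, Matrix.trace, Matrix.mul_apply, Fintype.sum_subsingleton _ (0 : Fin (w.n t))])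
  exact ⟨g, p.X_injective w (p.ext_right fun a => by rw [X_ch, hg, P_X])⟩

lemma P_groupLike (g : GroupLike k B) (a : A) : p.P a g.val = w.χ (p.ch w g) a := by
  rw [← p.P_X w, X_ch]

lemma P_e_self (g : GroupLike k B) : p.P (w.e (p.ch w g)) g.val = 1 := by
  rw [p.P_groupLike w, w.χ_e]

lemma P_e_ne {g h : GroupLike k B} (hgh : g ≠ h) : p.P (w.e (p.ch w h)) g.val = 0 := by
  rw [p.P_groupLike w, w.χ_e_ne ((p.ch_injective w).ne hgh)]

instance finite_groupLike : Finite (GroupLike k B) :=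
  (linearIndep_groupLikeVal (R := k) (A := B)).finite_of_isNoetherian

lemma exists_lt (g : GroupLike k B) : ∃ σ : Equiv.Perm (Fin w.r),
    (∀ t, g.val * p.X w t = p.X w (σ t)) ∧ (∀ t, w.n (σ t) = w.n t) ∧
      ∀ t s, w.c (σ t) (σ s) = w.c t s := by
  refine p.exists_translate (T := LinearMap.mulLeft k g.val) (fun b => ⟨g⁻¹.val * b, ?_⟩) ?_ ?_
  · rw [LinearMap.mulLeft_apply, ← mul_assoc, ← GroupLike.val_mul]
    simp
  · intro b
    rw [LinearMap.mulLeft_apply, Bialgebra.comul_mul, g.2.comul_eq_tmul_self]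
    induction comul (R := k) b with
    | zero => simp
    | add x y hx hy => simp [mul_add, hx, hy]
    | tmul x y => simp
  · intro b
    simp [g.2.counit_eq_one]

/-- Left translation of irreducible characters by a grouplike element. -/
noncomputable def lt (g : GroupLike k B) : Equiv.Perm (Fin w.r) :=
  Classical.choose (p.exists_lt w g)

lemma X_lt (g : GroupLike k B) (t : Fin w.r) : p.X w (p.lt w g t) = g.val * p.X w t :=
  ((Classical.choose_spec (p.exists_lt w g)).1 t).symm

@[simp] lemma n_lt (g : GroupLike k B) (t : Fin w.r) : w.n (p.lt w g t) = w.n t :=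
  (Classical.choose_spec (p.exists_lt w g)).2.1 t

@[simp] lemma c_lt (g : GroupLike k B) (t s : Fin w.r) :
    w.c (p.lt w g t) (p.lt w g s) = w.c t s :=
  (Classical.choose_spec (p.exists_lt w g)).2.2 t s

lemma lt_mul (g h : GroupLike k B) (t : Fin w.r) :
    p.lt w (g * h) t = p.lt w g (p.lt w h t) :=
  p.X_injective w (by simp [X_lt, mul_assoc])

@[simp] lemma lt_one (t : Fin w.r) : p.lt w 1 t = t :=
  p.X_injective w (by simp [X_lt])

@[simp] lemma lt_ch (g h : GroupLike k B) : p.lt w g (p.ch w h) = p.ch w (g * h) :=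
  p.X_injective w (by simp [X_lt])

@[simp] lemma pd_lt (g : GroupLike k B) (t : Fin w.r) : w.pd (p.lt w g t) = w.pd t := by
  unfold MatrixData.pd
  rw [← Equiv.sum_comp (p.lt w g)]
  simp

lemma pd_ch (g : GroupLike k B) : w.pd (p.ch w g) = w.pd (p.ch w 1) := by
  rw [← p.pd_lt w g (p.ch w 1), lt_ch, mul_one]

/-- The dual irreducible representation. -/
noncomputable def st : Equiv.Perm (Fin w.r) := Classical.choose (p.exists_dual (w := w))

lemma X_st (t : Fin w.r) : p.X w (p.st w t) = antipode k (p.X w t) :=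
  ((Classical.choose_spec (p.exists_dual (w := w))).1 t).symm

@[simp] lemma n_st (t : Fin w.r) : w.n (p.st w t) = w.n t :=
  (Classical.choose_spec (p.exists_dual (w := w))).2.1 t

@[simp] lemma c_st (t s : Fin w.r) : w.c (p.st w s) (p.st w t) = w.c t s :=
  (Classical.choose_spec (p.exists_dual (w := w))).2.2 t s

@[simp] lemma st_ch (g : GroupLike k B) : p.st w (p.ch w g) = p.ch w g⁻¹ :=
  p.X_injective w (by simp [X_st])

lemma finrank_eq_sum : Module.finrank k A = Nat.card (GroupLike k B) * w.pd (p.ch w 1) +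
    ∑ s with w.n s ≠ 1, w.n s * w.pd s := by
  have := Fintype.ofFinite (GroupLike k B)
  rw [← w.sum_n_pd, ← Finset.sum_filter_add_sum_filter_not Finset.univ (fun s => w.n s = 1)]
  congr 1
  rw [Nat.card_eq_fintype_card, ← Finset.card_univ, ← smul_eq_mul, ← Finset.sum_const]
  refine (Finset.sum_bij (fun g _ => p.ch w g) (by simp) (fun _ _ _ _ h => p.ch_injective w h)
    (fun t ht => ?_) (fun g _ => by rw [n_ch, one_mul, p.pd_ch w g])).symm
  obtain ⟨g, hg⟩ := p.exists_ch_eq w (Finset.mem_filter.1 ht).2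
  exact ⟨g, Finset.mem_univ _, hg⟩

end HopfPairing

section GroupOrder
variable [CharZero k]

lemma trace_mulLeft_groupLike (g : GroupLike k B) :
    LinearMap.trace k B (LinearMap.mulLeft k g.val) * LinearMap.trace k B (LinearMap.mulLeft k g.val) =
    LinearMap.trace k B (LinearMap.mulLeft k g.val) * (Module.finrank k B : k) := by
  let ρ : B →ₐ[k] Module.End k B := Algebra.lmul k B
  let Φ : (B ⊗[k] B) ≃ₗ[k] (B ⊗[k] B) := LinearEquiv.ofBijective (fuse ρ)
    ⟨LinearMap.injective_iff_surjective.2 (fuse_surjective ρ), fuse_surjective ρ⟩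
  have h : TensorProduct.map (LinearMap.mulLeft k g.val) (LinearMap.mulLeft k g.val) =
      Φ.conj (TensorProduct.map (LinearMap.mulLeft k g.val) LinearMap.id) := by
    apply LinearMap.ext
    intro t
    obtain ⟨t, rfl⟩ := Φ.surjective t
    have h1 : ∀ t, Φ t = fuse ρ t := fun t => rfl
    rw [LinearEquiv.conj_apply_apply, LinearEquiv.symm_apply_apply, h1, h1,
      ← tensorRep_comul_fuse, g.2.comul_eq_tmul_self, tensorRep_tmul]
    rfl
  have h3 := congrArg (LinearMap.trace k (B ⊗[k] B)) h
  rwa [LinearMap.trace_conj', LinearMap.trace_tensorProduct', LinearMap.trace_tensorProduct',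
    LinearMap.trace_id] at h3

lemma eq_one_of_trace_eq_one {e : B} (he : e * e = e)
    (h : LinearMap.trace k B (LinearMap.mulLeft k e) = (Module.finrank k B : k)) : e = 1 := by
  have h1 : IsIdempotentElem (LinearMap.mulLeft k (1 - e)) := by
    unfold IsIdempotentElem
    ext x
    simp [sub_mul, mul_sub, ← mul_assoc, he]
  have h2 : LinearMap.trace k B (LinearMap.mulLeft k (1 - e)) = 0 := by
    have : LinearMap.mulLeft k (1 - e) = LinearMap.id - LinearMap.mulLeft k e := by
      ext x; simp [sub_mul]
    rw [this, map_sub, LinearMap.trace_id, h, sub_self]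
  have h3 := LinearMap.IsIdempotentElem.eq_zero_of_trace_eq_zero h1 h2
  have h4 := LinearMap.congr_fun h3 1
  simp only [LinearMap.mulLeft_apply, mul_one, LinearMap.zero_apply] at h4
  exact (sub_eq_zero.1 h4).symm

lemma dvd_finrank_of_orderOf_prime {g : GroupLike k B} {q : ℕ} (hq : q.Prime) (hg : orderOf g = q) :
    q ∣ Module.finrank k B := by
  set D := Module.finrank k B with hD
  have hq0 : (q : k) ≠ 0 := by exact_mod_cast hq.ne_zero
  have hgq : g.val ^ q = 1 := by
    rw [← GroupLike.val_pow, ← hg, pow_orderOf_eq_one, GroupLike.val_one]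
  let E : B := (q : k)⁻¹ • ∑ j ∈ Finset.range q, g.val ^ j
  have hgE : g.val * E = E := by
    have h1 := Finset.sum_range_succ' (fun j => g.val ^ j) q
    rw [Finset.sum_range_succ, hgq, pow_zero, add_left_inj] at h1
    simp only [E, mul_smul_comm, Finset.mul_sum, ← pow_succ']
    rw [← h1]
  have hgE' : ∀ j, g.val ^ j * E = E := by
    intro j
    induction j with
    | zero => simp
    | succ j ih => rw [pow_succ, mul_assoc, hgE, ih]
  have hEE : E * E = E := by
    have : E * E = (q : k)⁻¹ • ∑ j ∈ Finset.range q, g.val ^ j * E := by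
      rw [← Finset.sum_mul, ← smul_mul_assoc]
    rw [this]
    simp only [hgE', Finset.sum_const, Finset.card_range, ← Nat.cast_smul_eq_nsmul k, smul_smul,
      inv_mul_cancel₀ hq0, one_smul]
  have htr : ∀ j : ℕ, ∃ d : ℕ, d ≤ 1 ∧
      LinearMap.trace k B (LinearMap.mulLeft k (g.val ^ j)) = (d * D : ℕ) := by
    intro j
    have h := trace_mulLeft_groupLike (g ^ j)
    rw [GroupLike.val_pow, ← sub_eq_zero, ← mul_sub, mul_eq_zero, sub_eq_zero] at h
    rcases h with h | h
    · exact ⟨0, Nat.zero_le _, by simpa using h⟩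
    · exact ⟨1, le_rfl, by simpa using h⟩
  choose d hd1 hd using htr
  have hDne : D ≠ 0 := by
    intro h0
    have : Subsingleton B := Module.finrank_zero_iff.1 h0
    exact hq.one_lt.ne' (hg ▸ (orderOf_eq_one_iff.2 (GroupLike.val_injective (Subsingleton.elim _ _))))
  have hd0 : d 0 = 1 := by
    have h := hd 0
    have h5 : LinearMap.mulLeft k (g.val ^ 0) = LinearMap.id := by ext; simp
    rw [h5, LinearMap.trace_id] at h
    have : D = d 0 * D := by exact_mod_cast h
    exact Nat.eq_of_mul_eq_mul_right (Nat.pos_of_ne_zero hDne) (by rw [← this, one_mul])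
  set m := ∑ j ∈ Finset.range q, d j with hm
  have hE : (q : k) * LinearMap.trace k B (LinearMap.mulLeft k E) = (m * D : ℕ) := by
    have h6 : LinearMap.mulLeft k E = (q : k)⁻¹ • ∑ j ∈ Finset.range q, LinearMap.mulLeft k (g.val ^ j) := by
      ext x
      simp [E, Finset.sum_mul]
    rw [h6, map_smul, smul_eq_mul, mul_inv_cancel_left₀ hq0, map_sum, hm, Finset.sum_mul, Nat.cast_sum]
    exact Finset.sum_congr rfl fun j _ => hd j
  obtain ⟨T, hT⟩ : ∃ T : ℕ, LinearMap.trace k B (LinearMap.mulLeft k E) = T :=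
    ⟨_, exists_trace_eq_natCast _ (by ext x; simp [← mul_assoc, hEE])⟩
  rw [hT] at hE
  have hE' : q * T = m * D := by exact_mod_cast hE
  rcases (Nat.Prime.dvd_mul hq).1 ⟨T, hE'.symm⟩ with h | h
  · exfalso
    have hm0 : 0 < m := by
      have : d 0 ≤ m := Finset.single_le_sum (f := d) (fun _ _ => Nat.zero_le _)
        (Finset.mem_range.2 hq.pos)
      omega
    have hmq : m ≤ q := by
      calc m ≤ ∑ j ∈ Finset.range q, 1 := Finset.sum_le_sum fun j _ => hd1 j
        _ = q := by simp
    have hmq' : m = q := le_antisymm hmq (Nat.le_of_dvd hm0 h)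
    rw [hmq'] at hE'
    have hTD : T = D := Nat.eq_of_mul_eq_mul_left hq.pos hE'
    have hE1 : E = 1 := eq_one_of_trace_eq_one hEE (by rw [hT, hTD])
    rw [hE1, mul_one] at hgE
    exact hq.one_lt.ne' (hg ▸ (orderOf_eq_one_iff.2 (GroupLike.val_injective hgE)))
  · exact h

lemma card_groupLike_eq_pow (hB : Module.finrank k B = 27) :
    ∃ a, Nat.card (GroupLike k B) = 3 ^ a := by
  refine ⟨_, Nat.eq_prime_pow_of_unique_prime_dvd Nat.card_pos.ne' ?_⟩
  intro q hq hqd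
  have := Fact.mk hq
  obtain ⟨g, hg⟩ := exists_prime_orderOf_dvd_card' q hqd
  have h := dvd_finrank_of_orderOf_prime hq hg
  rw [hB, show 27 = 3 ^ 3 by norm_num] at h
  exact (Nat.prime_dvd_prime_iff_eq hq Nat.prime_three).1 (hq.dvd_of_dvd_pow h)

end GroupOrder
end Characters
end HopfClass

namespace HopfClass

section Twist
open WithConv Coalgebra HopfAlgebra
variable {k : Type*} [Field k] {A : Type*} [Ring A] [HopfAlgebra k A] [FiniteDimensional k A]
  {B : Type*} [Ring B] [HopfAlgebra k B] [FiniteDimensional k B]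

lemma MatrixData.c_of_pd_eq (w : MatrixData k A) {t : Fin w.r} (h : w.pd t = w.n t) (s : Fin w.r) :
    w.c s t = if s = t then 1 else 0 := by
  have h1 : w.pd t = w.n t * w.c t t + ∑ s ∈ Finset.univ.erase t, w.n s * w.c s t :=
    (Finset.add_sum_erase _ (fun s => w.n s * w.c s t) (Finset.mem_univ t)).symm
  have hn : 0 < w.n t := Nat.pos_of_ne_zero (w.pos t).out
  have hc := w.c_pos t
  have h2 : w.n t * 1 ≤ w.n t * w.c t t := Nat.mul_le_mul_left _ hc
  have h3 : w.n t * w.c t t = w.n t * 1 := by omega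
  split_ifs with hst
  · rw [hst]
    exact Nat.eq_of_mul_eq_mul_left hn h3
  · have h4 : ∑ s ∈ Finset.univ.erase t, w.n s * w.c s t = 0 := by omega
    have h5 := (Finset.sum_eq_zero_iff.1 h4) s (Finset.mem_erase.2 ⟨hst, Finset.mem_univ s⟩)
    exact (Nat.mul_eq_zero.1 h5).resolve_left (w.pos s).out

lemma exists_conj_of_ker_eq {m : ℕ} {f₁ f₂ : A →ₐ[k] Matrix (Fin m) (Fin m) k}
    (h₁ : Function.Surjective f₁) (h₂ : Function.Surjective f₂) (h : ∀ a, f₂ a = 0 ↔ f₁ a = 0) :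
    ∃ u v : Matrix (Fin m) (Fin m) k, u * v = 1 ∧ ∀ a, f₁ a * u = u * f₂ a := by
  have h' : ∀ a b, f₁ a = f₁ b → f₂ a = f₂ b := fun a b hab => by
    rw [← sub_eq_zero, ← map_sub, h, map_sub, hab, sub_self]
  choose s hs using h₁
  let φ : Matrix (Fin m) (Fin m) k →ₐ[k] Matrix (Fin m) (Fin m) k := AlgHom.ofLinearMap
    { toFun := fun M => f₂ (s M)
      map_add' := fun M N => by
        rw [← map_add]
        exact h' _ _ (by rw [map_add, hs, hs, hs])
      map_smul' := fun c M => by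
        rw [RingHom.id_apply, ← map_smul]
        exact h' _ _ (by rw [map_smul, hs, hs]) }
    ((h' _ 1 (by rw [hs, map_one])).trans (map_one f₂))
    (fun M N => by
      change f₂ _ = f₂ _ * f₂ _
      rw [← map_mul]
      exact h' _ _ (by rw [map_mul, hs, hs, hs]))
  have hφ : ∀ a, φ (f₁ a) = f₂ a := fun a => h' _ _ (hs _)
  have hsur : Function.Surjective φ := fun M => by
    obtain ⟨a, rfl⟩ := h₂ M
    exact ⟨_, hφ a⟩
  have hinj : Function.Injective φ := LinearMap.injective_iff_surjective (f := φ.toLinearMap).2 hsur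
  let L : Matrix (Fin m) (Fin m) k ≃ₐ[k] Module.End k (Fin m → k) := Matrix.toLinAlgEquiv'
  obtain ⟨T, hT⟩ := ((L.symm.trans (AlgEquiv.ofBijective φ ⟨hinj, hsur⟩)).trans L).eq_linearEquivConjAlgEquiv
  refine ⟨L.symm T.symm.toLinearMap, L.symm T.toLinearMap, ?_, fun a => ?_⟩
  · rw [← map_mul, ← map_one L.symm]
    congr 1
    exact LinearMap.ext fun x => by simp
  · apply L.injective
    have h3 : L (f₂ a) = T.toLinearMap ∘ₗ L (f₁ a) ∘ₗ T.symm.toLinearMap := by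
      have := congrArg (fun F => F (L (f₁ a))) hT
      simp only [AlgEquiv.trans_apply, AlgEquiv.symm_apply_apply, ] at this
      have h4 : AlgEquiv.ofBijective φ ⟨hinj, hsur⟩ (f₁ a) = f₂ a := hφ a
      rw [← h4, this]
      rfl
    rw [map_mul, map_mul, h3, AlgEquiv.apply_symm_apply]
    exact LinearMap.ext fun x => by simp

lemma exists_mul_self_eq {m : ℕ} (hm : m = 2) (u : Matrix (Fin m) (Fin m) k) :
    ∃ c d : k, u * u = c • u + d • 1 := by
  subst hm
  refine ⟨u 0 0 + u 1 1, -(u 0 0 * u 1 1 - u 0 1 * u 1 0), ?_⟩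
  ext i j
  fin_cases i <;> fin_cases j <;> simp [Matrix.mul_apply] <;> ring

namespace HopfPairing
variable (p : HopfPairing k A B) (w : MatrixData k A)

/-- The algebra endomorphism `a ↦ g(a₁) a₂` given by a grouplike element. -/
noncomputable def tau (g : GroupLike k B) : A →ₐ[k] A :=
  AlgHom.ofLinearMap (p.adj (LinearMap.mulLeft k g.val))
    (p.adj_one fun b => by simp [g.2.counit_eq_one])
    (p.adj_mul fun b => by
      rw [LinearMap.mulLeft_apply, Bialgebra.comul_mul, g.2.comul_eq_tmul_self]
      induction comul (R := k) b with
      | zero => simp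
      | add x y hx hy => simp [mul_add, hx, hy]
      | tmul x y => simp)

lemma P_tau (g : GroupLike k B) (a : A) (b : B) : p.P (p.tau g a) b = p.P a (g.val * b) :=
  p.P_adj _ a b

lemma tau_mul (g h : GroupLike k B) (a : A) : p.tau (g * h) a = p.tau h (p.tau g a) :=
  p.ext_left fun b => by simp [P_tau, mul_assoc]

lemma tau_one (a : A) : p.tau 1 a = a := p.ext_left fun b => by simp [P_tau]

lemma tau_surjective (g : GroupLike k B) : Function.Surjective (p.tau g) := fun a =>
  ⟨p.tau g⁻¹ a, by rw [← tau_mul, inv_mul_cancel, tau_one]⟩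

lemma sum_tau_mul_antipode (g : GroupLike k B) {a : A} {ι : Type*} (r : Coalgebra.Repr k a ι) :
    ∑ i ∈ r.index, p.tau g (r.left i) * antipode k (r.right i) = p.P a g.val • 1 := by
  refine p.ext_left fun b => ?_
  simp only [map_sum, LinearMap.sum_apply, p.sum_mul_left (ℛ k b), P_tau, p.antipode_apply]
  rw [Finset.sum_comm]
  simp only [← p.sum_mul_right r, ← map_sum, mul_assoc, ← Finset.mul_sum,
    sum_mul_antipode_eq_smul (ℛ k b)]
  simp [p.one_left, mul_comm]

lemma sum_conj_of_intertwines {m : ℕ} {ρ : A →ₐ[k] Matrix (Fin m) (Fin m) k} {g : GroupLike k B}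
    {u : Matrix (Fin m) (Fin m) k} (hu : ∀ a, ρ a * u = u * ρ (p.tau g a)) (a : A) :
    ∑ i ∈ (ℛ k a).index, ρ ((ℛ k a).left i) * u * ρ (antipode k ((ℛ k a).right i)) =
      p.P a g.val • u := by
  simp only [hu, mul_assoc, ← map_mul, ← Finset.mul_sum, ← map_sum, sum_tau_mul_antipode]
  simp

variable [CharZero k]

lemma exists_intertwiner {g : GroupLike k B} {t : Fin w.r} (ht : p.lt w g t = t) :
    ∃ u v : Matrix (Fin (w.n t)) (Fin (w.n t)) k, u * v = 1 ∧
      ∀ a, w.π t a * u = u * w.π t (p.tau g a) := by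
  have hs : Function.Surjective ((w.π t).comp (p.tau g)) :=
    (w.π_surjective t).comp (p.tau_surjective g)
  refine exists_conj_of_ker_eq (w.π_surjective t) hs ?_
  obtain ⟨t', -, h2, h3⟩ := w.exists_of_surjective (Nat.pos_of_ne_zero (w.pos t).out) _ hs
  have h4 : t = t' := by
    apply w.χ_injective
    intro a
    rw [← h2]
    have := congrArg (p.P a) (p.X_lt w g t)
    rw [ht, P_X, ← P_tau, P_X] at this
    rw [this]
    rfl
  subst h4
  exact h3

lemma n_ne_two {g : GroupLike k B} {t : Fin w.r} (ht : p.lt w g t = t) (h1 : g ≠ 1)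
    (h2 : g * g ≠ 1) : w.n t ≠ 2 := by
  intro hn
  obtain ⟨u, v, huv, hu⟩ := p.exists_intertwiner w ht
  have hu1 : ∀ a, w.π t a * 1 = 1 * w.π t (p.tau 1 a) := fun a => by simp [tau_one]
  have hu2 : ∀ a, w.π t a * (u * u) = (u * u) * w.π t (p.tau (g * g) a) := fun a => by
    rw [← mul_assoc, hu, mul_assoc, hu, ← mul_assoc, tau_mul]
  obtain ⟨c, d, hcd⟩ := exists_mul_self_eq hn u
  let a := w.e (p.ch w (g * g))
  have e1 := p.sum_conj_of_intertwines hu a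
  have e2 := p.sum_conj_of_intertwines hu2 a
  have e0 := p.sum_conj_of_intertwines hu1 a
  rw [p.P_e_self, one_smul, hcd] at e2
  rw [p.P_e_ne w (show g ≠ g * g by simpa using h1), zero_smul] at e1
  rw [p.P_e_ne w h2.symm, zero_smul] at e0
  simp only [mul_add, add_mul, mul_smul_comm, smul_mul_assoc, Finset.sum_add_distrib,
    ← Finset.smul_sum, e1, e0, smul_zero, add_zero] at e2
  rw [← hcd] at e2
  have h6 : (1 : Matrix (Fin (w.n t)) (Fin (w.n t)) k) = 0 := by
    calc 1 = u * (u * v) * v := by rw [huv, mul_one, huv]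
      _ = (u * u) * v * v := by simp only [mul_assoc]
      _ = 0 := by rw [← e2, zero_mul, zero_mul]
  exact one_ne_zero h6

lemma card_mul_pd_le {t : Fin w.r} (h : w.pd t = w.n t) (s : Finset (GroupLike k B))
    (hs : ∀ g ∈ s, p.lt w g t = t) : s.card * w.pd (p.ch w 1) ≤ w.n t * w.n t := by
  have hid := tensor_identity (w := w) (w.e t) (p.isRep_X w ((p.st w).symm t))
  have hS : antipode k (p.X w ((p.st w).symm t)) = p.X w t := by rw [← X_st, Equiv.apply_symm_apply]
  rw [hS] at hid
  choose N hN using fun s => ((p.isRep_X w s).mul (p.isRep_X w t)).exists_eq_sum (w := w)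
  simp only [(hN _).1 t] at hid
  have h1 := congrArg (p.P 1) hid
  simp only [p.one_left, Bialgebra.counit_mul] at h1
  simp only [← p.one_left, map_sum, map_smul, P_X, w.χ_one, smul_eq_mul, w.χ_e_eq] at h1
  simp only [w.c_of_pd_eq h, mul_ite, mul_one, mul_zero, Finset.sum_ite_eq',
    Finset.mem_univ, if_true, Nat.cast_ite, Nat.cast_one, Nat.cast_zero, ite_mul, one_mul, zero_mul] at h1
  have hn : w.n ((p.st w).symm t) = w.n t := by
    rw [← p.n_st w, Equiv.apply_symm_apply]
  rw [hn] at h1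
  have h2 : w.n t * w.n t = ∑ s, w.pd s * N s t := by
    have : (w.n t * w.n t : k) = ((∑ s, w.pd s * N s t : ℕ) : k) := by
      rw [h1]
      rw [Finset.sum_comm]
      push_cast [MatrixData.pd, Finset.sum_mul]
      refine Finset.sum_congr rfl fun _ _ => Finset.sum_congr rfl fun _ _ => by ring
    exact_mod_cast this
  rw [h2]
  calc s.card * w.pd (p.ch w 1) = ∑ g ∈ s, w.pd (p.ch w g) * N (p.ch w g) t := by
        rw [Finset.card_eq_sum_ones, Finset.sum_mul]
        refine Finset.sum_congr rfl fun g hg => ?_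
        have h3 := (hN (p.ch w g)).1 t
        rw [X_ch, ← X_lt, hs g hg, P_X, w.χ_e] at h3
        have h4 : N (p.ch w g) t = 1 := by exact_mod_cast h3.symm
        rw [h4, p.pd_ch w g, one_mul, mul_one]
    _ = ∑ t' ∈ s.map ⟨p.ch w, p.ch_injective w⟩, w.pd t' * N t' t := by simp
    _ ≤ _ := Finset.sum_le_sum_of_subset (Finset.subset_univ _)

end HopfPairing
end Twist
end HopfClass

namespace HopfClass

section SkewPrimitive
open WithConv Coalgebra HopfAlgebra
variable {k : Type*} [Field k]

/-- A primitive element of a corner of a finite dimensional algebra vanishes. -/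
lemma eq_zero_of_primitive [CharZero k] {R : Type*} [Ring R] [Algebra k R] [FiniteDimensional k R]
    {e y : R} (he : e * e = e) (hey : e * y = y) (hye : y * e = y) (D : R →ₗ[k] R ⊗[k] R)
    (hmul : ∀ z, D (y * z) = D y * D z) (hDe : D e = e ⊗ₜ e) (hDy : D y = y ⊗ₜ e + e ⊗ₜ y) :
    y = 0 := by
  let sl : (R →ₗ[k] k) → R ⊗[k] R →ₗ[k] R := fun f =>
    (TensorProduct.rid k R).toLinearMap ∘ₗ TensorProduct.map LinearMap.id f
  have hsl : ∀ f a b, sl f (a ⊗ₜ b) = f b • a := fun f a b => by simp [sl]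
  let v : ℕ → R := fun n => y ^ n * e
  have hD : ∀ n, D (v n) = ∑ i ∈ Finset.range (n + 1), (n.choose i : k) • (v i ⊗ₜ[k] v (n - i)) := by
    have hab : Commute (y ⊗ₜ[k] (1 : R)) ((1 : R) ⊗ₜ[k] y) := by simp [Commute, SemiconjBy]
    have h1 : ∀ n, D (v n) = (y ⊗ₜ[k] (1 : R) + (1 : R) ⊗ₜ[k] y) ^ n * (e ⊗ₜ e) := by
      intro n
      induction n with
      | zero => simp [v, hDe]
      | succ n ih =>
        have h2 : v (n + 1) = y * v n := by simp [v, pow_succ', mul_assoc]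
        have h3 : Commute (e ⊗ₜ[k] e) (y ⊗ₜ[k] (1 : R) + (1 : R) ⊗ₜ[k] y) := by
          simp [Commute, SemiconjBy, mul_add, add_mul, hey, hye]
        have h4 : D y = (y ⊗ₜ[k] (1 : R) + (1 : R) ⊗ₜ[k] y) * (e ⊗ₜ e) := by
          simp [hDy, add_mul, hye]
        have h5 : (e ⊗ₜ[k] e) * (e ⊗ₜ[k] e) = e ⊗ₜ[k] e := by simp [he]
        rw [h2, hmul, ih, h4, mul_assoc, ← mul_assoc (e ⊗ₜ[k] e), (h3.pow_right n).eq, mul_assoc, h5,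
          ← mul_assoc, pow_succ']
    intro n
    rw [h1, hab.add_pow, Finset.sum_mul]
    refine Finset.sum_congr rfl fun i _ => ?_
    rw [← nsmul_eq_mul', Nat.cast_smul_eq_nsmul, smul_mul_assoc]
    congr 1
    simp [v, Algebra.TensorProduct.tmul_pow]
  let V : ℕ →o Submodule k R := ⟨fun j => Submodule.span k (v '' Set.Iio j), fun i j hij =>
    Submodule.span_mono (Set.image_mono (Set.Iio_subset_Iio hij))⟩
  have hV : ∃ m, v m ∈ V m := by
    obtain ⟨n, hn⟩ := monotone_stabilizes_iff_noetherian.2 (inferInstance : IsNoetherian k R) V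
    refine ⟨n, ?_⟩
    rw [hn (n + 1) (Nat.le_succ n)]
    exact Submodule.subset_span ⟨n, Nat.lt_succ_self n, rfl⟩
  classical
  have hm := Nat.find_spec hV
  have hmin := fun j => Nat.find_min hV (m := j)
  generalize Nat.find hV = m at hm hmin
  have hv0 : v 0 = e := by simp [v]
  have hv1 : v 1 = y := by simp [v, hye]
  obtain ⟨c, hc⟩ : ∃ c : k, y = c • e := by
    rcases m with _ | m
    · have : e = 0 := by
        have hm' : v 0 ∈ Submodule.span k (v '' Set.Iio 0) := hm
        rw [← hv0]
        simpa using hm'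
      exact ⟨0, by rw [zero_smul, ← hye, this, mul_zero]⟩
    · obtain ⟨f, hf0, hf⟩ := Submodule.exists_le_ker_of_notMem (hmin m (Nat.lt_succ_self m))
      have hfi : ∀ i, i < m → f (v i) = 0 := fun i hi =>
        hf (Submodule.subset_span ⟨i, hi, rfl⟩)
      have hT : ∀ z ∈ V (m + 1), sl f (D z) ∈ Submodule.span k {e} := by
        intro z hz
        refine Submodule.span_induction ?_ (by simp) (fun x y _ _ hx hy => by
          rw [map_add, map_add]; exact Submodule.add_mem _ hx hy) (fun a x _ hx => by
          rw [map_smul, map_smul]; exact Submodule.smul_mem _ a hx) hz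
        rintro _ ⟨i, hi, rfl⟩
        rw [hD, map_sum]
        refine Submodule.sum_mem _ fun j hj => ?_
        rw [map_smul, hsl]
        refine Submodule.smul_mem _ _ ?_
        rcases Nat.eq_zero_or_pos j with rfl | hj0
        · rw [hv0]
          exact Submodule.smul_mem _ _ (Submodule.mem_span_singleton_self e)
        · have : i - j < m := by
            have h1 : i < m + 1 := hi
            have h2 := Finset.mem_range.1 hj
            omega
          rw [hfi _ this, zero_smul]
          exact Submodule.zero_mem _
      have h6 := hT _ hm
      rw [hD, map_sum, Finset.sum_range_succ', Finset.sum_range_succ', Finset.sum_eq_zero, zero_add] at h6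
      · simp only [map_smul, hsl, zero_add, Nat.choose_one_right, Nat.choose_zero_right,
          Nat.add_sub_cancel, hv0, hv1] at h6
        have h7 := Submodule.sub_mem _ h6 (Submodule.smul_mem _ ((1 : ℕ) : k)
          (Submodule.smul_mem _ (f (v (m + 1))) (Submodule.mem_span_singleton_self e)))
        rw [Nat.sub_zero, add_sub_cancel_right, smul_smul, Submodule.smul_mem_iff] at h7
        · obtain ⟨c, hc⟩ := Submodule.mem_span_singleton.1 h7
          exact ⟨c, hc.symm⟩
        · exact mul_ne_zero (by exact_mod_cast Nat.succ_ne_zero m) hf0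
      · intro j hj
        rw [map_smul, hsl, hfi _ (by have := Finset.mem_range.1 hj; omega), zero_smul, smul_zero]
  by_cases he0 : e = 0
  · rw [← hye, he0, mul_zero]
  · rw [hc, map_smul, hDe, TensorProduct.tmul_smul, ← TensorProduct.smul_tmul', ← add_smul] at hDy
    have h8 : (e ⊗ₜ[k] e) ≠ 0 := by
      intro h
      obtain ⟨f, hf⟩ : ∃ f : R →ₗ[k] k, f e ≠ 0 := by
        by_contra! h
        exact he0 ((Module.forall_dual_apply_eq_zero_iff k e).1 h)
      have := congrArg (tmulFun f f) h
      simp [hf] at this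
    have h9 := smul_left_injective k h8 hDy
    have : c = 0 := by linear_combination -h9
    rw [hc, this, zero_smul]

variable {B : Type*} [Ring B] [HopfAlgebra k B] [FiniteDimensional k B]

lemma skewPrimitive_eq_of_commute [CharZero k] {ω : k} (hω : IsPrimitiveRoot ω 3) {g x : B}
    (hg : IsGroupLikeElem k g) (hg3 : g ^ 3 = 1) (hx : comul (R := k) x = x ⊗ₜ 1 + g ⊗ₜ x)
    (hgx : g * x = x * g) : ∃ c : k, x = c • (1 - g) := by
  have h3 : (3 : k) ≠ 0 := by norm_num
  have hω3 : ω ^ 3 = 1 := hω.pow_eq_one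
  have hω0 : ω ≠ 0 := hω.ne_zero (by norm_num)
  have hω1 : ω ≠ 1 := hω.ne_one (by norm_num)
  have hωs : 1 + ω + ω ^ 2 = 0 := by
    have : (ω - 1) * (1 + ω + ω ^ 2) = 0 := by linear_combination hω3
    exact (mul_eq_zero.1 this).resolve_left (sub_ne_zero.2 hω1)
  let E : k → B := fun z => (3 : k)⁻¹ • (1 + z ^ 2 • g + z • g ^ 2)
  have hggg : g * g ^ 2 = 1 := by rw [← pow_succ', hg3]
  have hgE : ∀ z, z ^ 3 = 1 → g * E z = z • E z := by
    intro z hz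
    have hz2 : z * z ^ 2 = 1 := by rw [← pow_succ', hz]
    have e1 : g * E z = (3 : k)⁻¹ • (g + z ^ 2 • g ^ 2 + z • 1) := by
      simp only [E, mul_smul_comm, mul_add, mul_one, hggg, ← pow_two]
    have e2 : z • E z = (3 : k)⁻¹ • ((z * z ^ 2) • g + z ^ 2 • g ^ 2 + z • 1) := by
      simp only [E]
      module
    rw [e1, e2, hz2, one_smul]
  have hEg : ∀ z, E z * g = g * E z := by
    intro z
    simp only [E, mul_smul_comm, smul_mul_assoc, mul_add, add_mul, mul_one, one_mul, ← pow_succ, ← pow_succ']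
  have hgx2 : g ^ 2 * x = x * g ^ 2 := ((show Commute g x from hgx).pow_left 2).eq
  have hEx : ∀ z, E z * x = x * E z := by
    intro z
    simp only [E, mul_smul_comm, smul_mul_assoc, mul_add, add_mul, mul_one, one_mul, hgx, hgx2]
  have hω4 : ω ^ 2 = - 1 - ω := by linear_combination hωs
  have hsum : E 1 + E ω + E (ω ^ 2) = 1 := by
    have e1 : (ω ^ 2) ^ 2 = ω := by linear_combination ω * hω3
    simp only [E, e1, ← smul_add]
    rw [show (1 + (1 : k) ^ 2 • g + (1 : k) • g ^ 2 + (1 + ω ^ 2 • g + ω • g ^ 2) +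
      (1 + ω • g + ω ^ 2 • g ^ 2)) = (3 : k) • (1 : B) + (1 + ω + ω ^ 2) • g + (1 + ω + ω ^ 2) • g ^ 2 by
        module, hωs, zero_smul, zero_smul, add_zero, add_zero, smul_smul, inv_mul_cancel₀ h3, one_smul]
  have hg2 : IsGroupLikeElem k (g ^ 2) := hg.pow
  have hΔ : ∀ a b, a ^ 3 = 1 → b ^ 3 = 1 → a * b = 1 →
      (E a ⊗ₜ[k] E b) * comul (R := k) (E 1) = E a ⊗ₜ E b := by
    intro a b ha hb hab
    have e1 : (E a ⊗ₜ[k] E b) * (g ⊗ₜ g) = E a ⊗ₜ E b := by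
      rw [Algebra.TensorProduct.tmul_mul_tmul, hEg, hEg, hgE a ha, hgE b hb, TensorProduct.smul_tmul_smul,
        hab, one_smul]
    have e2 : (E a ⊗ₜ[k] E b) * ((g ^ 2) ⊗ₜ (g ^ 2)) = E a ⊗ₜ E b := by
      rw [← Algebra.TensorProduct.tmul_pow, pow_two, ← mul_assoc, e1, e1]
    have e3 : comul (R := k) (E 1) = (3 : k)⁻¹ • (1 + g ⊗ₜ g + (g ^ 2) ⊗ₜ (g ^ 2)) := by
      simp only [E, map_smul, map_add, Bialgebra.comul_one, hg.comul_eq_tmul_self, hg2.comul_eq_tmul_self, one_pow,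
        one_smul]
    rw [e3, mul_smul_comm, mul_add, mul_add, e1, e2, mul_one,
      show ∀ v : B ⊗[k] B, v + v + v = (3 : k) • v from fun v => by module, smul_smul, inv_mul_cancel₀ h3, one_smul]
  have hEE : E 1 * E 1 = E 1 := by
    have e1 : g * E 1 = E 1 := by rw [hgE 1 (one_pow 3), one_smul]
    have e2 : g ^ 2 * E 1 = E 1 := by rw [pow_two, mul_assoc, e1, e1]
    conv_lhs => lhs; simp only [E]
    rw [smul_mul_assoc, add_mul, add_mul, one_pow, one_smul, one_smul, e1, e2, one_mul,
      show ∀ v : B, v + v + v = (3 : k) • v from fun v => by module, smul_smul, inv_mul_cancel₀ h3, one_smul]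
  have hy : E 1 * x = 0 := by
    refine eq_zero_of_primitive (k := k) (e := E 1) hEE (by rw [← mul_assoc, hEE])
      (by rw [mul_assoc, ← hEx, ← mul_assoc, hEE])
      (LinearMap.mulLeft k (E 1 ⊗ₜ[k] E 1) ∘ₗ comul) ?_ ?_ ?_
    · intro z
      have e0 := hΔ 1 1 (one_pow 3) (one_pow 3) (one_mul 1)
      have e1 : comul (R := k) (E 1) * comul (R := k) x = comul (R := k) x * comul (R := k) (E 1) := by
        rw [← Bialgebra.comul_mul, hEx, Bialgebra.comul_mul]
      have e2 : (E 1 ⊗ₜ[k] E 1) * comul (R := k) x = comul (R := k) x * (E 1 ⊗ₜ[k] E 1) := by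
        simp only [hx, mul_add, add_mul, Algebra.TensorProduct.tmul_mul_tmul, hEx, hEg, mul_one, one_mul]
      have e3 : (E 1 ⊗ₜ[k] E 1) * (E 1 ⊗ₜ[k] E 1) = E 1 ⊗ₜ[k] E 1 := by
        rw [Algebra.TensorProduct.tmul_mul_tmul, hEE]
      simp only [LinearMap.comp_apply, LinearMap.mulLeft_apply, Bialgebra.comul_mul, ← mul_assoc, e0]
      rw [mul_assoc _ _ (E 1 ⊗ₜ[k] E 1), ← e2, ← mul_assoc, e3]
    · simpa using hΔ 1 1 (one_pow 3) (one_pow 3) (one_mul 1)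
    · simp only [LinearMap.comp_apply, LinearMap.mulLeft_apply, Bialgebra.comul_mul, ← mul_assoc,
        hΔ 1 1 (one_pow 3) (one_pow 3) (one_mul 1)]
      rw [hx, mul_add, Algebra.TensorProduct.tmul_mul_tmul, Algebra.TensorProduct.tmul_mul_tmul, hEg,
        hgE 1 (one_pow 3), one_smul, mul_one]
  have hω23 : (ω ^ 2) ^ 3 = 1 := by rw [← pow_mul, mul_comm, pow_mul, hω3, one_pow]
  have h12 : (E ω * x) ⊗ₜ[k] E (ω ^ 2) + ω • (E ω ⊗ₜ[k] (E (ω ^ 2) * x)) = 0 := by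
    have e1 : (E ω ⊗ₜ[k] E (ω ^ 2)) * comul (R := k) (E 1 * x) = 0 := by rw [hy, map_zero, mul_zero]
    rw [Bialgebra.comul_mul, ← mul_assoc, hΔ ω (ω ^ 2) hω3 hω23 (by rw [← pow_succ', hω3]), hx, mul_add,
      Algebra.TensorProduct.tmul_mul_tmul, Algebra.TensorProduct.tmul_mul_tmul, hEg, hgE ω hω3, mul_one,
      ← TensorProduct.smul_tmul'] at e1
    exact e1
  have hSg : antipode k g = g ^ 2 := by
    have e1 : antipode k g * g = 1 := by
      have := HopfAlgebra.mul_antipode_rTensor_comul_apply (R := k) g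
      rw [hg.comul_eq_tmul_self] at this
      simpa [hg.counit_eq_one] using this
    calc antipode k g = antipode k g * (g * g ^ 2) := by rw [hggg, mul_one]
      _ = g ^ 2 := by rw [← mul_assoc, e1, one_mul]
  have hSg2 : antipode k (g ^ 2) = g := by
    rw [pow_two, antipode_mul_antidistrib, hSg, ← pow_add, show 2 + 2 = 3 + 1 from rfl, pow_succ, hg3, one_mul]
  have hSE : ∀ z, z ^ 3 = 1 → antipode k (E z) = E (z ^ 2) := by
    intro z hz
    have : (z ^ 2) ^ 2 = z := by linear_combination z * hz
    simp only [E, map_smul, map_add, antipode_one, hSg, hSg2, this]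
    congr 1
    abel
  have hx3 : x = E ω * x + E (ω ^ 2) * x := by
    calc x = (E 1 + E ω + E (ω ^ 2)) * x := by rw [hsum, one_mul]
      _ = _ := by rw [add_mul, add_mul, hy, zero_add]
  by_cases hE1 : E ω = 0
  · have hE2 : E (ω ^ 2) = 0 := by rw [← hSE ω hω3, hE1, map_zero]
    exact ⟨0, by rw [hx3, hE1, hE2]; simp⟩
  have hE2 : E (ω ^ 2) ≠ 0 := by
    intro h
    apply hE1
    have := hSE _ hω23
    rwa [h, map_zero, show (ω ^ 2) ^ 2 = ω by linear_combination ω * hω3, eq_comm] at this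
  have hsep : ∀ v : B, v ≠ 0 → ∃ f : B →ₗ[k] k, f v = 1 := by
    intro v hv
    obtain ⟨f, hf⟩ : ∃ f : B →ₗ[k] k, f v ≠ 0 := by
      by_contra! h
      exact hv ((Module.forall_dual_apply_eq_zero_iff k v).1 h)
    exact ⟨(f v)⁻¹ • f, by simp [hf]⟩
  obtain ⟨f1, hf1⟩ := hsep _ hE1
  obtain ⟨f2, hf2⟩ := hsep _ hE2
  have e1 := congrArg (sliceL f2) h12
  have e2 := congrArg (sliceR f1) h12
  simp only [map_add, map_smul, map_zero, sliceL_tmul, sliceR_tmul, hf1, hf2, one_smul] at e1 e2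
  set c := f1 (E ω * x) with hc
  have e3 : E ω * x = c • E ω := by
    have : E ω * x = (- (ω * f2 (E (ω ^ 2) * x))) • E ω := by
      rw [neg_smul, ← smul_smul]
      exact eq_neg_of_add_eq_zero_left e1
    rw [hc, this, map_smul, hf1, smul_eq_mul, mul_one]
  have e4 : E (ω ^ 2) * x = (- (c * ω ^ 2)) • E (ω ^ 2) := by
    have : E (ω ^ 2) * x = ω ^ 2 • (ω • (E (ω ^ 2) * x)) := by
      rw [smul_smul, ← pow_succ, hω3, one_smul]
    rw [this, eq_neg_of_add_eq_zero_right e2, smul_neg, smul_smul, neg_smul, mul_comm]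
  have e5 : 1 - g = (1 - ω) • (E ω - ω ^ 2 • E (ω ^ 2)) := by
    have : g = E 1 + ω • E ω + ω ^ 2 • E (ω ^ 2) := by
      conv_lhs => rw [← mul_one g, ← hsum, mul_add, mul_add, hgE 1 (one_pow 3), hgE ω hω3, hgE _ hω23, one_smul]
    have e6 : (1 - ω) * ω ^ 2 = ω ^ 2 - 1 := by linear_combination -hω3
    clear_value E
    calc 1 - g = (E 1 + E ω + E (ω ^ 2)) - (E 1 + ω • E ω + ω ^ 2 • E (ω ^ 2)) := by rw [hsum, ← this]
      _ = (1 - ω) • E ω - (ω ^ 2 - 1) • E (ω ^ 2) := by module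
      _ = _ := by rw [← e6]; module
  refine ⟨c * (1 - ω)⁻¹, ?_⟩
  rw [e5, smul_smul, mul_assoc, inv_mul_cancel₀ (sub_ne_zero.2 hω1.symm), mul_one]
  conv_lhs => rw [hx3, e3, e4]
  module

end SkewPrimitive
end HopfClass

namespace HopfClass

section SkewEigen
open WithConv Coalgebra HopfAlgebra
variable {k : Type*} [Field k] {B : Type*} [Ring B] [HopfAlgebra k B] [FiniteDimensional k B]

lemma exists_skewPrimitive_eigenvector [CharZero k] {ω : k} (hω : IsPrimitiveRoot ω 3) {g x : B}
    (hg : IsGroupLikeElem k g) (hg3 : g ^ 3 = 1) (hx : comul (R := k) x = x ⊗ₜ 1 + g ⊗ₜ x)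
    (hx0 : ∀ c : k, x ≠ c • (1 - g)) : ∃ q : k, IsPrimitiveRoot q 3 ∧ ∃ y : B, y ≠ 0 ∧
      comul (R := k) y = y ⊗ₜ 1 + g ⊗ₜ y ∧ g * y = q • (y * g) := by
  have hggg : g * (g * g) = 1 := by rw [← pow_three, hg3]
  have hggx : ∀ v, g * (g * (g * v)) = v := fun v => by rw [← mul_assoc g g, ← mul_assoc, mul_assoc g g g, hggg, one_mul]
  let y : k → B := fun z => x + z ^ 2 • (g * x * (g * g)) + z • ((g * g) * x * g)
  have hgy : ∀ z, z ^ 3 = 1 → g * y z = z • (y z * g) := by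
    intro z hz
    have hz2 : z * z ^ 2 = 1 := by rw [← pow_succ', hz]
    have e1 : g * y z = g * x + z ^ 2 • (g * (g * (x * (g * g)))) + z • (x * g) := by
      simp only [y, mul_smul_comm, mul_add, mul_assoc, hggx]
    have e2 : z • (y z * g) = (z * z ^ 2) • (g * x) + z ^ 2 • (g * (g * (x * (g * g)))) + z • (x * g) := by
      simp only [y, smul_mul_assoc, add_mul, mul_assoc, hggg, mul_one]
      module
    rw [e1, e2, hz2, one_smul]
  have hΔg := hg.comul_eq_tmul_self
  have hΔ : ∀ z, comul (R := k) (y z) = y z ⊗ₜ 1 + g ⊗ₜ y z := by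
    intro z
    have e1 : comul (R := k) (g * x * (g * g)) = (g * x * (g * g)) ⊗ₜ 1 + g ⊗ₜ (g * x * (g * g)) := by
      simp [Bialgebra.comul_mul, hΔg, hx, mul_add, add_mul, mul_assoc, hggg]
    have e2 : comul (R := k) ((g * g) * x * g) = ((g * g) * x * g) ⊗ₜ 1 + g ⊗ₜ ((g * g) * x * g) := by
      simp [Bialgebra.comul_mul, hΔg, hx, mul_add, add_mul, mul_assoc, hggg]
    simp only [y, map_add, map_smul, hx, e1, e2, TensorProduct.add_tmul, TensorProduct.tmul_add,
      TensorProduct.tmul_smul, ← TensorProduct.smul_tmul']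
    module
  have hω3 : ω ^ 3 = 1 := hω.pow_eq_one
  by_cases h1 : y ω = 0
  · by_cases h2 : y (ω ^ 2) = 0
    · exfalso
      have h3 : (3 : k) ≠ 0 := by norm_num
      have hωs : 1 + ω + ω ^ 2 = 0 := by
        have : (ω - 1) * (1 + ω + ω ^ 2) = 0 := by linear_combination hω3
        exact (mul_eq_zero.1 this).resolve_left (sub_ne_zero.2 (hω.ne_one (by norm_num)))
      have hs : y 1 + y ω + y (ω ^ 2) = (3 : k) • x := by
        have e1 : (ω ^ 2) ^ 2 = ω := by linear_combination ω * hω3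
        have : y 1 + y ω + y (ω ^ 2) = (3 : k) • x + (1 + ω + ω ^ 2) • (g * x * (g * g)) +
            (1 + ω + ω ^ 2) • ((g * g) * x * g) := by
          simp only [y, e1]
          module
        rw [this, hωs, zero_smul, zero_smul, add_zero, add_zero]
      rw [h1, h2, add_zero, add_zero] at hs
      obtain ⟨c, hc⟩ := skewPrimitive_eq_of_commute hω hg hg3 (hΔ 1)
        (by rw [hgy 1 (one_pow 3), one_smul])
      refine hx0 ((3 : k)⁻¹ * c) ?_
      rw [← smul_smul, ← hc, hs, smul_smul, inv_mul_cancel₀ h3, one_smul]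
    · refine ⟨ω ^ 2, hω.pow_of_coprime 2 (by norm_num), _, h2, hΔ _, hgy _ ?_⟩
      rw [← pow_mul, mul_comm, pow_mul, hω3, one_pow]
  · exact ⟨ω, hω, _, h1, hΔ _, hgy _ hω3⟩

variable {g x : B} {q : k}

lemma comul_sq_of_skew (hx : comul (R := k) x = x ⊗ₜ 1 + g ⊗ₜ x)
    (hgx : g * x = q • (x * g)) : comul (R := k) (x * x) =
      (x * x) ⊗ₜ 1 + (1 + q) • ((x * g) ⊗ₜ x) + (g * g) ⊗ₜ (x * x) := by
  rw [Bialgebra.comul_mul, hx]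
  simp only [mul_add, add_mul, Algebra.TensorProduct.tmul_mul_tmul, mul_one, one_mul, hgx,
    ← TensorProduct.smul_tmul']
  module

lemma mul_self_ne_zero_of_skew (hq : IsPrimitiveRoot q 3) (hg3 : g ^ 3 = 1)
    (hx : comul (R := k) x = x ⊗ₜ 1 + g ⊗ₜ x) (hgx : g * x = q • (x * g)) (hx0 : x ≠ 0) : x * x ≠ 0 := by
  intro h
  have h1 := comul_sq_of_skew hx hgx
  rw [h, map_zero, TensorProduct.zero_tmul, TensorProduct.tmul_zero, zero_add, add_zero] at h1
  have hq1 : 1 + q ≠ 0 := by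
    intro h2
    have h3 : q ^ 2 = 1 := by linear_combination (q - 1) * h2
    exact absurd (hq.dvd_of_pow_eq_one 2 h3) (by norm_num)
  have h2 : (x * g) ⊗ₜ[k] x = 0 := ((smul_eq_zero).1 h1.symm).resolve_left hq1
  obtain ⟨f, hf⟩ : ∃ f : B →ₗ[k] k, f x ≠ 0 := by
    by_contra! h
    exact hx0 ((Module.forall_dual_apply_eq_zero_iff k x).1 h)
  have h3 := congrArg (sliceL f) h2
  rw [sliceL_tmul, map_zero, smul_eq_zero, or_iff_right hf] at h3
  apply hx0
  have : x * g * g ^ 2 = 0 := by rw [h3, zero_mul]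
  rwa [mul_assoc, ← pow_succ', hg3, mul_one] at this

lemma mul_self_ne_of_skew (hq : IsPrimitiveRoot q 3) (hg3 : g ^ 3 = 1)
    (hx : comul (R := k) x = x ⊗ₜ 1 + g ⊗ₜ x) (hgx : g * x = q • (x * g)) (hx0 : x ≠ 0)
    (a b c d e : k) : x * x ≠ a • 1 + b • g + c • (g * g) + d • x + e • (x * g) := by
  intro h
  apply mul_self_ne_zero_of_skew hq hg3 hx hgx hx0
  have hgv : ∀ v, g * (x * v) = q • (x * (g * v)) := fun v => by
    rw [← mul_assoc, hgx, smul_mul_assoc, mul_assoc]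
  let L : B → B := fun z => g * (g * z - z * g) - q • ((g * z - z * g) * g)
  have e1 : L (x * x) = ((q ^ 2 - 1) * (q ^ 2 - q)) • (x * (x * (g * g))) := by
    simp only [L, mul_sub, sub_mul, mul_assoc, hgv, hgx, mul_smul_comm]
    module
  have e2 : L (a • 1 + b • g + c • (g * g) + d • x + e • (x * g)) = 0 := by
    simp only [L, mul_sub, sub_mul, mul_add, add_mul, mul_assoc, hgv, hgx, mul_smul_comm, smul_mul_assoc, mul_one, one_mul]
    module
  rw [h, e2] at e1
  have hq1 : q ≠ 1 := hq.ne_one (by norm_num)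
  have hq0 : q ≠ 0 := hq.ne_zero (by norm_num)
  have hq2 : q ^ 2 - 1 ≠ 0 := fun h2 =>
    absurd (hq.dvd_of_pow_eq_one 2 (sub_eq_zero.1 h2)) (by norm_num)
  have hq3 : q ^ 2 - q ≠ 0 := by
    rw [pow_two, ← mul_sub_one]
    exact mul_ne_zero hq0 (sub_ne_zero.2 hq1)
  have h5 := (smul_eq_zero.1 e1.symm).resolve_left (mul_ne_zero hq2 hq3)
  have h6 : x * (x * (g * g)) * g = 0 := by rw [h5, zero_mul]
  rwa [mul_assoc, mul_assoc, mul_assoc, ← pow_three, hg3, mul_one] at h6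

lemma ne_of_skew (hq : IsPrimitiveRoot q 3) (hg3 : g ^ 3 = 1) (hgx : g * x = q • (x * g))
    (hx0 : x ≠ 0) (a b : k) : x ≠ a • 1 + b • g := by
  intro h
  have h1 : g * x = x * g := by rw [h]; simp [mul_add, add_mul]
  have h2 : (q - 1) • (x * g) = 0 := by rw [sub_smul, ← hgx, h1, one_smul, sub_self]
  have h3 := (smul_eq_zero.1 h2).resolve_left (sub_ne_zero.2 (hq.ne_one (by norm_num)))
  apply hx0
  have : x * g * g ^ 2 = 0 := by rw [h3, zero_mul]
  rwa [mul_assoc, ← pow_succ', hg3, mul_one] at this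

end SkewEigen

section CartanPos
open WithConv Coalgebra HopfAlgebra
variable {k : Type*} [Field k] {A : Type*} [Ring A] [HopfAlgebra k A] [FiniteDimensional k A]
  {B : Type*} [Ring B] [HopfAlgebra k B] [FiniteDimensional k B]

lemma MatrixData.c_pos_of_ne_zero (w : MatrixData k A) {t s : Fin w.r} {a : A}
    (h : w.e t * a * w.e s ≠ 0) : 0 < w.c t s := by
  unfold MatrixData.c
  rw [Module.finrank_pos_iff]
  refine ⟨⟨⟨_, a, rfl⟩, 0, fun h0 => h ?_⟩⟩
  simpa [mul_assoc] using congrArg Subtype.val h0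

namespace HopfPairing
variable (p : HopfPairing k A B) (w : MatrixData k A) [CharZero k]

lemma c_pos_of_skew (g : GroupLike k B) {x : B} {q : k} (hq : IsPrimitiveRoot q 3) (hg3 : g.val ^ 3 = 1)
    (hx : comul (R := k) x = x ⊗ₜ 1 + g.val ⊗ₜ x) (hgx : g.val * x = q • (x * g.val)) (hx0 : x ≠ 0) :
    0 < w.c (p.ch w g) (p.ch w 1) ∧ 0 < w.c (p.ch w (g * g)) (p.ch w 1) := by
  have h11 : p.P (w.e (p.ch w 1)) 1 = 1 := p.P_e_self w 1
  have hg := g.2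
  have hΔg := hg.comul_eq_tmul_self
  have hΔ2 := comul_sq_of_skew hx hgx
  have hmx : ∀ a a', p.P (a * a') x = p.P a x * p.P a' 1 + p.P a g.val * p.P a' x := fun a a' => by
    rw [p.mul_left, hx]; simp
  have hm1 : ∀ a a', p.P (a * a') 1 = p.P a 1 * p.P a' 1 := fun a a' => by
    rw [p.mul_left]; simp [Algebra.TensorProduct.one_def]
  have hmg : ∀ a a', p.P (a * a') g.val = p.P a g.val * p.P a' g.val := fun a a' => by
    rw [p.mul_left, hΔg]; simp
  have hmgg : ∀ a a', p.P (a * a') (g.val * g.val) = p.P a (g.val * g.val) * p.P a' (g.val * g.val) :=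
    fun a a' => by rw [p.mul_left, Bialgebra.comul_mul, hΔg]; simp
  have hmxg : ∀ a a', p.P (a * a') (x * g.val) = p.P a (x * g.val) * p.P a' g.val +
      p.P a (g.val * g.val) * p.P a' (x * g.val) := fun a a' => by
    rw [p.mul_left, Bialgebra.comul_mul, hΔg, hx]; simp [add_mul]
  have hmxx : ∀ a a', p.P (a * a') (x * x) = p.P a (x * x) * p.P a' 1 +
      (1 + q) * (p.P a (x * g.val) * p.P a' x) + p.P a (g.val * g.val) * p.P a' (x * x) := fun a a' => by
    rw [p.mul_left, hΔ2]; simp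
  constructor
  · by_contra hc
    have h0 : ∀ a, w.e (p.ch w g) * a * w.e (p.ch w 1) = 0 := fun a => by
      by_contra h
      exact hc (w.c_pos_of_ne_zero h)
    have hgg : p.P (w.e (p.ch w g)) g.val = 1 := p.P_e_self w g
    refine ne_of_skew hq hg3 hgx hx0 (- p.P (w.e (p.ch w g)) x) (- p.P (w.e (p.ch w 1)) x) ?_
    refine p.ext_right fun a => ?_
    have h1 := congrArg (fun v => p.P v x) (h0 a)
    simp only [hmx, hmg, hgg, h11, map_zero, LinearMap.zero_apply] at h1
    simp only [map_add, map_smul, smul_eq_mul]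
    linear_combination h1
  · by_contra hc
    have h0 : ∀ a, w.e (p.ch w (g * g)) * a * w.e (p.ch w 1) = 0 := fun a => by
      by_contra h
      exact hc (w.c_pos_of_ne_zero h)
    have hgg : p.P (w.e (p.ch w (g * g))) (g.val * g.val) = 1 := p.P_e_self w (g * g)
    set f := w.e (p.ch w (g * g)) with hf
    set e := w.e (p.ch w 1) with he
    refine mul_self_ne_of_skew hq hg3 hx hgx hx0 (- p.P f (x * x))
      (-((1 + q) * (p.P f (x * g.val) * p.P e x))) (- p.P e (x * x)) (-((1 + q) * p.P f (x * g.val)))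
      (-((1 + q) * p.P e x)) ?_
    refine p.ext_right fun a => ?_
    have h1 := congrArg (fun v => p.P v (x * x)) (h0 a)
    simp only [hmxx, hmxg, hmgg, hgg, h11, map_zero, LinearMap.zero_apply] at h1
    simp only [map_add, map_smul, smul_eq_mul]
    linear_combination h1

end HopfPairing
end CartanPos
end HopfClass

namespace HopfClass

section SkewExistence
variable {k : Type*} [Field k] {A : Type*} [Ring A] [Algebra k A] [FiniteDimensional k A]

namespace MatrixData
variable (w : MatrixData k A)

lemma π_ext_of_n_eq_one {t : Fin w.r} (ht : w.n t = 1) {a b : A} (h : w.χ t a = w.χ t b) :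
    w.π t a = w.π t b := by
  rw [χ_apply, χ_apply] at h
  have : ∀ (m : ℕ) (M N : Matrix (Fin m) (Fin m) k), m = 1 → M.trace = N.trace → M = N := by
    rintro m M N rfl h
    ext i j
    fin_cases i
    fin_cases j
    simpa [Matrix.trace] using h
  exact this _ _ _ ht h

lemma χ_mul_of_n_eq_one {t : Fin w.r} (ht : w.n t = 1) (a b : A) : w.χ t (a * b) = w.χ t a * w.χ t b := by
  rw [χ_apply, χ_apply, χ_apply, map_mul]
  have : ∀ (m : ℕ) (M N : Matrix (Fin m) (Fin m) k), m = 1 → (M * N).trace = M.trace * N.trace := by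
    rintro m M N rfl
    simp [Matrix.trace, Matrix.mul_apply]
  exact this _ _ _ ht

lemma χ_eq_zero {m : A} (hm : ∀ s, w.π s m = 0) (t : Fin w.r) : w.χ t m = 0 := by
  rw [χ_apply, hm, Matrix.trace_zero]

lemma exists_block_unit (t : Fin w.r) : ∃ (a b : Fin (w.n t) → A),
    w.π t (∑ i, a i * w.e t * b i) = 1 ∧ ∀ s, s ≠ t → w.π s (∑ i, a i * w.e t * b i) = 0 := by
  have h1 : ∀ i : Fin (w.n t), ∃ a, w.π t a = Matrix.single i 0 1 ∧ ∀ s, s ≠ t → w.π s a = 0 :=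
    fun i => w.exists_single t _
  have h2 : ∀ i : Fin (w.n t), ∃ a, w.π t a = Matrix.single 0 i 1 ∧ ∀ s, s ≠ t → w.π s a = 0 :=
    fun i => w.exists_single t _
  choose a ha ha' using h1
  choose b hb hb' using h2
  refine ⟨a, b, ?_, fun s hs => ?_⟩
  · simp only [map_sum, map_mul, ha, hb, w.π_e, Matrix.single_mul_single_same, mul_one]
    ext i j
    simp [Matrix.sum_apply, Matrix.single_apply, Matrix.one_apply, ite_and]
  · simp [ha' _ s hs]

lemma eq_zero_of_c_eq_zero {t s : Fin w.r} (h : w.c t s = 0) (a : A) : w.e t * a * w.e s = 0 := by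
  unfold c at h
  rw [Module.finrank_eq_zero_iff_of_free] at h
  have := congrArg Subtype.val (Subsingleton.elim (⟨_, a, rfl⟩ :
    LinearMap.range (LinearMap.mulLeft k (w.e t) ∘ₗ LinearMap.mulRight k (w.e s))) 0)
  simpa [mul_assoc] using this

lemma exists_skew_functional {t₁ : Fin w.r} (h₁ : w.n t₁ = 1) (hc : ∀ t, w.n t ≠ 1 → w.c t t₁ = 0)
    {a₀ : A} (ha₀ : a₀ * w.e t₁ ≠ w.χ t₁ a₀ • w.e t₁) : ∃ t, w.n t = 1 ∧ ∃ x : A →ₗ[k] k,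
      (∀ a b, x (a * b) = w.χ t a * x b + w.χ t₁ b * x a) ∧ ∃ m, (∀ s, w.π s m = 0) ∧ x m ≠ 0 := by
  classical
  set e := w.e t₁ with he
  have hee : e * e = e := w.e_mul t₁
  have hχe : w.χ t₁ e = 1 := w.χ_e t₁
  let M : Ideal A :=
    { carrier := {y | y * e = y ∧ ∀ s, w.π s y = 0}
      add_mem' := fun {a b} ha hb => ⟨by rw [add_mul, ha.1, hb.1], fun s => by rw [map_add, ha.2, hb.2, add_zero]⟩
      zero_mem' := ⟨zero_mul _, fun s => map_zero _⟩
      smul_mem' := fun c y hy => ⟨by rw [smul_eq_mul, mul_assoc, hy.1], fun s => by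
        rw [smul_eq_mul, map_mul, hy.2, mul_zero]⟩ }
  have hD : ∀ a, (a - algebraMap k A (w.χ t₁ a)) * e ∈ M := by
    intro a
    refine ⟨by rw [mul_assoc, hee], fun s => ?_⟩
    by_cases hs : s = t₁
    · subst hs
      rw [map_mul]
      have : w.π s (a - algebraMap k A (w.χ s a)) = w.π s 0 := by
        apply w.π_ext_of_n_eq_one h₁
        rw [Algebra.algebraMap_eq_smul_one]
        simp [χ_one, h₁]
      rw [this, map_zero, zero_mul]
    · rw [map_mul, he, w.π_e_ne _ _ hs, mul_zero]
  obtain ⟨m, hm, hmJ⟩ : ∃ m ∈ M, m ∉ Ring.jacobson A * M := by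
    by_contra! hcon
    have hle : M ≤ Ring.jacobson A * M := hcon
    have hpow : ∀ j : ℕ, M ≤ (Ring.jacobson A : Ideal A) ^ j * M := by
      intro j
      induction j with
      | zero => rw [Submodule.pow_zero, Submodule.one_mul]
      | succ j ih =>
        rw [Submodule.pow_succ, mul_assoc]
        exact ih.trans (Ideal.mul_mono_right hle)
    obtain ⟨j, hj⟩ := w.nil
    have h0 := hpow j (hD a₀)
    rw [hj, zero_mul] at h0
    rw [Submodule.zero_eq_bot, Submodule.mem_bot, sub_mul, ← Algebra.smul_def, sub_eq_zero] at h0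
    exact ha₀ h0
  obtain ⟨f, hf0, hf⟩ := Submodule.exists_le_ker_of_notMem (p := (Ring.jacobson A * M).restrictScalars k) hmJ
  have hfJ : ∀ j, (∀ s, w.π s j = 0) → ∀ y ∈ M, f (j * y) = 0 := fun j hj y hy =>
    hf (show j * y ∈ Ring.jacobson A * M from Ideal.mul_mem_mul ((w.jac j).2 hj) hy)
  choose a b hu hu' using w.exists_block_unit
  let u : Fin w.r → A := fun t => ∑ i, a t i * w.e t * b t i
  have hu1 : ∀ y ∈ M, f y = ∑ t, f (u t * y) := by
    intro y hy
    have := hfJ (1 - ∑ t, u t) (fun s => by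
      rw [map_sub, map_sum, Finset.sum_eq_single s (fun t _ hts => hu' t s hts.symm) (by simp), hu, map_one,
        sub_self]) y hy
    rwa [sub_mul, map_sub, one_mul, Finset.sum_mul, map_sum, sub_eq_zero] at this
  obtain ⟨t, ht⟩ : ∃ t, f (u t * m) ≠ 0 := by
    by_contra! h
    exact hf0 (by rw [hu1 m hm]; exact Finset.sum_eq_zero fun t _ => h t)
  have hnt : w.n t = 1 := by
    by_contra hnt
    apply ht
    have : u t * m = 0 := by
      rw [← hm.1, Finset.sum_mul]
      refine Finset.sum_eq_zero fun i _ => ?_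
      have := w.eq_zero_of_c_eq_zero (hc t hnt) (b t i * m)
      rw [mul_assoc, mul_assoc, ← mul_assoc _ m, ← mul_assoc (w.e t), this, mul_zero]
    rw [this, map_zero]
  have hut : ∀ c y, y ∈ M → f (u t * (c * y)) = w.χ t c * f (u t * y) := by
    intro c y hy
    have := hfJ (u t * c - w.χ t c • u t) (fun s => by
      by_cases hs : s = t
      · subst hs
        rw [map_sub, map_mul, map_smul, hu, one_mul]
        rw [← map_one (w.π s), ← map_smul, sub_eq_zero]
        apply w.π_ext_of_n_eq_one hnt
        simp [χ_one, hnt]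
      · rw [map_sub, map_mul, map_smul, hu' t s hs, zero_mul, smul_zero, sub_self]) y hy
    rwa [sub_mul, map_sub, smul_mul_assoc, map_smul, smul_eq_mul, sub_eq_zero, mul_assoc] at this
  let x : A →ₗ[k] k := f ∘ₗ LinearMap.mulLeft k (u t) ∘ₗ LinearMap.mulRight k e ∘ₗ
    (LinearMap.id - Algebra.linearMap k A ∘ₗ w.χ t₁)
  have hx : ∀ c, x c = f (u t * ((c - algebraMap k A (w.χ t₁ c)) * e)) := fun c => by simp [x]
  refine ⟨t, hnt, x, fun c d => ?_, m, hm.2, ?_⟩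
  · have h1 : (c * d - algebraMap k A (w.χ t₁ (c * d))) * e =
        c * ((d - algebraMap k A (w.χ t₁ d)) * e) + w.χ t₁ d • ((c - algebraMap k A (w.χ t₁ c)) * e) := by
      rw [w.χ_mul_of_n_eq_one h₁]
      simp only [Algebra.algebraMap_eq_smul_one, sub_mul, mul_sub, smul_mul_assoc, mul_smul_comm, one_mul,
        mul_assoc]
      module
    rw [hx, hx, hx, h1, mul_add, map_add, hut _ _ (hD d), mul_smul_comm, map_smul, smul_eq_mul]
  · rw [hx, w.χ_eq_zero hm.2, map_zero, sub_zero, hm.1]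
    exact ht

end MatrixData
end SkewExistence

section SkewExistenceHopf
open WithConv Coalgebra HopfAlgebra
variable {k : Type*} [Field k] {A : Type*} [Ring A] [HopfAlgebra k A] [FiniteDimensional k A]
  {B : Type*} [Ring B] [HopfAlgebra k B] [FiniteDimensional k B]

namespace HopfPairing
variable (p : HopfPairing k A B)

lemma tensor_ext {u v : B ⊗[k] B} (h : ∀ a a', tmulFun (p.P a) (p.P a') u = tmulFun (p.P a) (p.P a') v) :
    u = v := by
  rw [← sub_eq_zero]
  apply eq_zero_of_tmulFun_eq_zero
  intro f g
  obtain ⟨a, rfl⟩ : ∃ a, p.P a = f := p.symm.funEquiv.surjective f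
  obtain ⟨b, rfl⟩ : ∃ a, p.P a = g := p.symm.funEquiv.surjective g
  rw [map_sub, h, sub_self]

variable (w : MatrixData k A) [CharZero k]

lemma exists_skewPrimitive (hc : ∀ t, w.n t ≠ 1 → w.c t (p.ch w 1) = 0)
    (hε : ∀ Λ : A, IsLeftInt k Λ → counit (R := k) Λ = 0) : ∃ (g : GroupLike k B) (x : B),
      comul (R := k) x = x ⊗ₜ 1 + g.val ⊗ₜ x ∧ ∀ c : k, x ≠ c • (1 - g.val) := by
  have hcou : ∀ a, w.χ (p.ch w 1) a = counit (R := k) a := fun a => by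
    rw [← p.P_groupLike, GroupLike.val_one, p.one_right]
  obtain ⟨a₀, ha₀⟩ : ∃ a₀, a₀ * w.e (p.ch w 1) ≠ w.χ (p.ch w 1) a₀ • w.e (p.ch w 1) := by
    by_contra! h
    have := hε (w.e (p.ch w 1)) (fun a => by rw [h, hcou])
    rw [← hcou, w.χ_e] at this
    exact one_ne_zero this
  obtain ⟨t, ht, x, hx, m, hm, hxm⟩ := w.exists_skew_functional (p.n_ch w 1) hc ha₀
  obtain ⟨g, rfl⟩ := p.exists_ch_eq w ht
  refine ⟨g, p.ofFun x, ?_, fun c hxc => hxm ?_⟩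
  · refine p.tensor_ext fun a a' => ?_
    rw [← p.mul_left, P_ofFun, hx, hcou, ← p.P_groupLike]
    simp only [map_add, tmulFun_tmul, P_ofFun, p.one_right]
    ring
  · have := congrArg (p.P m) hxc
    rw [P_ofFun, map_smul, map_sub, p.P_groupLike w, w.χ_eq_zero hm, p.one_right, ← hcou, w.χ_eq_zero hm] at this
    simpa using this

end HopfPairing
end SkewExistenceHopf
end HopfClass

namespace HopfClass

section Counting
open WithConv Coalgebra HopfAlgebra
variable {k : Type*} [Field k] {A : Type*} [Ring A] [HopfAlgebra k A] [FiniteDimensional k A]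
  {B : Type*} [Ring B] [HopfAlgebra k B] [FiniteDimensional k B]

lemma MatrixData.sum_le_pd (w : MatrixData k A) (s : Finset (Fin w.r)) (t : Fin w.r) :
    ∑ i ∈ s, w.n i * w.c i t ≤ w.pd t :=
  Finset.sum_le_sum_of_subset (Finset.subset_univ s)

lemma MatrixData.n_pos (w : MatrixData k A) (t : Fin w.r) : 0 < w.n t := Nat.pos_of_ne_zero (NeZero.ne _)

lemma MatrixData.n_le_pd (w : MatrixData k A) (t : Fin w.r) : w.n t ≤ w.pd t := by
  have := w.sum_le_pd {t} t
  rw [Finset.sum_singleton] at this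
  exact (Nat.le_mul_of_pos_right _ (w.c_pos t)).trans this

namespace HopfPairing
variable (p : HopfPairing k A B) (w : MatrixData k A) [CharZero k]

lemma sq_ne_one_of_pow_three {G : Type*} [Group G] {g : G} (h3 : g ^ 3 = 1) (h1 : g ≠ 1) :
    g * g ≠ 1 := by
  intro h
  apply h1
  rw [pow_succ, pow_two, h, one_mul] at h3
  exact h3

lemma lt_lt_lt {g : GroupLike k B} (h3 : g ^ 3 = 1) (t : Fin w.r) :
    p.lt w g (p.lt w g (p.lt w g t)) = t := by
  have h2 : p.lt w (g ^ 3) t = t := by rw [h3, lt_one]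
  simpa only [pow_succ, pow_zero, one_mul, lt_mul] using h2

lemma orbit_cases {g : GroupLike k B} (h3 : g ^ 3 = 1) (h1 : g ≠ 1) {T : Finset (Fin w.r)}
    (hT : ∀ s ∈ T, p.lt w g s ∈ T) (hT1 : ∀ s ∈ T, w.n s ≠ 1) {t : Fin w.r} (ht : t ∈ T) :
    (p.lt w g t = t ∧ 3 ≤ w.n t ∧ (∀ s ∈ T.erase t, p.lt w g s ∈ T.erase t) ∧
      ∑ s ∈ T, w.n s * w.pd s = w.n t * w.pd t + ∑ s ∈ T.erase t, w.n s * w.pd s) ∨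
    (2 ≤ w.n t ∧ ∃ T' ⊆ T, (∀ s ∈ T', p.lt w g s ∈ T') ∧ (∀ s ∈ T, s ∈ T' ∨ w.n s = w.n t) ∧
      ∑ s ∈ T, w.n s * w.pd s = 3 * (w.n t * w.pd t) + ∑ s ∈ T', w.n s * w.pd s) := by
  classical
  have hn := w.n_pos t
  have hn1 := hT1 t ht
  by_cases hf : p.lt w g t = t
  · left
    have hn2 := p.n_ne_two w hf h1 (sq_ne_one_of_pow_three h3 h1)
    refine ⟨hf, by omega, fun s hs => ?_, (Finset.add_sum_erase T _ ht).symm⟩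
    rw [Finset.mem_erase] at hs ⊢
    exact ⟨fun h => hs.1 ((p.lt w g).injective (h.trans hf.symm)), hT s hs.2⟩
  · right
    have hgb := p.lt_lt_lt w h3 t
    obtain ⟨a, ha⟩ : ∃ a, p.lt w g t = a := ⟨_, rfl⟩
    obtain ⟨b, hb⟩ : ∃ b, p.lt w g a = b := ⟨_, rfl⟩
    rw [ha, hb] at hgb
    rw [ha] at hf
    have hab : b ≠ a := fun h => hf ((p.lt w g).injective (by rw [hb, ha, h]))
    have htb : b ≠ t := fun h => hf (by rw [← ha]; rw [h] at hgb; exact hgb)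
    have haT : a ∈ T := ha ▸ hT _ ht
    have hbT : b ∈ T := hb ▸ hT _ haT
    let O : Finset (Fin w.r) := {t, a, b}
    have hO : ∀ s, s ∈ O ↔ s = t ∨ s = a ∨ s = b := fun s => by simp [O]
    have hOT : O ⊆ T := by
      intro s hs
      rcases (hO s).1 hs with rfl | rfl | rfl <;> assumption
    have hna : w.n a = w.n t := by rw [← ha, n_lt]
    have hnb : w.n b = w.n t := by rw [← hb, n_lt, hna]
    have hpa : w.pd a = w.pd t := by rw [← ha, pd_lt]
    have hpb : w.pd b = w.pd t := by rw [← hb, pd_lt, hpa]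
    refine ⟨by omega, T \ O, Finset.sdiff_subset, fun s hs => ?_, fun s hs => ?_, ?_⟩
    · rw [Finset.mem_sdiff] at hs ⊢
      refine ⟨hT s hs.1, fun h => hs.2 ?_⟩
      rw [hO] at h ⊢
      rcases h with h | h | h
      · exact Or.inr (Or.inr ((p.lt w g).injective (h.trans hgb.symm)))
      · exact Or.inl ((p.lt w g).injective (h.trans ha.symm))
      · exact Or.inr (Or.inl ((p.lt w g).injective (h.trans hb.symm)))
    · by_cases h : s ∈ O
      · right
        rcases (hO s).1 h with rfl | rfl | rfl <;> simp [hna, hnb]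
      · exact Or.inl (Finset.mem_sdiff.2 ⟨hs, h⟩)
    · rw [← Finset.sum_sdiff hOT, add_comm]
      congr 1
      rw [Finset.sum_insert (by simp [Ne.symm hf, Ne.symm htb]), Finset.sum_insert (by simp [Ne.symm hab]),
        Finset.sum_singleton, hna, hnb, hpa, hpb]
      ring

lemma nine_le {g : GroupLike k B} (h3 : g ^ 3 = 1) (h1 : g ≠ 1) {T : Finset (Fin w.r)}
    (hT : ∀ s ∈ T, p.lt w g s ∈ T) (hT1 : ∀ s ∈ T, w.n s ≠ 1) (hne : T.Nonempty) :
    9 ≤ ∑ s ∈ T, w.n s * w.pd s := by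
  obtain ⟨t, ht⟩ := hne
  have hp := w.n_le_pd t
  rcases p.orbit_cases w h3 h1 hT hT1 ht with ⟨-, hn, -, h⟩ | ⟨hn, T', -, -, -, h⟩ <;> rw [h]
  · have := Nat.mul_le_mul hn (hn.trans hp)
    omega
  · have := Nat.mul_le_mul hn (hn.trans hp)
    omega

/-- The indices of the representations of dimension at least two. -/
def big (w : MatrixData k A) : Finset (Fin w.r) := Finset.univ.filter fun s => w.n s ≠ 1

lemma mem_big {s : Fin w.r} : s ∈ big w ↔ w.n s ≠ 1 := by simp [big]

lemma lt_mem_big (g : GroupLike k B) (s) (hs : s ∈ big w) : p.lt w g s ∈ big w := by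
  rw [mem_big] at hs ⊢
  rwa [n_lt]

lemma finrank_eq_add : Module.finrank k A = Nat.card (GroupLike k B) * w.pd (p.ch w 1) +
    ∑ s ∈ big w, w.n s * w.pd s := by
  classical
  exact p.finrank_eq_sum w

/-- If `ε` vanishes on left integrals then the Cartan matrix has an extra entry. -/
lemma exists_cartan_entry (hε : ∀ Λ : A, IsLeftInt k Λ → counit (R := k) Λ = 0) :
    2 ≤ w.c (p.ch w 1) (p.ch w 1) ∨ ∃ h : GroupLike k B, h ≠ 1 ∧ 0 < w.c (p.ch w h) (p.ch w 1) := by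
  have hcou : ∀ a, p.P a (1 : GroupLike k B).val = counit (R := k) a := fun a => by
    rw [GroupLike.val_one, p.one_right]
  have : Nontrivial A := ⟨w.e (p.ch w 1), 0, w.e_ne_zero _⟩
  obtain ⟨Λ, h0, hl⟩ := exists_left_integral k A
  obtain ⟨α, hα⟩ := exists_distinguished k A hl h0
  obtain ⟨h, hh⟩ := p.exists_groupLike (α := α.toLinearMap) (by simp) (by simp)
  have h1 : w.e (p.ch w 1) * Λ = Λ := by
    rw [hl, ← hcou, p.P_e_self, one_smul]
  have h2 : Λ * w.e (p.ch w h) = Λ := by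
    rw [hα, ← α.toLinearMap_apply, ← hh, p.P_e_self, one_smul]
  by_cases hh1 : h = 1
  · left
    subst hh1
    rw [MatrixData.c]
    let R := LinearMap.range
      (LinearMap.mulLeft k (w.e (p.ch w 1)) ∘ₗ LinearMap.mulRight k (w.e (p.ch w 1)))
    have m1 : w.e (p.ch w 1) ∈ R := ⟨w.e (p.ch w 1), by simp [w.e_mul]⟩
    have m2 : Λ ∈ R := ⟨Λ, by simp [h1, h2]⟩
    have hli : LinearIndependent k ![(⟨_, m1⟩ : R), ⟨_, m2⟩] := by
      rw [LinearIndependent.pair_iff]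
      intro s t hst
      have h3 : s • w.e (p.ch w 1) + t • Λ = 0 := congrArg Subtype.val hst
      have hs : s = 0 := by
        have h4 := congrArg (counit (R := k)) h3
        rw [map_add, map_smul, map_smul, hε Λ hl, ← hcou, p.P_e_self] at h4
        simpa using h4
      refine ⟨hs, ?_⟩
      rw [hs, zero_smul, zero_add] at h3
      exact (smul_eq_zero.1 h3).resolve_right h0
    simpa using hli.fintype_card_le_finrank
  · right
    refine ⟨h⁻¹, inv_ne_one.2 hh1, ?_⟩
    have h3 : 0 < w.c (p.ch w 1) (p.ch w h) := w.c_pos_of_ne_zero (a := Λ) (by rwa [h1, h2])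
    rwa [← p.c_lt w h⁻¹, p.lt_ch, p.lt_ch, mul_one, inv_mul_cancel] at h3

lemma two_le_pd (hε : ∀ Λ : A, IsLeftInt k Λ → counit (R := k) Λ = 0) :
    2 ≤ w.pd (p.ch w 1) := by
  rcases p.exists_cartan_entry w hε with h | ⟨h, h1, hc⟩
  · have := w.sum_le_pd {p.ch w 1} (p.ch w 1)
    simp only [Finset.sum_singleton, n_ch] at this
    omega
  · have := w.sum_le_pd {p.ch w 1, p.ch w h} (p.ch w 1)
    rw [Finset.sum_pair (fun e => h1 (p.ch_injective w e).symm)] at this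
    simp only [n_ch] at this
    have := w.c_pos (p.ch w 1)
    omega

lemma add_two_le_pd (hε : ∀ Λ : A, IsLeftInt k Λ → counit (R := k) Λ = 0) {t : Fin w.r}
    (ht : w.n t ≠ 1) (hc : w.c t (p.ch w 1) ≠ 0) : w.n t + 2 ≤ w.pd (p.ch w 1) := by
  have hne : ∀ h, p.ch w h ≠ t := fun h e => ht (by rw [← e, n_ch])
  have hn : w.n t ≤ w.n t * w.c t (p.ch w 1) :=
    Nat.le_mul_of_pos_right _ (Nat.pos_of_ne_zero hc)
  rcases p.exists_cartan_entry w hε with h | ⟨h, h1, hch⟩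
  · have := w.sum_le_pd {p.ch w 1, t} (p.ch w 1)
    rw [Finset.sum_pair (hne _), n_ch] at this
    omega
  · have := w.sum_le_pd {p.ch w 1, p.ch w h, t} (p.ch w 1)
    rw [Finset.sum_insert (by simp [hne, (p.ch_injective w).eq_iff, Ne.symm h1]),
      Finset.sum_pair (hne _), n_ch, n_ch] at this
    have := w.c_pos (p.ch w 1)
    omega

lemma orderOf_three_le {g : GroupLike k B} (h3 : g ^ 3 = 1) (h1 : g ≠ 1) :
    3 ≤ Nat.card (GroupLike k B) := by
  rw [← orderOf_eq_prime h3 h1]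
  exact orderOf_le_card

/-- No representation of dimension at least two occurs in the projective cover of the counit. -/
lemma c_ch_one_eq_zero (hdim : Module.finrank k A = 27)
    (hε : ∀ Λ : A, IsLeftInt k Λ → counit (R := k) Λ = 0) {g : GroupLike k B} (h3 : g ^ 3 = 1)
    (h1 : g ≠ 1) (t : Fin w.r) (ht : w.n t ≠ 1) : w.c t (p.ch w 1) = 0 := by
  by_contra hc
  have hd := p.add_two_le_pd w hε ht hc
  have hN := orderOf_three_le h3 h1
  have hsum := p.finrank_eq_add w
  rw [hdim] at hsum
  have hNd := Nat.mul_le_mul hN hd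
  have hu : w.n (p.st w t) = w.n t := p.n_st w t
  have hcu : 0 < w.c (p.ch w 1) (p.st w t) := by
    have := p.c_st w t (p.ch w 1)
    rw [st_ch, inv_one] at this
    omega
  obtain ⟨u, hu'⟩ : ∃ u, p.st w t = u := ⟨_, rfl⟩
  rw [hu'] at hu hcu
  have hub : u ∈ big w := (mem_big w).2 (by omega)
  have hne : ∀ h, p.ch w h ≠ u := fun h e => ht (by rw [← hu, ← e, n_ch])
  have hnu : w.n u ≤ w.n u * w.c u u := Nat.le_mul_of_pos_right _ (w.c_pos u)
  rcases p.orbit_cases w h3 h1 (p.lt_mem_big w g) (fun s => (mem_big w).1) hub with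
    ⟨hf, hn, -, hs⟩ | ⟨hn, T', -, -, -, hs⟩
  · have hg2 := sq_ne_one_of_pow_three h3 h1
    have hc1 : w.c (p.ch w g) u = w.c (p.ch w 1) u := by
      have := p.c_lt w g (p.ch w 1) u
      rwa [lt_ch, mul_one, hf] at this
    have hc2 : w.c (p.ch w (g * g)) u = w.c (p.ch w 1) u := by
      have := p.c_lt w g (p.ch w g) u
      rwa [lt_ch, hf, hc1] at this
    have := w.sum_le_pd {p.ch w 1, p.ch w g, p.ch w (g * g), u} u
    rw [Finset.sum_insert (by simp [hne, (p.ch_injective w).eq_iff, Ne.symm h1, Ne.symm hg2]),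
      Finset.sum_insert (by simp [hne, (p.ch_injective w).eq_iff, h1]),
      Finset.sum_pair (hne _), n_ch, n_ch, n_ch, hc1, hc2] at this
    have := Nat.mul_le_mul hn (show 6 ≤ w.pd u by omega)
    omega
  · have := w.sum_le_pd {p.ch w 1, u} u
    rw [Finset.sum_pair (hne _), n_ch] at this
    have := Nat.mul_le_mul hn (show 3 ≤ w.pd u by omega)
    omega

/-- The dimension of a projective cover, with the one-dimensional composition factors collected. -/
lemma pd_eq_add (t : Fin w.r) : w.pd t = (∑ᶠ h : GroupLike k B, w.c (p.ch w h) t) +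
    ∑ s ∈ big w, w.n s * w.c s t := by
  classical
  have := Fintype.ofFinite (GroupLike k B)
  rw [MatrixData.pd, ← Finset.sum_filter_add_sum_filter_not Finset.univ (fun s => w.n s = 1)]
  congr 1
  rw [finsum_eq_sum_of_fintype]
  refine (Finset.sum_bij (fun g _ => p.ch w g) ?_ ?_ ?_ ?_).symm
  · intro g _; simp
  · intro g _ h _ e; exact p.ch_injective w e
  · intro t ht
    obtain ⟨g, hg⟩ := p.exists_ch_eq w (Finset.mem_filter.1 ht).2
    exact ⟨g, Finset.mem_univ _, hg⟩
  · intro g _; rw [n_ch, one_mul]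

end HopfPairing
end Counting
end HopfClass

namespace HopfClass

section CountingTwo
open WithConv Coalgebra HopfAlgebra
variable {k : Type*} [Field k] {A : Type*} [Ring A] [HopfAlgebra k A] [FiniteDimensional k A]
  {B : Type*} [Ring B] [HopfAlgebra k B] [FiniteDimensional k B]

namespace HopfPairing
variable (p : HopfPairing k A B) (w : MatrixData k A) [CharZero k]

lemma exists_pow_three_eq_one (hB : Module.finrank k B = 27) (hne : Nat.card (GroupLike k B) ≠ 1) :
    ∃ g : GroupLike k B, g ^ 3 = 1 ∧ g ≠ 1 := by
  obtain ⟨a, ha⟩ := card_groupLike_eq_pow (k := k) hB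
  have h3 : 3 ∣ Nat.card (GroupLike k B) := by
    rw [ha]
    exact dvd_pow_self 3 (fun h => hne (by rw [ha, h, pow_zero]))
  have : Fact (Nat.Prime 3) := ⟨Nat.prime_three⟩
  obtain ⟨g, hg⟩ := exists_prime_orderOf_dvd_card' 3 h3
  refine ⟨g, by rw [← hg, pow_orderOf_eq_one], fun h => ?_⟩
  rw [h, orderOf_one] at hg
  norm_num at hg

lemma groupLike_cases (hN : Nat.card (GroupLike k B) = 3) {g : GroupLike k B} (h3 : g ^ 3 = 1)
    (h1 : g ≠ 1) (h : GroupLike k B) : h = 1 ∨ h = g ∨ h = g * g := by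
  classical
  have := Fintype.ofFinite (GroupLike k B)
  have hg2 := sq_ne_one_of_pow_three h3 h1
  have hc : ({1, g, g * g} : Finset (GroupLike k B)).card = Fintype.card (GroupLike k B) := by
    rw [← Nat.card_eq_fintype_card, hN, Finset.card_eq_three]
    exact ⟨_, _, _, Ne.symm h1, Ne.symm hg2, fun e => h1 (by simpa using e), rfl⟩
  have := Finset.mem_univ h
  rw [← (Finset.card_eq_iff_eq_univ _).1 hc] at this
  simpa using this

lemma exists_skew_eigenvector (p : HopfPairing k A B) [IsAlgClosed k] (hdim : Module.finrank k A = 27)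
    (hε : ∀ Λ : A, IsLeftInt k Λ → counit (R := k) Λ = 0) (hN : Nat.card (GroupLike k B) = 3) :
    ∃ (g : GroupLike k B) (x : B) (q : k), g ≠ 1 ∧ g ^ 3 = 1 ∧ IsPrimitiveRoot q 3 ∧ x ≠ 0 ∧
      comul (R := k) x = x ⊗ₜ 1 + g.val ⊗ₜ x ∧ g.val * x = q • (x * g.val) := by
  obtain ⟨w⟩ := exists_matrixData k A
  obtain ⟨g₀, h₀, h₁⟩ := exists_pow_three_eq_one (k := k) (p.finrank_eq ▸ hdim) (by rw [hN]; norm_num)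
  obtain ⟨g, x, hx, hx0⟩ := p.exists_skewPrimitive w (p.c_ch_one_eq_zero w hdim hε h₀ h₁) hε
  have hg3 : g ^ 3 = 1 := by rw [← hN, pow_card_eq_one']
  have hv3 : g.val ^ 3 = 1 := by rw [← GroupLike.val_pow, hg3, GroupLike.val_one]
  have : NeZero ((3 : ℕ) : k) := ⟨by norm_num⟩
  obtain ⟨ω, hω⟩ := HasEnoughRootsOfUnity.exists_primitiveRoot k 3
  obtain ⟨q, hq, y, hy0, hy, hgy⟩ := exists_skewPrimitive_eigenvector hω g.2 hv3 hx hx0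
  refine ⟨g, y, q, ?_, hg3, hq, hy0, hy, hgy⟩
  rintro rfl
  rw [GroupLike.val_one, one_mul, mul_one] at hgy
  have : (1 - q) • y = 0 := by rw [sub_smul, one_smul, ← hgy, sub_self]
  exact hq.ne_one (by norm_num) (sub_eq_zero.1 ((smul_eq_zero.1 this).resolve_right hy0)).symm

lemma c_ch_pos [IsAlgClosed k] (hdim : Module.finrank k A = 27)
    (hε : ∀ Λ : A, IsLeftInt k Λ → counit (R := k) Λ = 0) (hN : Nat.card (GroupLike k B) = 3)
    (h : GroupLike k B) : 0 < w.c (p.ch w h) (p.ch w 1) := by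
  obtain ⟨g, x, q, h1, h3, hq, hx0, hx, hgx⟩ := p.exists_skew_eigenvector hdim hε hN
  have hv3 : g.val ^ 3 = 1 := by rw [← GroupLike.val_pow, h3, GroupLike.val_one]
  have := p.c_pos_of_skew w g hq hv3 hx hgx hx0
  rcases groupLike_cases hN h3 h1 h with rfl | rfl | rfl
  exacts [w.c_pos _, this.1, this.2]

lemma three_le_pd [IsAlgClosed k] (hdim : Module.finrank k A = 27)
    (hε : ∀ Λ : A, IsLeftInt k Λ → counit (R := k) Λ = 0) (hN : Nat.card (GroupLike k B) = 3) :
    3 ≤ w.pd (p.ch w 1) := by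
  have := Fintype.ofFinite (GroupLike k B)
  rw [p.pd_eq_add, finsum_eq_sum_of_fintype, ← hN, Nat.card_eq_fintype_card, Fintype.card_eq_sum_ones]
  exact le_add_right (Finset.sum_le_sum fun h _ => p.c_ch_pos w hdim hε hN h)

lemma c_big_ch_eq_zero (hc : ∀ t, w.n t ≠ 1 → w.c t (p.ch w 1) = 0) (h : GroupLike k B) {t : Fin w.r}
    (ht : w.n t ≠ 1) : w.c t (p.ch w h) = 0 := by
  rw [← p.c_lt w h⁻¹, lt_ch, inv_mul_cancel]
  exact hc _ (by rwa [n_lt])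

lemma c_ch_big_eq_zero (hc : ∀ t, w.n t ≠ 1 → w.c t (p.ch w 1) = 0) (h : GroupLike k B) {t : Fin w.r}
    (ht : w.n t ≠ 1) : w.c (p.ch w h) t = 0 := by
  rw [← p.c_st w, st_ch]
  exact p.c_big_ch_eq_zero w hc _ (by rwa [n_st])

lemma pd_eq_sum_big (hc : ∀ t, w.n t ≠ 1 → w.c t (p.ch w 1) = 0) {t : Fin w.r} (ht : w.n t ≠ 1) :
    w.pd t = ∑ s ∈ big w, w.n s * w.c s t := by
  rw [p.pd_eq_add, finsum_eq_zero_of_forall_eq_zero fun h => p.c_ch_big_eq_zero w hc h ht, zero_add]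

/-- A single big representation, with Cartan entry two, cannot occur. -/
lemma false_of_pd_eq_six (hN : Nat.card (GroupLike k B) = 3) {g : GroupLike k B} (h3 : g ^ 3 = 1)
    (h1 : g ≠ 1) (hc : ∀ t, w.n t ≠ 1 → w.c t (p.ch w 1) = 0) (hd : w.pd (p.ch w 1) = 3)
    {t : Fin w.r} (ht : p.lt w g t = t) (hb : big w = {t}) (hct : w.c t t = 2) : False := by
  classical
  have hmem : ∀ s, w.n s ≠ 1 ↔ s = t := fun s => by rw [← mem_big w, hb, Finset.mem_singleton]
  have htn := (hmem t).2 rfl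
  have hfix : ∀ h : GroupLike k B, p.lt w h t = t := by
    intro h
    rcases groupLike_cases hN h3 h1 h with rfl | rfl | rfl
    · rw [lt_one]
    · exact ht
    · rw [lt_mul, ht, ht]
  obtain ⟨N, hNN, -⟩ := IsRep.exists_eq_sum (w := w) ((p.isRep_X w t).mul (p.isRep_X w t).antipode)
  have hid := tensor_identity (w := w) (w.e (p.ch w 1)) (p.isRep_X w t)
  have hPX : ∀ s, p.P (w.e t) (p.X w s) = if t = s then 1 else 0 := fun s => by
    rw [P_X, w.χ_e_eq]
    congr 1
    exact propext eq_comm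
  apply_fun p.P (w.e t) at hid
  have hR : p.P (w.e t) (∑ s, ∑ u, ((w.c s u : k) *
      p.P (w.e (p.ch w 1)) (p.X w u * antipode k (p.X w t))) • p.X w s) = 2 * N (p.ch w 1) := by
    simp only [map_sum, map_smul, hPX, smul_eq_mul, mul_ite, mul_one, mul_zero]
    rw [Finset.sum_comm]
    simp only [Finset.sum_ite_eq, Finset.mem_univ, if_true]
    rw [Finset.sum_eq_single t]
    · rw [hNN, hct]; norm_num
    · intro s _ hs
      obtain ⟨h, rfl⟩ := p.exists_ch_eq w (not_not.1 (mt (hmem s).1 hs))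
      rw [p.c_big_ch_eq_zero w hc h htn, Nat.cast_zero, zero_mul]
    · simp
  have hL : p.P (w.e t) ((∑ s, ∑ u, ((w.c s u : k) * w.χ u (w.e (p.ch w 1))) • p.X w s) *
      p.X w t) = 3 := by
    have h5 : ((w.pd (p.ch w 1) : ℕ) : k) = 3 := by rw [hd]; norm_num
    rw [← h5, MatrixData.pd, Nat.cast_sum, Finset.sum_mul, map_sum]
    refine Finset.sum_congr rfl fun s _ => ?_
    rw [Finset.sum_eq_single (p.ch w 1)]
    · rw [w.χ_e, mul_one, smul_mul_assoc, map_smul, smul_eq_mul]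
      by_cases hs : w.n s = 1
      · obtain ⟨h, rfl⟩ := p.exists_ch_eq w hs
        rw [X_ch, ← X_lt, hfix, hPX, if_pos rfl, n_ch, one_mul, mul_one]
      · rw [hc s hs]; simp
    · intro u _ hu
      rw [w.χ_e_eq, if_neg (hu)]; simp
    · simp
  rw [hL, hR] at hid
  have : (3 : ℕ) = 2 * N (p.ch w 1) := by exact_mod_cast hid
  omega

lemma eq_empty_of_sum_lt {g : GroupLike k B} (h3 : g ^ 3 = 1) (h1 : g ≠ 1) {T : Finset (Fin w.r)}
    (hT : ∀ s ∈ T, p.lt w g s ∈ T) (hT1 : ∀ s ∈ T, w.n s ≠ 1)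
    (h : ∑ s ∈ T, w.n s * w.pd s < 9) : T = ∅ := by
  by_contra hne
  have := p.nine_le w h3 h1 hT hT1 (Finset.nonempty_iff_ne_empty.2 hne)
  omega

lemma eq_three_of_mul_eq_nine {n m : ℕ} (h3 : 3 ≤ n) (hnm : n ≤ m) (h : n * m ≤ 9) :
    n = 3 ∧ m = 3 := by
  have hn : n = 3 := by nlinarith
  subst hn
  omega

/-- A closed set of representations of total dimension nine is a single fixed one. -/
lemma eq_singleton_of_sum_eq_nine {g : GroupLike k B} (h3 : g ^ 3 = 1) (h1 : g ≠ 1)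
    {T : Finset (Fin w.r)} (hT : ∀ s ∈ T, p.lt w g s ∈ T) (hT1 : ∀ s ∈ T, w.n s ≠ 1)
    (h : ∑ s ∈ T, w.n s * w.pd s = 9) :
    ∃ t, T = {t} ∧ p.lt w g t = t ∧ w.n t = 3 ∧ w.pd t = 3 := by
  have hne : T.Nonempty := by
    rw [Finset.nonempty_iff_ne_empty]
    rintro rfl
    simp at h
  obtain ⟨t, ht⟩ := hne
  have hp := w.n_le_pd t
  rcases p.orbit_cases w h3 h1 hT hT1 ht with ⟨hf, hn, hcl, hs⟩ | ⟨hn, T', -, -, -, hs⟩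
  · rw [h] at hs
    have hnp := eq_three_of_mul_eq_nine hn hp (by omega)
    rw [hnp.1, hnp.2] at hs
    have he := p.eq_empty_of_sum_lt w h3 h1 hcl (fun s hs => hT1 s (Finset.mem_of_mem_erase hs))
      (by omega)
    refine ⟨t, ?_, hf, hnp⟩
    rw [Finset.erase_eq_empty_iff] at he
    exact he.resolve_left (Finset.ne_empty_of_mem ht)
  · rw [h] at hs
    have := Nat.mul_le_mul hn (hn.trans hp)
    omega

/-- The shape of a non-semisimple, non-basic algebra of dimension `27`. -/
theorem structure_of_finrank [IsAlgClosed k] (hdim : Module.finrank k A = 27)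
    (hε : ∀ Λ : A, IsLeftInt k Λ → counit (R := k) Λ = 0) (hne : Nat.card (GroupLike k B) ≠ 1) :
    (∀ t, w.n t = 1) ∨ (Nat.card (GroupLike k B) = 3 ∧ ∃ u v, u ≠ v ∧ big w = {u, v} ∧
      (w.n u = 3 ∧ w.pd u = 3 ∧ ∀ h, p.lt w h u = u) ∧
      (w.n v = 3 ∧ w.pd v = 3 ∧ ∀ h, p.lt w h v = v)) := by
  classical
  have hB : Module.finrank k B = 27 := p.finrank_eq ▸ hdim
  obtain ⟨g, h3, h1⟩ := exists_pow_three_eq_one (k := k) hB hne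
  have hc := p.c_ch_one_eq_zero w hdim hε h3 h1
  have hd := p.two_le_pd w hε
  have hsum := p.finrank_eq_add w
  rw [hdim] at hsum
  have hcl := p.lt_mem_big w g
  have hbig : ∀ s ∈ big w, w.n s ≠ 1 := fun s => (mem_big w).1
  rw [or_iff_not_imp_left]
  intro hnb
  push Not at hnb
  obtain ⟨t, ht⟩ := hnb
  have htb : t ∈ big w := (mem_big w).2 ht
  have h9 := p.nine_le w h3 h1 hcl hbig ⟨t, htb⟩
  have hg2 := sq_ne_one_of_pow_three h3 h1
  have h123 : ∀ t, p.lt w g t = t → ∀ h ∈ ({1, g, g * g} : Finset (GroupLike k B)),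
      p.lt w h t = t := by
    intro t ht h hh
    simp only [Finset.mem_insert, Finset.mem_singleton] at hh
    rcases hh with rfl | rfl | rfl
    · rw [lt_one]
    · exact ht
    · rw [lt_mul, ht, ht]
  have hcard : ({1, g, g * g} : Finset (GroupLike k B)).card = 3 :=
    Finset.card_eq_three.2 ⟨_, _, _, Ne.symm h1, Ne.symm hg2, fun e => h1 (by simpa using e), rfl⟩
  have hle : ∀ t, p.lt w g t = t → w.n t = 3 → w.pd t = 3 → w.pd (p.ch w 1) ≤ 3 := by
    intro t hf hn hp
    have := p.card_mul_pd_le w (hp.trans hn.symm) _ (h123 t hf)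
    rw [hn, hcard] at this
    omega
  obtain ⟨a, ha⟩ := card_groupLike_eq_pow (k := k) hB
  obtain ⟨d, hd'⟩ : ∃ d, w.pd (p.ch w 1) = d := ⟨_, rfl⟩
  obtain ⟨R, hR⟩ : ∃ R, ∑ s ∈ big w, w.n s * w.pd s = R := ⟨_, rfl⟩
  rw [hd'] at hd hsum hle
  rw [hR] at hsum h9
  have ha2 : a = 1 ∨ a = 2 := by
    rcases Nat.lt_or_ge a 3 with h | h
    · rcases a with _ | _ | _ | a
      · exact absurd ha (by simpa using hne)
      · exact Or.inl rfl
      · exact Or.inr rfl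
      · omega
    · exfalso
      have : 3 ^ 3 ≤ 3 ^ a := Nat.pow_le_pow_right (by norm_num) h
      rw [← ha] at this
      have := Nat.mul_le_mul this hd
      omega
  rcases ha2 with rfl | rfl
  swap
  · exfalso
    rw [ha] at hsum
    have hd2 : d = 2 := by omega
    have hR9 : R = 9 := by omega
    obtain ⟨u, hu, -, hn, hp⟩ := p.eq_singleton_of_sum_eq_nine w h3 h1 hcl hbig (hR.trans hR9)
    have := Fintype.ofFinite (GroupLike k B)
    have := p.card_mul_pd_le w (hp.trans hn.symm) Finset.univ (fun h _ => by
      have := p.lt_mem_big w h u (by simp [hu])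
      simpa [hu] using this)
    rw [Finset.card_univ, ← Nat.card_eq_fintype_card, ha, hd', hn, hd2] at this
    norm_num at this
  rw [pow_one] at ha
  rw [ha] at hsum
  refine ⟨ha, ?_⟩
  have hd3 := p.three_le_pd w hdim hε ha
  rw [hd'] at hd3
  have hfix : ∀ t, p.lt w g t = t → ∀ h, p.lt w h t = t := fun t ht h => by
    apply h123 t ht
    have := groupLike_cases ha h3 h1 h
    simpa using this
  have hsing : ∀ t, big w = {t} → w.pd t = w.n t * w.c t t := fun t ht => by
    rw [p.pd_eq_sum_big w hc (hbig t (by simp [ht])), ht, Finset.sum_singleton]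
  have hp := w.n_le_pd t
  obtain ⟨n, hn'⟩ : ∃ n, w.n t = n := ⟨_, rfl⟩
  obtain ⟨m, hm'⟩ : ∃ m, w.pd t = m := ⟨_, rfl⟩
  rcases p.orbit_cases w h3 h1 hcl hbig htb with ⟨hf, hn, hcl', hs⟩ | ⟨hn, T', hT', hcl', hor, hs⟩
  · have hT1 : ∀ s ∈ (big w).erase t, w.n s ≠ 1 := fun s hs => hbig s (Finset.mem_of_mem_erase hs)
    by_cases hrest : (big w).erase t = ∅
    · exfalso
      have hb : big w = {t} := ((Finset.erase_eq_empty_iff _ _).1 hrest).resolve_left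
        (Finset.ne_empty_of_mem htb)
      have hpt := hsing t hb
      rw [hrest, Finset.sum_empty, add_zero, hR] at hs
      have hle' := hle t hf
      rw [hn', hm'] at hs
      rw [hn', hm'] at hpt
      rw [hn', hm'] at hle' hp
      rw [hn'] at hn
      have hn4 : n ≤ 4 := by
        by_contra hlt
        have := Nat.mul_le_mul (show 5 ≤ n by omega) (show 5 ≤ m by omega)
        omega
      obtain ⟨c, hcc⟩ : ∃ c, w.c t t = c := ⟨_, rfl⟩
      rw [hcc] at hpt
      have hn34 : n = 3 ∨ n = 4 := by omega
      have hc2 : n = 3 ∧ m = 6 ∧ c = 2 ∧ d = 3 := by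
        rcases hn34 with rfl | rfl <;> omega
      exact p.false_of_pd_eq_six w ha h3 h1 hc (by omega) hf hb (by omega)
    · have h9' := p.nine_le w h3 h1 hcl' hT1 (Finset.nonempty_iff_ne_empty.2 hrest)
      obtain ⟨hn3, hm3⟩ := eq_three_of_mul_eq_nine hn hp (by omega)
      have := hle t hf hn3 hm3
      obtain ⟨v, hv, hvf, hvn, hvp⟩ := p.eq_singleton_of_sum_eq_nine w h3 h1 hcl' hT1
        (by rw [hn3, hm3] at hs; omega)
      refine ⟨t, v, ?_, ?_, ⟨hn3, hm3, hfix t hf⟩, ⟨hvn, hvp, hfix v hvf⟩⟩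
      · rintro rfl
        have : t ∈ (big w).erase t := by rw [hv]; simp
        simp at this
      · rw [← hv, Finset.insert_erase htb]
  · exfalso
    have h2m := hn.trans hp
    by_cases hrest : T' = ∅
    · rw [hrest, Finset.sum_empty, add_zero, hR] at hs
      have hallt : ∀ s ∈ big w, w.n s = w.n t := fun s hs => by
        have := hor s hs
        rw [hrest] at this
        simpa using this
      have hpt : w.pd t = w.n t * ∑ s ∈ big w, w.c s t := by
        rw [p.pd_eq_sum_big w hc ht, Finset.mul_sum]
        exact Finset.sum_congr rfl fun s hs => by rw [hallt s hs]
      obtain ⟨c, hcc⟩ : ∃ c, ∑ s ∈ big w, w.c s t = c := ⟨_, rfl⟩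
      have hone := fun e => p.card_mul_pd_le w (t := t) e {1} (by simp [lt_one])
      rw [hcc] at hpt
      rw [Finset.card_singleton, hd', one_mul] at hone
      rw [hn', hm'] at hs hpt hp hone
      rw [hn'] at hn
      have hn2 : n = 2 := by
        by_contra hlt
        have := Nat.mul_le_mul (show 3 ≤ n by omega) (show 3 ≤ m by omega)
        omega
      subst hn2
      by_cases hm2 : m = 2
      · have := hone hm2; omega
      · omega
    · have h9' := p.nine_le w h3 h1 hcl' (fun s hs => hbig s (hT' hs))
        (Finset.nonempty_iff_ne_empty.2 hrest)
      have := Nat.mul_le_mul hn h2m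
      omega

end HopfPairing
end CountingTwo
end HopfClass

namespace HopfClass

section Fusion
open WithConv Coalgebra HopfAlgebra
variable {k : Type*} [Field k] {A : Type*} [Ring A] [HopfAlgebra k A] [FiniteDimensional k A]
  {B : Type*} [Ring B] [HopfAlgebra k B] [FiniteDimensional k B]

namespace HopfPairing
variable (p : HopfPairing k A B) (w : MatrixData k A) [CharZero k]

/-- The numerical data of a non-basic algebra of dimension `27`. -/
structure TwoBig (u v : Fin w.r) : Prop where
  card : Nat.card (GroupLike k B) = 3
  ne : u ≠ v
  big_eq : big w = {u, v}
  n_left : w.n u = 3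
  pd_left : w.pd u = 3
  lt_left : ∀ h, p.lt w h u = u
  n_right : w.n v = 3
  pd_right : w.pd v = 3
  lt_right : ∀ h, p.lt w h v = v
  pd_one : w.pd (p.ch w 1) = 3
  c_zero : ∀ t, w.n t ≠ 1 → w.c t (p.ch w 1) = 0

namespace TwoBig
variable {p w} {u v : Fin w.r} (T : TwoBig p w u v)

lemma symm (T : TwoBig p w u v) : TwoBig p w v u :=
  ⟨T.card, T.ne.symm, by rw [T.big_eq, Finset.pair_comm], T.n_right, T.pd_right, T.lt_right,
    T.n_left, T.pd_left, T.lt_left, T.pd_one, T.c_zero⟩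

lemma n_ne_one_iff (T : TwoBig p w u v) (s : Fin w.r) : w.n s ≠ 1 ↔ s = u ∨ s = v := by
  rw [← mem_big w, T.big_eq]; simp

lemma ch_ne (T : TwoBig p w u v) (h : GroupLike k B) : p.ch w h ≠ u := fun e =>
  (T.n_ne_one_iff u).2 (Or.inl rfl) (by rw [← e, n_ch])

lemma c_left (T : TwoBig p w u v) (s : Fin w.r) : w.c s u = if s = u then 1 else 0 :=
  w.c_of_pd_eq (T.pd_left.trans T.n_left.symm) s

lemma st_cases (T : TwoBig p w u v) : p.st w u = u ∨ p.st w u = v := by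
  rw [← T.n_ne_one_iff, n_st, T.n_left]
  norm_num

lemma c_right (T : TwoBig p w u v) (s : Fin w.r) : w.c u s = if s = u then 1 else 0 := by
  rw [← p.c_st w]
  have : w.c (p.st w s) (p.st w u) = if p.st w s = p.st w u then 1 else 0 := by
    rcases T.st_cases with h | h <;> rw [h]
    · exact T.c_left _
    · exact T.symm.c_left _
  rw [this]
  simp

lemma sum_eq (T : TwoBig p w u v) [Fintype (GroupLike k B)] {M : Type*} [AddCommMonoid M]
    (f : Fin w.r → M) : ∑ t, f t = ∑ h : GroupLike k B, f (p.ch w h) + (f u + f v) := by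
  classical
  rw [← Finset.sum_filter_add_sum_filter_not Finset.univ (fun s => w.n s = 1)]
  congr 1
  · refine (Finset.sum_bij (fun g _ => p.ch w g) ?_ ?_ ?_ ?_).symm
    · intro g _; simp
    · intro g _ h _ e; exact p.ch_injective w e
    · intro t ht
      obtain ⟨g, hg⟩ := p.exists_ch_eq w (Finset.mem_filter.1 ht).2
      exact ⟨g, Finset.mem_univ _, hg⟩
    · intro g _; rfl
  · rw [← Finset.sum_pair T.ne, ← T.big_eq]
    rfl

lemma row_sum (T : TwoBig p w u v) (h : GroupLike k B) : ∑ s, w.n s * w.c (p.ch w h) s = 3 := by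
  rw [← T.pd_one, ← p.pd_ch w h⁻¹, MatrixData.pd, ← Equiv.sum_comp (p.st w)]
  refine Finset.sum_congr rfl fun s _ => ?_
  rw [n_st, ← p.c_st w s (p.ch w h⁻¹), st_ch, inv_inv]

lemma P_e_X (s t : Fin w.r) : p.P (w.e s) (p.X w t) = if t = s then 1 else 0 := by
  rw [P_X, w.χ_e_eq]

lemma P_one_X (t : Fin w.r) : p.P 1 (p.X w t) = w.n t := by
  rw [P_X, w.χ_one]

lemma groupLike_mul_X (T : TwoBig p w u v) (h : GroupLike k B) : h.val * p.X w u = p.X w u := by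
  rw [← X_lt, T.lt_left]

lemma mul_X_eq (T : TwoBig p w u v) (y : Fin w.r) : p.X w u * p.X w y =
    ∑ t, ∑ s, ((w.c t s : k) * p.P (w.e u) (p.X w s * p.X w (p.st w y))) • p.X w t := by
  rw [X_st, ← tensor_identity (w := w) (w.e u) (p.isRep_X w y)]
  congr 1
  rw [Finset.sum_eq_single u]
  · rw [Finset.sum_eq_single u]
    · rw [T.c_left, if_pos rfl, w.χ_e]; simp
    · intro s _ hs
      rw [w.χ_e_eq, if_neg hs]; simp
    · simp
  · intro t _ ht
    refine Finset.sum_eq_zero fun s _ => ?_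
    by_cases hs : s = u
    · rw [hs, T.c_left, if_neg ht]; simp
    · rw [w.χ_e_eq, if_neg hs]; simp
  · simp

lemma P_e_ch_mul (T : TwoBig p w u v) {y : Fin w.r} (hy : y = u ∨ y = v) (h : GroupLike k B) :
    p.P (w.e (p.ch w h)) (p.X w u * p.X w y) = if p.st w y = u then 3 else 0 := by
  have hsty : p.st w y = u ∨ p.st w y = v := by
    rw [← T.n_ne_one_iff, n_st]
    exact (T.n_ne_one_iff y).2 hy
  rw [T.mul_X_eq, map_sum, Finset.sum_eq_single (p.ch w h)]
  · rw [map_sum]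
    have h3 : ((∑ s, w.n s * w.c (p.ch w h) s : ℕ) : k) = 3 := by rw [T.row_sum]; norm_num
    have : (if p.st w y = u then (3 : k) else 0) =
        ∑ s, ((w.n s * w.c (p.ch w h) s : ℕ) : k) * if p.st w y = u then 1 else 0 := by
      rw [← Finset.sum_mul, ← Nat.cast_sum, h3]; simp
    rw [this]
    refine Finset.sum_congr rfl fun s _ => ?_
    rw [map_smul, P_e_X, if_pos rfl, smul_eq_mul, mul_one]
    by_cases hs : w.n s = 1
    · obtain ⟨g, rfl⟩ := p.exists_ch_eq w hs
      have hg : g.val * p.X w (p.st w y) = p.X w (p.st w y) := by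
        rcases hsty with e | e <;> rw [e]
        · exact T.groupLike_mul_X g
        · exact T.symm.groupLike_mul_X g
      rw [X_ch, hg, P_e_X, n_ch, one_mul]
    · rw [p.c_ch_big_eq_zero w T.c_zero h hs]; simp
  · intro t _ ht
    rw [map_sum]
    refine Finset.sum_eq_zero fun s _ => ?_
    rw [map_smul, P_e_X, if_neg ht, smul_zero]
  · simp

lemma exists_mul_eq (T : TwoBig p w u v) [Fintype (GroupLike k B)] {y : Fin w.r}
    (hy : y = u ∨ y = v) : ∃ c a b : ℕ, c + a + b = 3 ∧ c = (if p.st w y = u then 3 else 0) ∧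
      p.X w u * p.X w y = (c : k) • ∑ h : GroupLike k B, h.val +
        ((a : k) • p.X w u + (b : k) • p.X w v) := by
  obtain ⟨N, h1, h2⟩ := IsRep.exists_eq_sum (w := w) ((p.isRep_X w u).mul (p.isRep_X w y))
  have hny : w.n y = 3 := by
    rcases hy with rfl | rfl
    exacts [T.n_left, T.n_right]
  have hNh : ∀ h, N (p.ch w h) = if p.st w y = u then 3 else 0 := by
    intro h
    have := T.P_e_ch_mul hy h
    rw [h1] at this
    split_ifs at this ⊢ <;> exact_mod_cast this
  rw [T.sum_eq] at h2
  simp only [hNh, X_ch] at h2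
  refine ⟨_, N u, N v, ?_, rfl, by rw [h2, Finset.smul_sum]⟩
  have hdim := congrArg (p.P 1) h2
  simp only [map_add, map_sum, map_smul, p.one_left, Bialgebra.counit_mul] at hdim
  simp only [← p.one_left, P_one_X, smul_eq_mul, T.n_left, T.n_right, hny] at hdim
  simp only [p.one_left, (GroupLike.isGroupLikeElem_val _).counit_eq_one, Finset.sum_const,
    Finset.card_univ, ← Nat.card_eq_fintype_card, T.card] at hdim
  have : 3 * 3 = 3 * ((if p.st w y = u then 3 else 0) * 1) + (N u * 3 + N v * 3) := by
    rw [← Nat.cast_inj (R := k)]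
    push_cast
    rw [nsmul_eq_mul] at hdim
    exact_mod_cast hdim
  omega

variable [Fintype (GroupLike k B)]

lemma sum_mul_X (T : TwoBig p w u v) :
    (∑ h : GroupLike k B, h.val) * p.X w u = (3 : k) • p.X w u := by
  rw [Finset.sum_mul, Finset.sum_congr rfl fun h _ => T.groupLike_mul_X h, Finset.sum_const,
    Finset.card_univ, ← Nat.card_eq_fintype_card, T.card, ← Nat.cast_smul_eq_nsmul k]
  norm_num

lemma P_e_one_sum : p.P (w.e (p.ch w 1)) (∑ h : GroupLike k B, h.val) = 1 := by
  classical
  rw [map_sum, Finset.sum_eq_single 1]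
  · exact p.P_e_self w 1
  · intro h _ hh
    exact p.P_e_ne w hh
  · simp

lemma P_e_one_X (T : TwoBig p w u v) : p.P (w.e (p.ch w 1)) (p.X w u) = 0 := by
  rw [P_e_X, if_neg (T.ch_ne 1).symm]

lemma st_eq (T : TwoBig p w u v) : p.st w u = v := by
  refine T.st_cases.resolve_left fun hu => ?_
  have hv : p.st w v = v := T.symm.st_cases.resolve_right fun h =>
    T.ne ((p.st w).injective (hu.trans h.symm))
  obtain ⟨c, a, b, h1, h2, h3⟩ := T.exists_mul_eq (Or.inl rfl)
  rw [if_pos hu] at h2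
  obtain ⟨rfl, rfl, rfl⟩ : c = 3 ∧ a = 0 ∧ b = 0 := by omega
  obtain ⟨c, a, b, h1', h2', h3'⟩ := T.symm.exists_mul_eq (Or.inl rfl)
  rw [if_pos hv] at h2'
  obtain ⟨rfl, rfl, rfl⟩ : c = 3 ∧ a = 0 ∧ b = 0 := by omega
  obtain ⟨c, a, b, h1'', h2'', h4⟩ := T.exists_mul_eq (Or.inr rfl)
  rw [if_neg (by rw [hv]; exact T.ne.symm)] at h2''
  subst h2''
  have hW : p.P (w.e (p.ch w 1)) (∑ h : GroupLike k B, h.val) = 1 := P_e_one_sum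
  have hXu := T.P_e_one_X
  have hXv := T.symm.P_e_one_X
  have hu' := T.sum_mul_X
  have hv' := T.symm.sum_mul_X
  generalize (∑ h : GroupLike k B, h.val) = W at *
  generalize p.P (w.e (p.ch w 1)) = φ at *
  generalize p.X w u = x at *
  generalize p.X w v = y at *
  simp only [Nat.cast_zero, zero_smul, add_zero, zero_add] at h3 h3' h4
  have e1 : x * (x * y) = ((3 : ℕ) : k) • ((3 : k) • y) := by
    rw [← mul_assoc, h3, smul_mul_assoc, hv']
  have h5 := congrArg φ e1
  rw [h4, mul_add, mul_smul_comm, mul_smul_comm, h3, h4] at h5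
  simp only [map_add, map_smul, hW, hXu, hXv, smul_eq_mul, mul_zero, mul_one, add_zero] at h5
  have ha : a = 0 := by
    have : a * 3 = 0 := by exact_mod_cast h5
    omega
  obtain rfl : b = 3 := by omega
  rw [ha, Nat.cast_zero, zero_smul, zero_add] at h4
  have h30 : ((3 : ℕ) : k) ≠ 0 := by norm_num
  have e2 : x * W = (3 : k) • x := by
    apply smul_right_injective B h30
    simp only
    rw [← mul_smul_comm, ← h3, ← mul_assoc, h3, smul_mul_assoc, hu']
  have e3 : (x * y) * y = x * (y * y) := mul_assoc _ _ _
  rw [h4, h3', smul_mul_assoc, mul_smul_comm, h3', e2] at e3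
  have h6 := congrArg φ e3
  simp [hW, hXu] at h6

lemma X_mul_X_right (T : TwoBig p w u v) :
    p.X w u * p.X w v = (3 : k) • ∑ h : GroupLike k B, h.val := by
  obtain ⟨c, a, b, h1, h2, h3⟩ := T.exists_mul_eq (Or.inr rfl)
  rw [if_pos T.symm.st_eq] at h2
  obtain ⟨rfl, rfl, rfl⟩ : c = 3 ∧ a = 0 ∧ b = 0 := by omega
  simpa using h3

lemma X_mul_X_left (T : TwoBig p w u v) : p.X w u * p.X w u = (3 : k) • p.X w v := by
  obtain ⟨c, a, b, h1, h2, h3⟩ := T.exists_mul_eq (Or.inl rfl)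
  rw [if_neg (by rw [T.st_eq]; exact T.ne.symm)] at h2
  subst h2
  obtain ⟨c, a', b', h1', h2', h3'⟩ := T.symm.exists_mul_eq (Or.inl rfl)
  rw [if_neg (by rw [T.symm.st_eq]; exact T.ne)] at h2'
  subst h2'
  have hW : p.P (w.e (p.ch w 1)) (∑ h : GroupLike k B, h.val) = 1 := P_e_one_sum
  have hXu := T.P_e_one_X
  have hXv := T.symm.P_e_one_X
  have hu' := T.sum_mul_X
  have hvu := T.symm.X_mul_X_right
  generalize (∑ h : GroupLike k B, h.val) = W at *
  generalize p.P (w.e (p.ch w 1)) = φ at *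
  generalize p.X w u = x at *
  generalize p.X w v = y at *
  simp only [Nat.cast_zero, zero_smul, zero_add] at h3 h3'
  have e1 : y * (x * x) = (3 : k) • ((3 : k) • x) := by
    rw [← mul_assoc, hvu, smul_mul_assoc, hu']
  have h5 := congrArg φ e1
  rw [h3, mul_add, mul_smul_comm, mul_smul_comm, hvu, h3'] at h5
  simp only [map_add, map_smul, hW, hXu, hXv, smul_eq_mul, mul_zero, mul_one, add_zero] at h5
  have ha : a = 0 := by
    have : a * 3 = 0 := by exact_mod_cast h5
    omega
  obtain rfl : b = 3 := by omega
  rw [h3, ha]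
  simp

lemma X_mul_sum (T : TwoBig p w u v) :
    p.X w u * (∑ h : GroupLike k B, h.val) = (3 : k) • p.X w u := by
  have h30 : (3 : k) ≠ 0 := by norm_num
  apply smul_right_injective B h30
  simp only
  rw [← mul_smul_comm, ← T.X_mul_X_right, ← mul_assoc, T.X_mul_X_left, smul_mul_assoc,
    T.symm.X_mul_X_left]

end TwoBig
end HopfPairing
end Fusion
end HopfClass

namespace HopfClass

section Center
variable {k : Type*} [Field k] {A : Type*} [Ring A] [Algebra k A] [FiniteDimensional k A] [CharZero k]

lemma eq_zero_of_biTrace_eq_zero {e f : A} (he : e * e = e) (hf : f * f = f)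
    (h : biTrace k e f = 0) (a : A) : e * a * f = 0 := by
  have hi : IsIdempotentElem (LinearMap.mulLeft k e ∘ₗ LinearMap.mulRight k f) :=
    LinearMap.ext fun x => by
      simp only [Module.End.mul_apply, LinearMap.comp_apply, LinearMap.mulLeft_apply,
        LinearMap.mulRight_apply]
      rw [mul_assoc, mul_assoc, hf, ← mul_assoc e e, he, ← mul_assoc]
  have := LinearMap.congr_fun (LinearMap.IsIdempotentElem.eq_zero_of_trace_eq_zero hi h) a
  simpa [mul_assoc] using this

lemma eq_zero_of_trace_mulLeft_eq_zero {A : Type*} [Ring A] [Algebra k A] [FiniteDimensional k A]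
    {e : A} (he : e * e = e)
    (h : LinearMap.trace k A (LinearMap.mulLeft k e) = 0) : e = 0 := by
  have hi : IsIdempotentElem (LinearMap.mulLeft k e) :=
    LinearMap.ext fun x => by simp [← mul_assoc, he]
  simpa using LinearMap.congr_fun (LinearMap.IsIdempotentElem.eq_zero_of_trace_eq_zero hi h) 1

lemma MatrixData.exists_central_idempotent (w : MatrixData k A) {u : Fin w.r}
    (hL : ∀ s, w.c s u = if s = u then 1 else 0) (hR : ∀ s, w.c u s = if s = u then 1 else 0) :
    ∃ E : A, E * E = E ∧ (∀ a, E * a = a * E) ∧ w.π u E = 1 ∧ ∀ t, t ≠ u → w.π t E = 0 := by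
  classical
  let F : A →ₐ[k] (∀ t, Matrix (Fin (w.n t)) (Fin (w.n t)) k) := AlgHom.pi w.π
  obtain ⟨a, ha⟩ := w.surj (Pi.single u 1)
  obtain ⟨E, hE, hFE⟩ := exists_isIdempotentElem_eq_of_ker_isNilpotent F.toRingHom
    (fun x hx => w.isNilpotent_of_π fun t => congrFun (show F x = 0 from hx) t)
    (Pi.single u 1) ⟨a, funext ha⟩
    (by unfold IsIdempotentElem; rw [← Pi.single_mul, one_mul])
  have hπ : ∀ t, w.π t E = (Pi.single u 1 : ∀ t, Matrix (Fin (w.n t)) (Fin (w.n t)) k) t :=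
    fun t => congrFun hFE t
  have h1 : w.π u E = 1 := by rw [hπ, Pi.single_eq_same]
  have h2 : ∀ t, t ≠ u → w.π t E = 0 := fun t ht => by rw [hπ, Pi.single_eq_of_ne ht]
  have hE' : E * E = E := hE
  have hχ : ∀ t, w.χ t E = if t = u then (w.n u : k) else 0 := by
    intro t
    rw [w.χ_apply]
    split_ifs with h
    · subst h; rw [h1, Matrix.trace_one, Fintype.card_fin]
    · rw [h2 t h, Matrix.trace_zero]
  have hc : (1 - E) * (1 - E) = 1 - E := by rw [mul_sub, sub_mul, sub_mul, hE']; simp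
  have b1 : biTrace k E (1 - E) = 0 := by
    rw [w.biTrace_eq]
    refine Finset.sum_eq_zero fun t _ => Finset.sum_eq_zero fun s _ => ?_
    rw [hχ t, map_sub, hχ s, w.χ_one]
    by_cases ht : t = u
    · subst ht
      rw [hR]
      by_cases hs : s = t
      · simp [hs]
      · simp [hs]
    · simp [ht]
  have b2 : biTrace k (1 - E) E = 0 := by
    rw [w.biTrace_eq]
    refine Finset.sum_eq_zero fun t _ => Finset.sum_eq_zero fun s _ => ?_
    rw [hχ s, map_sub, hχ t, w.χ_one]
    by_cases ht : s = u
    · subst ht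
      rw [hL]
      by_cases hs : t = s
      · simp [hs]
      · simp [hs]
    · simp [ht]
  refine ⟨E, hE', fun a => ?_, h1, h2⟩
  have c1 := eq_zero_of_biTrace_eq_zero hE' hc b1 a
  have c2 := eq_zero_of_biTrace_eq_zero hc hE' b2 a
  rw [mul_sub, mul_one, sub_eq_zero] at c1
  rw [sub_mul, sub_mul, one_mul, sub_eq_zero] at c2
  rw [c1, c2]

end Center

section Grading
open WithConv Coalgebra HopfAlgebra
variable {k : Type*} [Field k] [CharZero k] {A : Type*} [Ring A] [HopfAlgebra k A]
  [FiniteDimensional k A] {B : Type*} [Ring B] [HopfAlgebra k B] [FiniteDimensional k B]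

lemma trace_mulLeft_mul_tmul {e f : A} (he : ∀ a, e * a = a * e) (hf : ∀ a, f * a = a * f)
    (y : A ⊗[k] A) :
    LinearMap.trace k (A ⊗[k] A) (LinearMap.mulLeft k (y * (e ⊗ₜ[k] f))) =
      tmulFun (biTraceL e) (biTraceL f) y := by
  induction y with
  | zero => simp
  | add x y hx hy =>
    rw [add_mul, map_add, ← hx, ← hy, ← map_add]
    congr 1
    exact LinearMap.ext fun z => by simp [add_mul, mul_assoc]
  | tmul x y =>
    rw [tmulFun_tmul, biTraceL_apply, biTraceL_apply, Algebra.TensorProduct.tmul_mul_tmul]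
    have : LinearMap.mulLeft k ((x * e) ⊗ₜ[k] (y * f)) =
        TensorProduct.map (LinearMap.mulLeft k x ∘ₗ LinearMap.mulRight k e)
          (LinearMap.mulLeft k y ∘ₗ LinearMap.mulRight k f) := by
      ext a b
      simp [mul_assoc, he, hf]
    rw [this, LinearMap.trace_tensorProduct']
    rfl

variable (p : HopfPairing k A B) {E : Fin 3 → A} {ψ : Fin 3 → B}

lemma HopfPairing.comul_central_idempotent (hE : ∀ i, E i * E i = E i) (hne : ∀ i j, i ≠ j → E i * E j = 0)
    (hcen : ∀ i a, E i * a = a * E i) (hsum : ∑ i, E i = 1)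
    (hψ : ∀ i a, p.P a (ψ i) = biTrace k a (E i))
    (hmul : ∀ i j, ψ i * ψ j = (9 : k) • ψ (i + j)) (l : Fin 3) :
    comul (R := k) (E l) = ∑ i, E i ⊗ₜ[k] E (l - i) := by
  have hcen2 : ∀ i j (y : A ⊗[k] A), (E i ⊗ₜ[k] E j) * y = y * (E i ⊗ₜ[k] E j) := by
    intro i j y
    induction y with
    | zero => simp
    | add x y hx hy => rw [mul_add, add_mul, hx, hy]
    | tmul x y => simp [hcen]
  have hzero : ∀ l i j, l ≠ i + j → comul (R := k) (E l) * (E i ⊗ₜ[k] E j) = 0 := by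
    intro l i j hl
    apply eq_zero_of_trace_mulLeft_eq_zero (k := k)
    · rw [mul_assoc, hcen2, ← mul_assoc, ← mul_assoc, ← Bialgebra.comul_mul, hE, mul_assoc,
        Algebra.TensorProduct.tmul_mul_tmul, hE, hE]
    · rw [trace_mulLeft_mul_tmul (hcen i) (hcen j)]
      have h1 : p.P.flip (ψ i) = biTraceL (E i) := LinearMap.ext fun a => hψ i a
      have h2 : p.P.flip (ψ j) = biTraceL (E j) := LinearMap.ext fun a => hψ j a
      rw [← h1, ← h2, ← p.mul_right, hmul, map_smul, hψ]
      have : LinearMap.mulLeft k (E l) ∘ₗ LinearMap.mulRight k (E (i + j)) = 0 :=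
        LinearMap.ext fun x => by
          rw [LinearMap.comp_apply, LinearMap.mulLeft_apply, LinearMap.mulRight_apply, ← hcen,
            ← mul_assoc, hne _ _ hl, zero_mul, LinearMap.zero_apply]
      rw [biTrace, this, map_zero, smul_zero]
  have hone : ∑ i, ∑ j, E i ⊗ₜ[k] E j = 1 := by
    simp only [← tmul_sum, ← sum_tmul, hsum]
    rfl
  have hself : ∀ i j, comul (R := k) (E (i + j)) * (E i ⊗ₜ[k] E j) = E i ⊗ₜ[k] E j := by
    intro i j
    conv_rhs => rw [← one_mul (E i ⊗ₜ[k] E j), ← Bialgebra.comul_one (R := k), ← hsum, map_sum,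
      Finset.sum_mul, Finset.sum_eq_single (i + j) (fun l _ hl => hzero l i j hl) (by simp)]
  calc comul (R := k) (E l) = comul (R := k) (E l) * ∑ i, ∑ j, E i ⊗ₜ[k] E j := by rw [hone, mul_one]
    _ = ∑ i, E i ⊗ₜ[k] E (l - i) := by
      simp only [Finset.mul_sum]
      refine Finset.sum_congr rfl fun i _ => ?_
      rw [Finset.sum_eq_single (l - i) (fun j _ hj => hzero l i j fun h => hj (by rw [h]; abel))
        (by simp)]
      conv_rhs => rw [← hself]
      rw [add_sub_cancel]

lemma isGroupLikeElem_sum (hE : ∀ i, E i * E i = E i) (hne : ∀ i j, i ≠ j → E i * E j = 0)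
    (hsum : ∑ i, E i = 1)
    (hΔ : ∀ l, comul (R := k) (E l) = ∑ i, E i ⊗ₜ[k] E (l - i)) {c : Fin 3 → k} (hc0 : c 0 = 1)
    (hc : ∀ i j, c (i + j) = c i * c j) : IsGroupLikeElem k (∑ i, c i • E i) := by
  have hΔz : comul (R := k) (∑ i, c i • E i) = (∑ i, c i • E i) ⊗ₜ[k] (∑ i, c i • E i) := by
    simp only [map_sum, map_smul, hΔ, sum_tmul, tmul_sum, Finset.smul_sum]
    rw [Finset.sum_comm]
    conv_rhs => rw [Finset.sum_comm]
    refine Finset.sum_congr rfl fun i _ => ?_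
    rw [← Equiv.sum_comp (Equiv.addLeft i)]
    refine Finset.sum_congr rfl fun j _ => ?_
    simp [hc, ← smul_tmul', smul_smul, mul_comm]
  have hunit : (∑ i, c (-i) • E i) * (∑ i, c i • E i) = 1 := by
    rw [Finset.sum_mul, ← hsum]
    refine Finset.sum_congr rfl fun i _ => ?_
    rw [Finset.mul_sum, Finset.sum_eq_single i (fun j _ hj => by
      rw [smul_mul_smul_comm, hne i j hj.symm, smul_zero]) (by simp), smul_mul_smul_comm, hE, ← hc,
      neg_add_cancel, hc0, one_smul]
  refine ⟨?_, hΔz⟩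
  generalize (∑ i, c i • E i) = z at *
  have h := Coalgebra.rTensor_counit_comul (R := k) z
  rw [hΔz, LinearMap.rTensor_tmul] at h
  have h2 := congrArg (TensorProduct.lid k A) h
  rw [lid_tmul, lid_tmul, one_smul] at h2
  have h3 := congrArg (fun y => counit (R := k) ((∑ i, c (-i) • E i) * y)) h2
  simp only [mul_smul_comm, hunit, map_smul, Bialgebra.counit_one, smul_eq_mul, mul_one] at h3
  exact h3

end Grading

section Twist
open WithConv Coalgebra HopfAlgebra
variable {k : Type*} [Field k] [CharZero k] {A : Type*} [Ring A] [HopfAlgebra k A]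
  [FiniteDimensional k A] {B : Type*} [Ring B] [HopfAlgebra k B] [FiniteDimensional k B]

namespace HopfPairing
namespace TwoBig
variable {p : HopfPairing k A B} {w : MatrixData k A} {u v : Fin w.r}

lemma biTrace_right_eq (T : TwoBig p w u v) {E : A} (h1 : w.π u E = 1) (h2 : ∀ t, t ≠ u → w.π t E = 0)
    (a : A) : biTrace k a E = p.P a ((3 : k) • p.X w u) := by
  rw [w.biTrace_right, Finset.sum_eq_single u (fun s _ hs => by
    rw [w.χ_apply, h2 s hs, Matrix.trace_zero, mul_zero]) (by simp), w.χ_apply, h1,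
    Matrix.trace_one, Fintype.card_fin, T.n_left, w.biTrace_left, Finset.sum_eq_single u
    (fun t _ ht => by rw [w.biTrace_e, T.c_left, if_neg ht]; simp) (by simp), w.biTrace_e, T.c_left,
    if_pos rfl, map_smul, P_X]
  simp [mul_comm]

lemma biTrace_one_eq (T : TwoBig p w u v) [Fintype (GroupLike k B)] (a : A) : biTrace k a 1 =
    p.P a ((3 : k) • ((∑ h : GroupLike k B, h.val) + p.X w u + p.X w v)) := by
  have key : ∀ t, biTrace k (w.e t) 1 = 3 := by
    intro t
    rw [w.biTrace_right]
    have : ∑ s, w.n s * w.c t s = 3 := by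
      by_cases ht : w.n t = 1
      · obtain ⟨g, rfl⟩ := p.exists_ch_eq w ht
        exact T.row_sum g
      · rcases (T.n_ne_one_iff t).1 ht with rfl | rfl
        · simp [T.c_right, T.n_left]
        · simp [T.symm.c_right, T.n_right]
    simp only [w.biTrace_e, w.χ_one]
    rw [← Nat.cast_ofNat (R := k) (n := 3), ← this]
    push_cast
    exact Finset.sum_congr rfl fun s _ => mul_comm _ _
  rw [w.biTrace_left]
  simp only [key]
  rw [← Finset.mul_sum, T.sum_eq, map_smul, map_add, map_add, map_sum, P_X, P_X, smul_eq_mul,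
    add_assoc]
  simp only [P_groupLike p w]

/-- The algebra has a central grouplike element of order `3`. -/
theorem exists_central_groupLike (T : TwoBig p w u v) {ω : k} (hω : IsPrimitiveRoot ω 3) :
    ∃ z E : A, IsGroupLikeElem k z ∧ (∀ a, z * a = a * z) ∧ z ^ 3 = 1 ∧ z ≠ 1 ∧
      (3 : k) • E = 1 + z + z * z ∧ E * E = E ∧
      LinearMap.trace k A (LinearMap.mulLeft k E) = 9 ∧ ∀ g : GroupLike k B, p.P z g.val = 1 := by
  classical
  have : Fintype (GroupLike k B) := have := finite_groupLike (k := k) (B := B); Fintype.ofFinite _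
  obtain ⟨Eu, hu1, hu2, hu3, hu4⟩ := w.exists_central_idempotent T.c_left T.c_right
  obtain ⟨Ev, hv1, hv2, hv3, hv4⟩ := w.exists_central_idempotent T.symm.c_left T.symm.c_right
  have huv : Eu * Ev = 0 := by
    have hid : (Eu * Ev) * (Eu * Ev) = Eu * Ev := by
      rw [mul_assoc, ← mul_assoc Ev, ← hu2, mul_assoc Eu Ev Ev, hv1, ← mul_assoc, hu1]
    have hnil : IsNilpotent (Eu * Ev) := w.isNilpotent_of_π fun t => by
      rw [map_mul]
      by_cases ht : t = u
      · subst ht; rw [hv4 t T.ne, mul_zero]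
      · rw [hu4 t ht, zero_mul]
    obtain ⟨m, hm⟩ := hnil
    have : IsIdempotentElem (Eu * Ev) := hid
    rcases Nat.eq_zero_or_pos m with rfl | hm'
    · rw [pow_zero] at hm
      rw [← mul_one (Eu * Ev), hm, mul_zero]
    · obtain ⟨m, rfl⟩ := Nat.exists_eq_succ_of_ne_zero hm'.ne'
      rwa [this.pow_succ_eq] at hm
  have hvu : Ev * Eu = 0 := by rw [← hu2, huv]
  let E : Fin 3 → A := ![1 - Eu - Ev, Eu, Ev]
  let W : B := ∑ h : GroupLike k B, h.val
  let ψ : Fin 3 → B := ![(3 : k) • W, (3 : k) • p.X w u, (3 : k) • p.X w v]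
  have hE : ∀ i, E i * E i = E i := by
    intro i
    fin_cases i
    · simp [E, mul_sub, sub_mul, hu1, hv1, huv, hvu]
    · exact hu1
    · exact hv1
  have hne : ∀ i j, i ≠ j → E i * E j = 0 := by
    intro i j hij
    fin_cases i <;> fin_cases j <;> first | exact absurd rfl hij | skip
    all_goals simp [E, mul_sub, sub_mul, hu1, hv1, huv, hvu]
  have hcen : ∀ i a, E i * a = a * E i := by
    intro i a
    fin_cases i
    · simp [E, mul_sub, sub_mul, hu2, hv2]
    · exact hu2 a
    · exact hv2 a
  have hsum : ∑ i, E i = 1 := by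
    simp only [E, Fin.sum_univ_three, Matrix.cons_val]
    abel
  have hψ : ∀ i a, p.P a (ψ i) = biTrace k a (E i) := by
    intro i a
    have e1 := T.biTrace_right_eq hu3 hu4 a
    have e2 := T.symm.biTrace_right_eq hv3 hv4 a
    fin_cases i
    · have e3 := T.biTrace_one_eq a
      change p.P a ((3 : k) • W) = biTrace k a (1 - Eu - Ev)
      rw [← biTraceR_apply, map_sub, map_sub, biTraceR_apply, biTraceR_apply, biTraceR_apply,
        e1, e2, e3, ← map_sub, ← map_sub]
      congr 1
      simp only [W, smul_add]
      abel
    · exact e1.symm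
    · exact e2.symm
  have hWW : W * W = (3 : k) • W := by
    have : ∀ h : GroupLike k B, h.val * W = W := by
      intro h
      simp only [W, Finset.mul_sum, ← GroupLike.val_mul]
      exact Equiv.sum_comp (Equiv.mulLeft h) fun g => g.val
    conv_lhs => rw [show W = ∑ h : GroupLike k B, h.val from rfl, Finset.sum_mul]
    rw [Finset.sum_congr rfl fun h _ => this h, Finset.sum_const, Finset.card_univ,
      ← Nat.card_eq_fintype_card, T.card, ← Nat.cast_smul_eq_nsmul k]
    norm_num
  have hmul : ∀ i j, ψ i * ψ j = (9 : k) • ψ (i + j) := by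
    have s1 := T.sum_mul_X
    have s2 := T.symm.sum_mul_X
    have s3 := T.X_mul_sum
    have s4 := T.symm.X_mul_sum
    have s5 := T.X_mul_X_left
    have s6 := T.symm.X_mul_X_left
    have s7 := T.X_mul_X_right
    have s8 := T.symm.X_mul_X_right
    intro i j
    fin_cases i <;> fin_cases j <;>
      simp [ψ, smul_smul, hWW, s1, s2, s3, s4, s5, s6, s7, s8, W] <;> norm_num
  have hΔ := p.comul_central_idempotent hE hne hcen hsum hψ hmul
  let c : Fin 3 → k := ![1, ω, ω ^ 2]
  have hω3 : ω ^ 3 = 1 := hω.pow_eq_one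
  have hc : ∀ i j, c (i + j) = c i * c j := by
    intro i j
    fin_cases i <;> fin_cases j <;> simp [c] <;>
      first | ring1 | linear_combination -hω3 | linear_combination -ω * hω3
  have hz := isGroupLikeElem_sum hE hne hsum hΔ (c := c) rfl hc
  have hzE : ∑ i, c i • E i = (1 - Eu - Ev) + ω • Eu + ω ^ 2 • Ev := by
    simp [c, E, Fin.sum_univ_three]
  rw [hzE] at hz
  have h0 : (1 - Eu - Ev) * (1 - Eu - Ev) = 1 - Eu - Ev := hE 0
  have h0u : (1 - Eu - Ev) * Eu = 0 := hne 0 1 (by decide)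
  have h0v : (1 - Eu - Ev) * Ev = 0 := hne 0 2 (by decide)
  have hu0 : Eu * (1 - Eu - Ev) = 0 := hne 1 0 (by decide)
  have hv0 : Ev * (1 - Eu - Ev) = 0 := hne 2 0 (by decide)
  have h0c : ∀ a, (1 - Eu - Ev) * a = a * (1 - Eu - Ev) := hcen 0
  have hω4 : ω ^ 2 * ω ^ 2 = ω := by linear_combination ω * hω3
  have hmulz : ∀ a b a' b' : k, ((1 - Eu - Ev) + a • Eu + b • Ev) * ((1 - Eu - Ev) + a' • Eu + b' • Ev) =
      (1 - Eu - Ev) + (a * a') • Eu + (b * b') • Ev := by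
    intro a b a' b'
    generalize 1 - Eu - Ev = E0 at *
    simp only [mul_add, add_mul, mul_smul_comm, smul_mul_assoc, h0, h0u, h0v, hu0, hv0, hu1, hv1, huv,
      hvu, smul_zero, add_zero, zero_add, smul_smul]
    rw [mul_comm a a', mul_comm b b']
  have hzz := hmulz ω (ω ^ 2) ω (ω ^ 2)
  have hω1 : 1 + ω + ω ^ 2 = 0 := by
    have h := hω.geom_sum_eq_zero (by norm_num)
    simpa [Finset.sum_range_succ] using h
  refine ⟨_, 1 - Eu - Ev, hz, fun a => ?_, ?_, fun h => ?_, ?_, h0, ?_, fun g => ?_⟩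
  · rw [add_mul, add_mul, mul_add, mul_add, smul_mul_assoc, smul_mul_assoc, mul_smul_comm,
      mul_smul_comm, h0c, hu2, hv2]
  · rw [pow_succ, pow_two, hzz, hmulz, show ω * ω * ω = 1 by rw [← hω3]; ring,
      show ω ^ 2 * ω ^ 2 * ω ^ 2 = 1 by rw [hω4, ← hω3]; ring, one_smul, one_smul]
    abel
  · have h1 := congrArg (w.χ u) h
    have h2 : w.χ u Eu = 3 := by
      rw [w.χ_apply, hu3, Matrix.trace_one, Fintype.card_fin, T.n_left, Nat.cast_ofNat]
    have h3 : w.χ u Ev = 0 := by rw [w.χ_apply, hv4 u T.ne, Matrix.trace_zero]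
    simp only [map_add, map_sub, map_smul, h2, h3, w.χ_one, T.n_left, Nat.cast_ofNat, smul_eq_mul] at h1
    refine hω.ne_one (by norm_num) ?_
    have h30 : (3 : k) ≠ 0 := by norm_num
    apply mul_right_cancel₀ h30
    linear_combination h1
  · rw [hzz, hω4]
    have e1 : ω ^ 2 = -1 - ω := by linear_combination hω1
    rw [show ω * ω = -1 - ω by rw [← e1]; ring, e1]
    module
  · have h1 : LinearMap.mulLeft k (1 - Eu - Ev) =
        LinearMap.mulLeft k 1 ∘ₗ LinearMap.mulRight k (1 - Eu - Ev) :=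
      LinearMap.ext fun x => by simpa using h0c x
    rw [h1]
    have h2 := hψ 0 1
    rw [biTrace] at h2
    refine h2.symm.trans ?_
    rw [p.one_left]
    change counit (R := k) ((3 : k) • W) = 9
    rw [map_smul, map_sum, Finset.sum_congr rfl fun h _ => h.2.counit_eq_one, Finset.sum_const,
      Finset.card_univ, ← Nat.card_eq_fintype_card, T.card]
    norm_num
  · have h2 : w.χ (p.ch w g) Eu = 0 := by rw [w.χ_apply, hu4 _ (T.ch_ne g), Matrix.trace_zero]
    have h3 : w.χ (p.ch w g) Ev = 0 := by rw [w.χ_apply, hv4 _ (T.symm.ch_ne g), Matrix.trace_zero]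
    rw [P_groupLike p w]
    simp [h2, h3, w.χ_one, n_ch]

end TwoBig
end HopfPairing
end Twist
end HopfClass

namespace HopfClass

section Taft
open WithConv Coalgebra HopfAlgebra
variable {k : Type*} [Field k] [CharZero k] {B : Type*} [Ring B] [HopfAlgebra k B] [FiniteDimensional k B]

lemma eq_zero_of_tmul_eq_zero {V W : Type*} [AddCommGroup V] [Module k V] [AddCommGroup W] [Module k W]
    {v : V} {w : W} (h : v ⊗ₜ[k] w = 0) (hw : w ≠ 0) : v = 0 := by
  obtain ⟨f, hf⟩ : ∃ f : W →ₗ[k] k, f w ≠ 0 := by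
    by_contra! h
    exact hw ((Module.forall_dual_apply_eq_zero_iff k w).1 h)
  have h1 := congrArg (fun y => TensorProduct.rid k V (LinearMap.lTensor V f y)) h
  simpa [hf] using h1

/-- The spectral idempotent of an element of order three for the eigenvalue `d`. -/
noncomputable def eig (g : B) (d : k) : B := (3 : k)⁻¹ • (1 + (d * d) • g + d • (g * g))

variable {g x : B} {q d a b : k}

lemma commute_eig (g : B) (d : k) : g * eig g d = eig g d * g := by
  simp [eig, mul_add, add_mul, mul_assoc]

lemma mul_eig (hg3 : g ^ 3 = 1) (hd : d ^ 3 = 1) : g * eig g d = d • eig g d := by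
  have h : g * (g * g) = 1 := by rw [← hg3]; noncomm_ring
  have h1 : d * (d * d) = 1 := by rw [← hd]; ring
  rw [eig, mul_smul_comm, smul_comm d (3 : k)⁻¹]
  congr 1
  rw [mul_add, mul_add, mul_one, mul_smul_comm, mul_smul_comm, h, smul_add, smul_add, smul_smul d (d * d),
    h1, smul_smul d d, one_smul]
  abel

lemma eig_mul (hg3 : g ^ 3 = 1) (hd : d ^ 3 = 1) : eig g d * g = d • eig g d := by
  rw [← commute_eig, mul_eig hg3 hd]

lemma eig_mul_eig_of_ne (hg3 : g ^ 3 = 1) (ha : a ^ 3 = 1) (hb : b ^ 3 = 1) (hab : a ≠ b) :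
    eig g a * eig g b = 0 := by
  have h : a • (eig g a * eig g b) = b • (eig g a * eig g b) := by
    rw [← smul_mul_assoc, ← eig_mul hg3 ha, mul_assoc, mul_eig hg3 hb, mul_smul_comm]
  rw [← sub_eq_zero, ← sub_smul] at h
  exact (smul_eq_zero.1 h).resolve_left (sub_ne_zero.2 hab)

lemma eig_mul_self (hg3 : g ^ 3 = 1) (hd : d ^ 3 = 1) : eig g d * eig g d = eig g d := by
  conv_lhs => enter [1]; rw [eig]
  rw [smul_mul_assoc, add_mul, add_mul, one_mul, smul_mul_assoc, smul_mul_assoc, mul_assoc,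
    mul_eig hg3 hd, mul_smul_comm, mul_eig hg3 hd, smul_smul, smul_smul, smul_smul,
    show d * d * d = 1 by rw [← hd]; ring, one_smul]
  rw [show eig g d + eig g d + eig g d = (3 : k) • eig g d by module, smul_smul]
  norm_num

lemma sum_eig (hd : 1 + d + d ^ 2 = 0) : eig g (1 : k) + eig g d + eig g (d ^ 2) = 1 := by
  have h1 : d ^ 2 = -1 - d := by linear_combination hd
  have h2 : d * d = -1 - d := by linear_combination hd
  have h3 : (-1 - d) * (-1 - d) = d := by linear_combination hd
  simp only [eig, h1, h2, h3]
  module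

lemma counit_eig_one (hg : IsGroupLikeElem k g) : counit (R := k) (eig g (1 : k)) = 1 := by
  simp [eig, hg.counit_eq_one]
  norm_num

lemma skew_mul_eig (hq : q ^ 3 = 1) (hgx : g * x = q • (x * g)) :
    x * eig g d = eig g (q * d) * x := by
  have h1 : g * g * x = (q * q) • (x * (g * g)) := by
    rw [mul_assoc, hgx, mul_smul_comm, ← mul_assoc, hgx, smul_mul_assoc, smul_smul, mul_assoc]
  simp only [eig, mul_smul_comm, smul_mul_assoc, mul_add, add_mul, mul_one, one_mul, hgx, h1, smul_smul]
  rw [show q * d * (q * d) * q = d * d by linear_combination d * d * hq,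
    show q * d * (q * q) = d by linear_combination d * hq]

lemma pow_skew_mul_eig (hq : q ^ 3 = 1) (hgx : g * x = q • (x * g)) (m : ℕ) :
    x ^ m * eig g d = eig g (q ^ m * d) * x ^ m := by
  induction m with
  | zero => simp
  | succ m ih =>
    rw [pow_succ', mul_assoc, ih, ← mul_assoc, skew_mul_eig hq hgx, mul_assoc, pow_succ' q, mul_assoc]

lemma tmul_eig_mul_comul (hg : IsGroupLikeElem k g) (hg3 : g ^ 3 = 1) (ha : a ^ 3 = 1)
    (hb : b ^ 3 = 1) : (eig g a ⊗ₜ[k] eig g b) * comul (R := k) (eig g (a * b)) =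
      eig g a ⊗ₜ[k] eig g b := by
  conv_lhs => enter [2]; rw [eig]
  have h1 : (eig g a ⊗ₜ[k] eig g b) * comul (R := k) g = (a * b) • (eig g a ⊗ₜ[k] eig g b) := by
    rw [hg.comul_eq_tmul_self, Algebra.TensorProduct.tmul_mul_tmul, eig_mul hg3 ha, eig_mul hg3 hb,
      smul_tmul_smul]
  rw [map_smul, map_add, map_add, map_smul, map_smul, Bialgebra.comul_mul, Bialgebra.comul_one,
    mul_smul_comm, mul_add, mul_add, mul_one, mul_smul_comm, mul_smul_comm,
    ← mul_assoc (eig g a ⊗ₜ[k] eig g b), h1, smul_mul_assoc, h1, smul_smul, smul_smul, smul_smul,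
    show a * b * (a * b) * (a * b) = 1 by linear_combination b ^ 3 * ha + hb, one_smul]
  generalize eig g a ⊗ₜ[k] eig g b = y
  rw [show y + y + y = (3 : k) • y by module, smul_smul]
  norm_num

lemma eig_ne_zero (hg : IsGroupLikeElem k g) (hg3 : g ^ 3 = 1) (hg1 : g ≠ 1) (hd : d ^ 3 = 1) :
    eig g d ≠ 0 := by
  intro h
  have h1 : eig g (1 : k) ≠ 0 := fun h0 => by
    have := counit_eig_one hg
    rw [h0, map_zero] at this
    exact zero_ne_one this
  by_cases hd1 : d = 1
  · exact h1 (hd1 ▸ h)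
  have hd2 : (d ^ 2) ^ 3 = 1 := by linear_combination (d ^ 3 + 1) * hd
  have h2 := tmul_eig_mul_comul hg hg3 hd2 hd2
  rw [show d ^ 2 * d ^ 2 = d by linear_combination d * hd, h, map_zero, mul_zero, eq_comm] at h2
  have h3 : eig g (d ^ 2) = 0 := by_contra fun h3 => h3 (eq_zero_of_tmul_eq_zero h2 h3)
  have hs : 1 + d + d ^ 2 = 0 := by
    have : (d - 1) * (1 + d + d ^ 2) = 0 := by linear_combination hd
    exact (mul_eq_zero.1 this).resolve_left (sub_ne_zero.2 hd1)
  have h4 := sum_eig (g := g) hs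
  rw [h, h3, add_zero, add_zero] at h4
  have h5 := mul_eig hg3 (one_pow 3 : (1 : k) ^ 3 = 1)
  rw [h4, mul_one, one_smul] at h5
  exact hg1 h5

lemma eig_mul_skew_ne_zero (hg : IsGroupLikeElem k g) (hg3 : g ^ 3 = 1) (hg1 : g ≠ 1)
    (hq : IsPrimitiveRoot q 3) (hgx : g * x = q • (x * g)) (hx0 : x ≠ 0)
    (hx : comul (R := k) x = x ⊗ₜ 1 + g ⊗ₜ x) (hd : d ^ 3 = 1) : eig g d * x ≠ 0 := by
  intro h
  have hq3 := hq.pow_eq_one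
  have key : ∀ a : k, a ^ 3 = 1 → eig g a * x = 0 := by
    intro a ha
    have hd0 : d ≠ 0 := fun h => by rw [h] at hd; simp at hd
    have ha0 : a ≠ 0 := fun h => by rw [h] at ha; simp at ha
    obtain ⟨b, hb, rfl⟩ : ∃ b, b ^ 3 = 1 ∧ d = a * b :=
      ⟨d / a, by rw [div_pow, hd, ha, div_one], by field_simp⟩
    have hqb : q * b ≠ b := fun e => by
      have hb0 : b ≠ 0 := right_ne_zero_of_mul hd0
      exact hq.ne_one (by norm_num) (mul_right_cancel₀ hb0 (by rw [e, one_mul]))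
    have hqb3 : (q * b) ^ 3 = 1 := by rw [mul_pow, hq3, hb, one_mul]
    have h1 : (eig g a ⊗ₜ[k] eig g b) * comul (R := k) (eig g (a * b) * x) * (1 ⊗ₜ eig g b) = 0 := by
      rw [h, map_zero, mul_zero, zero_mul]
    rw [Bialgebra.comul_mul, ← mul_assoc, tmul_eig_mul_comul hg hg3 ha hb, hx, mul_add, add_mul,
      Algebra.TensorProduct.tmul_mul_tmul, Algebra.TensorProduct.tmul_mul_tmul,
      Algebra.TensorProduct.tmul_mul_tmul, Algebra.TensorProduct.tmul_mul_tmul, mul_one, mul_one,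
      mul_one, eig_mul_self hg3 hb, mul_assoc (eig g b), skew_mul_eig hq3 hgx, ← mul_assoc,
      eig_mul_eig_of_ne hg3 hb hqb3 hqb.symm, zero_mul, tmul_zero, add_zero] at h1
    exact eq_zero_of_tmul_eq_zero h1 (eig_ne_zero hg hg3 hg1 hb)
  have hs : 1 + q + q ^ 2 = 0 := by
    simpa [Finset.sum_range_succ] using hq.geom_sum_eq_zero (by norm_num)
  have h4 := congrArg (· * x) (sum_eig (g := g) hs)
  simp only [add_mul, one_mul, key 1 (one_pow 3), key q hq3,
    key (q ^ 2) (by rw [← pow_mul, mul_comm, pow_mul, hq3, one_pow]), add_zero] at h4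
  exact hx0 h4.symm

lemma eig_mul_skew_sq_ne_zero (hg : IsGroupLikeElem k g) (hg3 : g ^ 3 = 1) (hg1 : g ≠ 1)
    (hq : IsPrimitiveRoot q 3) (hgx : g * x = q • (x * g)) (hx0 : x ≠ 0)
    (hx : comul (R := k) x = x ⊗ₜ 1 + g ⊗ₜ x) (hd : d ^ 3 = 1) : eig g d * (x * x) ≠ 0 := by
  intro h
  have hq3 := hq.pow_eq_one
  have hd0 : d ≠ 0 := fun h => by rw [h] at hd; simp at hd
  have hq0 : q ≠ 0 := hq.ne_zero (by norm_num)
  obtain ⟨b, hb, rfl⟩ : ∃ b, b ^ 3 = 1 ∧ d = q * b :=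
    ⟨d / q, by rw [div_pow, hd, hq3, div_one], by field_simp⟩
  have hb0 : b ≠ 0 := right_ne_zero_of_mul hd0
  have hqb : q * b ≠ b := fun e => hq.ne_one (by norm_num) (mul_right_cancel₀ hb0 (by rw [e, one_mul]))
  have hqqb : q ^ 2 * b ≠ q * b := fun e =>
    hqb (mul_left_cancel₀ hq0 (by linear_combination e))
  have hqqb3 : (q ^ 2 * b) ^ 3 = 1 := by rw [mul_pow, hb, ← pow_mul, pow_mul', hq3]; simp
  have hx1 : eig g (1 : k) * x ≠ 0 := eig_mul_skew_ne_zero hg hg3 hg1 hq hgx hx0 hx (one_pow 3)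
  have hxq : eig g (q * b) * x ≠ 0 := eig_mul_skew_ne_zero hg hg3 hg1 hq hgx hx0 hx hd
  have hΔ := tmul_eig_mul_comul hg hg3 (one_pow 3) hd
  rw [one_mul] at hΔ
  have hz : ∀ m : ℕ, q ^ m * b ≠ q * b → (q ^ m * b) ^ 3 = 1 →
      eig g (q * b) * x ^ m * eig g b = 0 := fun m hm hm3 => by
    rw [mul_assoc, pow_skew_mul_eig hq3 hgx, ← mul_assoc, eig_mul_eig_of_ne hg3 hd hm3 hm.symm, zero_mul]
  have z0 : eig g (q * b) * eig g b = 0 := eig_mul_eig_of_ne hg3 hd hb hqb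
  have z1 : eig g (q * b) * x * eig g b = eig g (q * b) * x := by
    rw [mul_assoc, skew_mul_eig hq3 hgx, ← mul_assoc, eig_mul_self hg3 hd]
  have z2 : eig g (q * b) * (x * x) * eig g b = 0 := by rw [← pow_two]; exact hz 2 hqqb hqqb3
  have h1 : (eig g (1 : k) ⊗ₜ[k] eig g (q * b)) * comul (R := k) (eig g (q * b) * (x * x)) *
      (1 ⊗ₜ eig g b) = 0 := by
    rw [h, map_zero, mul_zero, zero_mul]
  rw [Bialgebra.comul_mul, ← mul_assoc, hΔ, comul_sq_of_skew hx hgx, mul_add, mul_add, add_mul, add_mul,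
    mul_smul_comm, smul_mul_assoc] at h1
  simp only [Algebra.TensorProduct.tmul_mul_tmul, mul_one, z0, z1, z2, tmul_zero, add_zero, zero_add] at h1
  have hq1 : 1 + q ≠ 0 := by
    intro h2
    have h3 : q ^ 2 = 1 := by linear_combination (q - 1) * h2
    exact absurd (hq.dvd_of_pow_eq_one 2 h3) (by norm_num)
  have h2 := eq_zero_of_tmul_eq_zero ((smul_eq_zero.1 h1).resolve_left hq1) hxq
  have h3 := congrArg (· * (g * g)) h2
  simp only [zero_mul, mul_assoc] at h3
  rw [show g * (g * g) = 1 by rw [← hg3]; noncomm_ring, mul_one] at h3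
  exact hx1 h3

/-- The nine elements of a Taft subalgebra are linearly independent. -/
lemma linearIndependent_taft (hg : IsGroupLikeElem k g) (hg3 : g ^ 3 = 1) (hg1 : g ≠ 1)
    (hq : IsPrimitiveRoot q 3) (hgx : g * x = q • (x * g)) (hx0 : x ≠ 0)
    (hx : comul (R := k) x = x ⊗ₜ 1 + g ⊗ₜ x) :
    LinearIndependent k (fun i : Fin 3 × Fin 3 => eig g (q ^ (i.1 : ℕ)) * x ^ (i.2 : ℕ)) := by
  have hq3 := hq.pow_eq_one
  have hp : ∀ n : ℕ, (q ^ n) ^ 3 = 1 := fun n => by rw [← pow_mul, mul_comm, pow_mul, hq3, one_pow]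
  have hq0 : q ≠ 0 := hq.ne_zero (by norm_num)
  have hinj : ∀ i j : Fin 3, q ^ (i : ℕ) = q ^ (j : ℕ) → i = j := fun i j h =>
    Fin.ext (hq.pow_inj i.2 j.2 h)
  rw [Fintype.linearIndependent_iff]
  rintro c hc ⟨i, m⟩
  obtain ⟨d, hd3, hd⟩ : ∃ d, d ^ 3 = 1 ∧ q ^ (m : ℕ) * d = q ^ (i : ℕ) :=
    ⟨q ^ (i : ℕ) / q ^ (m : ℕ), by rw [div_pow, hp, hp, div_one], by field_simp⟩
  have hd0 : d ≠ 0 := fun h => by rw [h] at hd3; simp at hd3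
  have hne : eig g (q ^ (i : ℕ)) * x ^ (m : ℕ) ≠ 0 := by
    fin_cases m
    · simpa using eig_ne_zero hg hg3 hg1 (hp i)
    · simpa using eig_mul_skew_ne_zero hg hg3 hg1 hq hgx hx0 hx (hp i)
    · simpa [pow_two] using eig_mul_skew_sq_ne_zero hg hg3 hg1 hq hgx hx0 hx (hp i)
  have h1 := congrArg (fun y => eig g (q ^ (i : ℕ)) * y * eig g d) hc
  simp only [Finset.mul_sum, Finset.sum_mul, mul_zero, zero_mul] at h1
  rw [Finset.sum_eq_single (i, m)] at h1
  · simp only [mul_smul_comm, smul_mul_assoc] at h1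
    rw [← mul_assoc, eig_mul_self hg3 (hp _), mul_assoc, pow_skew_mul_eig hq3 hgx, hd, ← mul_assoc,
      eig_mul_self hg3 (hp _)] at h1
    exact (smul_eq_zero.1 h1).resolve_right hne
  · rintro ⟨j, l⟩ - hjl
    simp only [mul_smul_comm, smul_mul_assoc]
    rw [← mul_assoc]
    by_cases hij : i = j
    · subst hij
      rw [eig_mul_self hg3 (hp _), mul_assoc, pow_skew_mul_eig hq3 hgx, ← mul_assoc,
        eig_mul_eig_of_ne hg3 (hp _) (by rw [mul_pow, hp, hd3, one_mul]), zero_mul, smul_zero]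
      intro e
      rw [← hd] at e
      exact hjl (by rw [hinj m l (mul_right_cancel₀ hd0 e)])
    · rw [eig_mul_eig_of_ne hg3 (hp _) (hp _) fun e => hij (hinj i j e)]
      simp
  · simp

variable {A : Type*} [Ring A] [HopfAlgebra k A] [FiniteDimensional k A]

/-- A functional multiplicative on the left against a left integral kills it unless it is the counit. -/
lemma HopfPairing.P_groupLike_integral (p : HopfPairing k A B) {z : A} (hz : IsGroupLikeElem k z)
    (hz1 : z ≠ 1) {Λ : B} (hΛ : IsLeftInt k Λ) : p.P z Λ = 0 := by
  by_contra h0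
  refine hz1 (p.ext_left fun b => ?_)
  have h1 := congrArg (p.P z) (hΛ b)
  rw [p.mul_right, hz.comul_eq_tmul_self, tmulFun_tmul, map_smul, smul_eq_mul] at h1
  rw [p.one_left]
  exact mul_right_cancel₀ h0 h1

/-- A Taft subalgebra fixed by translations by a central grouplike element obstructs the existence
of a left integral with nonzero counit. -/
theorem HopfPairing.false_of_central (p : HopfPairing k A B) {z E : A} (hz : IsGroupLikeElem k z)
    (hz3 : z ^ 3 = 1) (hz1 : z ≠ 1) (hzE : (3 : k) • E = 1 + z + z * z) (hE : E * E = E)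
    (htr : LinearMap.trace k A (LinearMap.mulLeft k E) = 9) (hg : IsGroupLikeElem k g)
    (hzg : p.P z g = 1) (hg3 : g ^ 3 = 1) (hg1 : g ≠ 1) (hq : IsPrimitiveRoot q 3)
    (hgx : g * x = q • (x * g)) (hx0 : x ≠ 0) (hx : comul (R := k) x = x ⊗ₜ 1 + g ⊗ₜ x)
    {Λ : B} (hΛ : IsLeftInt k Λ) (hε : counit (R := k) Λ ≠ 0) : False := by
  have h30 : (3 : k) ≠ 0 := by norm_num
  have hq1 : q ≠ 1 := hq.ne_one (by norm_num)
  let τ : B →ₐ[k] B := p.symm.tau ⟨z, hz⟩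
  have hτ : ∀ a b, p.P a (τ b) = p.P (z * a) b := fun a b => p.symm.P_tau ⟨z, hz⟩ b a
  have hmul : ∀ b b', p.P z (b * b') = p.P z b * p.P z b' := fun b b' => by
    rw [p.mul_right, hz.comul_eq_tmul_self]; rfl
  have hzx : p.P z x = 0 := by
    have h1 := congrArg (p.P z) hgx
    rw [map_smul, hmul, hmul, hzg, smul_eq_mul, one_mul, mul_one] at h1
    have h2 : (q - 1) * p.P z x = 0 := by linear_combination -h1
    exact (mul_eq_zero.1 h2).resolve_left (sub_ne_zero.2 hq1)
  have hεx : counit (R := k) x = 0 := by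
    have h1 := congrArg (counit (R := k)) hgx
    rw [map_smul, Bialgebra.counit_mul, Bialgebra.counit_mul, hg.counit_eq_one, smul_eq_mul, one_mul,
      mul_one] at h1
    have h2 : (q - 1) * counit (R := k) x = 0 := by linear_combination -h1
    exact (mul_eq_zero.1 h2).resolve_left (sub_ne_zero.2 hq1)
  have hτg : τ g = g := p.ext_right fun a => by
    rw [hτ, p.mul_left, hg.comul_eq_tmul_self, tmulFun_tmul, hzg, one_mul]
  have hτx : τ x = x := p.ext_right fun a => by
    rw [hτ, p.mul_left, hx, map_add, tmulFun_tmul, tmulFun_tmul, hzx, hzg, zero_mul, one_mul, zero_add]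
  have hτe : ∀ d : k, τ (eig g d) = eig g d := fun d => by simp [eig, hτg]
  let F : B →ₗ[k] B := p.symm.adj (LinearMap.mulLeft k E)
  have hF : ∀ a b, p.P a (F b) = p.P (E * a) b := fun a b => p.symm.P_adj _ b a
  have hF3 : ∀ b, (3 : k) • F b = b + τ b + τ (τ b) := fun b => p.ext_right fun a => by
    rw [map_smul, hF, map_add, map_add, hτ, hτ, hτ, ← LinearMap.smul_apply, ← map_smul,
      ← smul_mul_assoc, hzE, add_mul, add_mul, map_add, map_add, one_mul, ← mul_assoc]
    rfl
  have hfix : ∀ b, τ b = b → F b = b := fun b hb => by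
    have h1 := hF3 b
    rw [hb, hb] at h1
    apply smul_right_injective B h30
    simp only [h1]
    module
  have hFF : ∀ b, F (F b) = F b := fun b => p.ext_right fun a => by
    rw [hF, hF, hF, ← mul_assoc, hE]
  let T : Submodule k B := LinearMap.ker (F - LinearMap.id)
  have hT : ∀ b, b ∈ T ↔ F b = b := fun b => by
    simp [T, sub_eq_zero]
  let R : Submodule k A := LinearMap.range (LinearMap.mulLeft k E)
  have hR : Module.finrank k R = 9 := by
    have h1 := exists_trace_eq_natCast (LinearMap.mulLeft k E)
      (LinearMap.ext fun x => by simp [← mul_assoc, hE])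
    rw [htr] at h1
    exact_mod_cast h1.symm
  have hTR : Module.finrank k T ≤ 9 := by
    rw [← hR, ← Subspace.dual_finrank_eq (K := k) (V := R)]
    let φ : T →ₗ[k] Module.Dual k R := LinearMap.lcomp k k R.subtype ∘ₗ p.P.flip ∘ₗ T.subtype
    refine LinearMap.finrank_le_finrank_of_injective (f := φ) ((injective_iff_map_eq_zero φ).2 ?_)
    rintro ⟨b, hb⟩ h
    have h0 : b = 0 := p.ext_right fun a => by
      rw [← (hT b).1 hb, hF, map_zero]
      exact LinearMap.congr_fun h ⟨E * a, ⟨a, rfl⟩⟩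
    exact Subtype.ext h0
  have hli := linearIndependent_taft hg hg3 hg1 hq hgx hx0 hx
  set V : Fin 3 × Fin 3 → B := fun i => eig g (q ^ (i.1 : ℕ)) * x ^ (i.2 : ℕ) with hV
  have hspan : Submodule.span k (Set.range V) = T := by
    apply Submodule.eq_of_le_of_finrank_le
    · rw [Submodule.span_le]
      rintro _ ⟨i, rfl⟩
      exact (hT _).2 (hfix _ (by simp only [hV, map_mul, map_pow, hτe, hτx]))
    · rw [finrank_span_eq_card hli]
      simpa using hTR
  have hcorner : ∀ b ∈ T, ∃ c : k, eig g (1 : k) * b * eig g (1 : k) = c • eig g (1 : k) := by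
    intro b hb
    rw [← hspan] at hb
    have h11 : (1 : k) ^ 3 = 1 := one_pow 3
    have hq3 := hq.pow_eq_one
    have hp : ∀ n : ℕ, (q ^ n) ^ 3 = 1 := fun n => by rw [← pow_mul, mul_comm, pow_mul, hq3, one_pow]
    induction hb using Submodule.span_induction with
    | mem b hb =>
      obtain ⟨⟨i, m⟩, rfl⟩ := hb
      simp only [hV]
      by_cases hi : q ^ (i : ℕ) = 1
      · rw [hi, ← mul_assoc, eig_mul_self hg3 h11]
        by_cases hm : q ^ (m : ℕ) = 1
        · have : (m : ℕ) = 0 := hq.pow_inj m.2 (by norm_num) (hm.trans (pow_zero q).symm)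
          exact ⟨1, by rw [this, pow_zero, mul_one, eig_mul_self hg3 h11, one_smul]⟩
        · refine ⟨0, ?_⟩
          rw [mul_assoc, pow_skew_mul_eig hq3 hgx, mul_one, ← mul_assoc,
            eig_mul_eig_of_ne hg3 h11 (hp _) (Ne.symm hm), zero_mul, zero_smul]
      · refine ⟨0, ?_⟩
        rw [← mul_assoc, eig_mul_eig_of_ne hg3 h11 (hp _) (Ne.symm hi), zero_mul, zero_mul, zero_smul]
    | zero => exact ⟨0, by simp⟩
    | add b b' _ _ h h' =>
      obtain ⟨c, hc⟩ := h
      obtain ⟨c', hc'⟩ := h'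
      exact ⟨c + c', by rw [mul_add, add_mul, hc, hc', add_smul]⟩
    | smul a b _ h =>
      obtain ⟨c, hc⟩ := h
      exact ⟨a * c, by rw [mul_smul_comm, smul_mul_assoc, hc, smul_smul]⟩
  have hΛF : ∀ b, τ b = b → b * F Λ = counit (R := k) b • F Λ := fun b hb => by
    have e1 : b * τ Λ = counit (R := k) b • τ Λ := by
      conv_lhs => rw [← hb]
      rw [← map_mul, hΛ, map_smul]
    have e2 : b * τ (τ Λ) = counit (R := k) b • τ (τ Λ) := by
      conv_lhs => rw [← hb]
      rw [← map_mul, e1, map_smul]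
    apply smul_right_injective B h30
    simp only
    rw [← mul_smul_comm, smul_comm, hF3, mul_add, mul_add, hΛ, e1, e2, smul_add, smul_add]
  have hεt : counit (R := k) (F Λ) ≠ 0 := by
    have hz2 : z * z ≠ 1 := fun h => hz1 (by rw [← hz3, pow_succ, pow_two, h, one_mul])
    have h1 : (3 : k) * p.P 1 (F Λ) = counit (R := k) Λ := by
      rw [hF, mul_one, ← smul_eq_mul, ← LinearMap.smul_apply, ← map_smul, hzE, map_add, map_add,
        LinearMap.add_apply, LinearMap.add_apply, p.one_left, p.P_groupLike_integral hz hz1 hΛ,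
        p.P_groupLike_integral (hz.mul hz) hz2 hΛ, add_zero, add_zero]
    rw [p.one_left] at h1
    exact fun h => hε (by rw [← h1, h, mul_zero])
  obtain ⟨c, hc⟩ := hcorner (F Λ) ((hT _).2 (hFF Λ))
  rw [hΛF _ (hτe 1), counit_eig_one hg, one_smul] at hc
  have hc0 : c ≠ 0 := by
    rintro rfl
    have := congrArg (counit (R := k)) hc
    rw [Bialgebra.counit_mul, counit_eig_one hg, mul_one, zero_smul, map_zero] at this
    exact hεt this
  have h1 := congrArg (x * ·) hc
  simp only [← mul_assoc, hΛF x hτx, hεx, zero_smul, zero_mul, mul_smul_comm] at h1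
  have h2 := (smul_eq_zero.1 h1.symm).resolve_left hc0
  rw [skew_mul_eig hq.pow_eq_one hgx] at h2
  exact eig_mul_skew_ne_zero hg hg3 hg1 hq hgx hx0 hx (by rw [mul_one, hq.pow_eq_one]) h2

end Taft
end HopfClass

namespace HopfClass

section Basic
variable {k : Type*} [Field k] {A : Type*} [Ring A] [Algebra k A]

lemma MatrixData.π_eq_zero_of_n_eq_one (w : MatrixData k A) {t : Fin w.r} (ht : w.n t = 1) {a : A}
    (h : w.χ t a = 0) : w.π t a = 0 := by
  have hs : Subsingleton (Fin (w.n t)) := by rw [ht]; infer_instance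
  ext i j
  rw [w.χ_apply, Matrix.trace, Fintype.sum_subsingleton _ i] at h
  rw [Subsingleton.elim j i]
  exact h

/-- A proper two-sided ideal of a basic algebra is killed by a character. -/
lemma MatrixData.exists_χ_eq_zero [FiniteDimensional k A] (w : MatrixData k A) (hw : ∀ t, w.n t = 1) (I : Submodule k A)
    (hl : ∀ a, ∀ x ∈ I, a * x ∈ I) (h1 : (1 : A) ∉ I) : ∃ t, ∀ x ∈ I, w.χ t x = 0 := by
  classical
  by_contra! h
  choose x hx hx0 using h
  choose a ha has using fun t => w.exists_single t ((w.χ t (x t))⁻¹ • 1)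
  have hsum : ∀ s, w.χ s (1 - ∑ t, a t * x t) = 0 := fun s => by
    have hz : ∀ t ∈ Finset.univ, t ≠ s → w.χ s (a t * x t) = 0 := fun t _ hts => by
      rw [w.χ_mul_of_n_eq_one (hw s), w.χ_apply s (a t), has t s (Ne.symm hts), Matrix.trace_zero,
        zero_mul]
    rw [map_sub, map_sum, Finset.sum_eq_single s hz (fun h => absurd (Finset.mem_univ s) h),
      w.χ_mul_of_n_eq_one (hw s), w.χ_apply s (a s), ha, Matrix.trace_smul, Matrix.trace_one,
      Fintype.card_fin, w.χ_one, hw s, Nat.cast_one, smul_eq_mul, mul_one,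
      inv_mul_cancel₀ (hx0 s), sub_self]
  have hu := (w.isNilpotent_of_π fun s => w.π_eq_zero_of_n_eq_one (hw s) (hsum s)).isUnit_one_sub
  rw [sub_sub_cancel] at hu
  obtain ⟨u, hu⟩ := hu
  have := hl ↑u⁻¹ _ (Submodule.sum_mem I fun t (_ : t ∈ Finset.univ) => hl (a t) _ (hx t))
  rw [← hu, Units.inv_mul] at this
  exact h1 this

/-- The coalgebra dual to a basic algebra is pointed. -/
lemma isPointedWrt_of_basic [FiniteDimensional k A] (w : MatrixData k A) (hw : ∀ t, w.n t = 1)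
    {M : Type*} [AddCommGroup M] [Module k M] (Δ : M →ₗ[k] M ⊗[k] M) (P : M ≃ₗ[k] (A →ₗ[k] k))
    (hP : ∀ a b m, tmulFun (P.toLinearMap.flip a) (P.toLinearMap.flip b) (Δ m) = P m (a * b)) :
    IsPointedWrt k Δ := by
  intro C hC
  obtain ⟨hsub, hne, hsimple⟩ := hC
  have hev : ∀ f : M →ₗ[k] k, ∃ a, P.toLinearMap.flip a = f := fun f => by
    obtain ⟨a, ha⟩ := (Module.evalEquiv k A).surjective (f ∘ₗ P.symm.toLinearMap)
    refine ⟨a, LinearMap.ext fun m => ?_⟩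
    have := LinearMap.congr_fun ha (P m)
    simpa using this
  let I : Submodule k A :=
    { carrier := {a | ∀ c ∈ C, P c a = 0}
      add_mem' := fun ha hb c hc => by rw [map_add, ha c hc, hb c hc, add_zero]
      zero_mem' := fun c _ => map_zero _
      smul_mem' := fun r a ha c hc => by rw [map_smul, ha c hc, smul_zero] }
  have hI : ∀ a, a ∈ I ↔ ∀ c ∈ C, P c a = 0 := fun a => Iff.rfl
  have hl : ∀ a, ∀ x ∈ I, a * x ∈ I := fun a x hx => by
    rw [hI]
    intro c hc
    obtain ⟨u, hu⟩ := hsub c hc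
    rw [← hP, ← hu, tmulFun_map]
    have : P.toLinearMap.flip x ∘ₗ C.subtype = 0 := LinearMap.ext fun c => hx c c.2
    rw [this]
    simp [tmulFun]
  have h1 : (1 : A) ∉ I := fun h => by
    obtain ⟨c, hc, hc0⟩ := C.exists_mem_ne_zero_of_ne_bot hne
    refine hc0 (P.injective ?_)
    rw [map_zero]
    exact LinearMap.ext fun a => by simpa using hl a 1 h c hc
  obtain ⟨t, ht⟩ := w.exists_χ_eq_zero hw I hl h1
  let m : M := P.symm (w.χ t)
  have hm : P m = w.χ t := P.apply_symm_apply _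
  have hm0 : m ≠ 0 := fun h => by
    have := LinearMap.congr_fun hm (w.e t)
    rw [h, map_zero, w.χ_e] at this
    simp at this
  have hmC : m ∈ C := by
    by_contra hmC
    obtain ⟨f, hf, hfC⟩ := Submodule.exists_le_ker_of_notMem hmC
    obtain ⟨a, rfl⟩ := hev f
    refine hf ?_
    have : P m a = 0 := by rw [hm]; exact ht a fun c hc => hfC hc
    exact this
  have hΔ : Δ m = m ⊗ₜ m := by
    rw [← sub_eq_zero]
    apply eq_zero_of_tmulFun_eq_zero
    intro f g
    obtain ⟨a, rfl⟩ := hev f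
    obtain ⟨b, rfl⟩ := hev g
    rw [map_sub, hP, tmulFun_tmul, LinearMap.flip_apply, LinearMap.flip_apply, LinearEquiv.coe_coe,
      hm, w.χ_mul_of_n_eq_one (hw t), sub_self]
  have hD : IsSubcoalgWrt k Δ (k ∙ m) := by
    intro x hx
    obtain ⟨r, rfl⟩ := Submodule.mem_span_singleton.1 hx
    refine ⟨r • (⟨m, Submodule.mem_span_singleton_self m⟩ ⊗ₜ
      ⟨m, Submodule.mem_span_singleton_self m⟩), ?_⟩
    rw [map_smul, map_smul, hΔ, map_tmul]
    rfl
  have hle : (k ∙ m) ≤ C := (Submodule.span_singleton_le_iff_mem m C).2 hmC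
  have hEq : (k ∙ m) = C := by
    by_contra hneq
    exact hm0 (Submodule.span_singleton_eq_bot.1 (hsimple _ hD (lt_of_le_of_ne hle hneq)))
  rw [← hEq, finrank_span_singleton hm0]

end Basic

section Final
open WithConv Coalgebra HopfAlgebra
variable {k : Type*} [Field k] {A : Type*} [Ring A] [HopfAlgebra k A] [FiniteDimensional k A]
  {B : Type*} [Ring B] [HopfAlgebra k B] [FiniteDimensional k B]

lemma HopfPairing.isPointed_of_basic (p : HopfPairing k A B) (w : MatrixData k A)
    (hw : ∀ t, w.n t = 1) : IsPointed k B :=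
  isPointedWrt_of_basic w hw _ p.funEquiv fun a b m => (p.mul_left a b m).symm

lemma isCopointed_of_basic (w : MatrixData k A) (hw : ∀ t, w.n t = 1) : IsCopointed k A := by
  refine isPointedWrt_of_basic w hw _ (LinearEquiv.refl k _) fun a b m => ?_
  obtain ⟨u, hu⟩ := (TensorProduct.dualDistribEquiv k A A).surjective
    ((LinearMap.mul' k A).dualMap m)
  have h1 : dualComul k A m = u := by
    simp [dualComul, ← hu]
  have h2 : ∀ u : Module.Dual k A ⊗[k] Module.Dual k A,
      tmulFun ((LinearEquiv.refl k (Module.Dual k A)).toLinearMap.flip a)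
        ((LinearEquiv.refl k (Module.Dual k A)).toLinearMap.flip b) u =
      TensorProduct.dualDistribEquiv k A A u (a ⊗ₜ b) := fun u => by
    induction u with
    | zero => simp
    | tmul f g => simp [TensorProduct.dualDistribEquiv]
    | add x y hx hy => rw [map_add, map_add, LinearMap.add_apply, hx, hy]
  rw [h1]
  refine (h2 u).trans ?_
  rw [hu]
  simp

/-- A non-semisimple Hopf algebra of dimension `27` with a nontrivial character is basic or has a
central grouplike element of order `3`. -/
lemma HopfPairing.basic_or_exists_central (p : HopfPairing k A B) [CharZero k] [IsAlgClosed k]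
    (hdim : Module.finrank k A = 27)
    (hε : ∀ Λ : A, IsLeftInt k Λ → counit (R := k) Λ = 0) (hne : Nat.card (GroupLike k B) ≠ 1) :
    (∃ w : MatrixData k A, ∀ t, w.n t = 1) ∨ (Nat.card (GroupLike k B) = 3 ∧
      ∃ z E : A, IsGroupLikeElem k z ∧ (∀ a, z * a = a * z) ∧ z ^ 3 = 1 ∧ z ≠ 1 ∧
        (3 : k) • E = 1 + z + z * z ∧ E * E = E ∧
        LinearMap.trace k A (LinearMap.mulLeft k E) = 9 ∧
        ∀ g : GroupLike k B, p.P z g.val = 1) := by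
  obtain ⟨w⟩ := exists_matrixData k A
  rcases p.structure_of_finrank w hdim hε hne with h | ⟨hN, u, v, huv, hbig, ⟨hu1, hu2, hu3⟩,
    hv1, hv2, hv3⟩
  · exact Or.inl ⟨w, h⟩
  · obtain ⟨g, h3, h1⟩ := exists_pow_three_eq_one (k := k) (p.finrank_eq ▸ hdim) hne
    have hpd := p.finrank_eq_add w
    rw [hdim, hN, hbig, Finset.sum_pair huv, hu1, hu2, hv1, hv2] at hpd
    have T : TwoBig p w u v := ⟨hN, huv, hbig, hu1, hu2, hu3, hv1, hv2, hv3, by omega,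
      p.c_ch_one_eq_zero w hdim hε h3 h1⟩
    have : NeZero ((3 : ℕ) : k) := ⟨by norm_num⟩
    obtain ⟨ω, hω⟩ := HasEnoughRootsOfUnity.exists_primitiveRoot k 3
    exact Or.inr ⟨hN, T.exists_central_groupLike hω⟩

lemma HopfPairing.apply_eq_counit (p : HopfPairing k A B) (h : Nat.card (GroupLike k B) = 1)
    (α : A →ₐ[k] k) (a : A) : α a = counit (R := k) a := by
  obtain ⟨g, hg⟩ := p.exists_groupLike (α := α.toLinearMap) (by simp) (by simp)
  have : Subsingleton (GroupLike k B) := (Nat.card_eq_one_iff_unique.1 h).1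
  rw [Subsingleton.elim g 1] at hg
  rw [← p.one_right, ← GroupLike.val_one (R := k) (A := B), hg]
  rfl

/-- A Hopf algebra of dimension `27` with a nontrivial character. -/
lemma HopfPairing.basic_of_card_ne_one (p : HopfPairing k A B) [CharZero k] [IsAlgClosed k]
    (hdim : Module.finrank k A = 27)
    (hε : ∀ Λ : A, IsLeftInt k Λ → counit (R := k) Λ = 0) (hne : Nat.card (GroupLike k B) ≠ 1) :
    (∃ w : MatrixData k A, ∀ t, w.n t = 1) ∨ ∃ w : MatrixData k B, ∀ t, w.n t = 1 := by
  have hB : Module.finrank k B = 27 := p.finrank_eq ▸ hdim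
  refine (p.basic_or_exists_central hdim hε hne).imp_right ?_
  rintro ⟨hN, z, E, hz, hzc, hz3, hz1, hzE, hE, htr, hzg⟩
  by_cases hεB : ∀ Λ : B, IsLeftInt k Λ → counit (R := k) Λ = 0
  · let Z : GroupLike k A := ⟨z, hz⟩
    have hZ1 : Z ≠ 1 := fun h => hz1 (by simpa using congrArg GroupLike.val h)
    have hZ3 : Z ^ 3 = 1 := GroupLike.val_injective (by simpa using hz3)
    have hne' : Nat.card (GroupLike k A) ≠ 1 := fun h => by
      have := (Nat.card_eq_one_iff_unique.1 h).1
      exact hZ1 (Subsingleton.elim _ _)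
    refine (p.symm.basic_or_exists_central hB hεB hne').resolve_right ?_
    rintro ⟨hN', -⟩
    obtain ⟨g, x, q, hg1, hg3, hq, hx0, -, hgx⟩ := p.symm.exists_skew_eigenvector hB hεB hN'
    have hc : g.val * x = x * g.val := by
      rcases groupLike_cases hN' hZ3 hZ1 g with rfl | rfl | rfl
      · simp
      · exact hzc x
      · rw [GroupLike.val_mul]
        change z * z * x = x * (z * z)
        rw [mul_assoc, hzc x, ← mul_assoc, hzc x, mul_assoc]
    rw [hc] at hgx
    have h2 : (q - 1) • (x * g.val) = 0 := by rw [sub_smul, ← hgx, one_smul, sub_self]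
    refine hx0 (g.2.isUnit.mul_left_eq_zero.1 ?_)
    exact (smul_eq_zero.1 h2).resolve_left (sub_ne_zero.2 (hq.ne_one (by norm_num)))
  · push Not at hεB
    obtain ⟨Λ, hΛ, hΛ0⟩ := hεB
    obtain ⟨g, x, q, hg1, hg3, hq, hx0, hx, hgx⟩ := p.exists_skew_eigenvector hdim hε hN
    refine (p.false_of_central hz hz3 hz1 hzE hE htr g.2 (hzg g) ?_ ?_ hq hgx hx0 hx hΛ hΛ0).elim
    · rw [← GroupLike.val_pow, hg3, GroupLike.val_one]
    · exact fun h => hg1 (GroupLike.val_injective (by simpa using h))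

lemma exists_isLeftInt_counit_ne_zero [CharZero k] [Nontrivial A]
    (hA : Unimodular k A) (hB : Unimodular k (DualHopf k A)) (hodd : Odd (Module.finrank k A)) :
    ∃ Λ : A, IsLeftInt k Λ ∧ counit (R := k) Λ ≠ 0 := by
  obtain ⟨Λ, h0, hΛ⟩ := exists_left_integral k A
  exact ⟨Λ, hΛ, counit_ne_zero_of_unimodular k A hA hB hodd hΛ h0⟩

end Final
end HopfClass

open HopfClass in
/-- Every Hopf algebra of dimension 27 over an algebraically closed field of characteristic
zero is semisimple, pointed, or copointed (its dual Hopf algebra is pointed). -/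
theorem hopf_dim_27_semisimple_or_pointed_or_copointed
    (k : Type*) [Field k] [IsAlgClosed k] [CharZero k]
    (H : Type*) [Ring H] [HopfAlgebra k H] [FiniteDimensional k H]
    (hdim : Module.finrank k H = 27) :
    IsSemisimpleRing H ∨ IsPointed k H ∨ IsCopointed k H := by
  by_cases hε : ∀ Λ : H, IsLeftInt k Λ → Coalgebra.counit (R := k) Λ = 0
  swap
  · push Not at hε
    obtain ⟨Λ, hΛ, h0⟩ := hε
    exact Or.inl (isSemisimpleRing_of_counit_ne_zero hΛ h0)
  right
  have : Nontrivial H := Module.nontrivial_of_finrank_pos (R := k) (by rw [hdim]; norm_num)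
  let p := dualPairing k H
  have hB : Module.finrank k (DualHopf k H) = 27 := p.finrank_eq ▸ hdim
  by_cases hN : Nat.card (GroupLike k (DualHopf k H)) = 1
  · left
    have hU : Unimodular k H := unimodular_of_unique_character k H (p.apply_eq_counit hN)
    have hU' : ¬ Unimodular k (DualHopf k H) := fun hU' => by
      obtain ⟨Λ, hΛ, h0⟩ := exists_isLeftInt_counit_ne_zero hU hU' (by rw [hdim]; decide)
      exact h0 (hε Λ hΛ)
    have hεB : ∀ Λ : DualHopf k H, IsLeftInt k Λ → Coalgebra.counit (R := k) Λ = 0 :=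
      fun Λ hΛ => by
        by_contra h0
        exact hU' (unimodular_of_counit_ne_zero k _ hΛ h0)
    have hN' : Nat.card (GroupLike k H) ≠ 1 := fun h =>
      hU' (unimodular_of_unique_character k _ (p.symm.apply_eq_counit h))
    rcases p.symm.basic_or_exists_central hB hεB hN' with ⟨w, hw⟩ | ⟨-, z, -, hz, -, -, hz1, -⟩
    · exact p.symm.isPointed_of_basic w hw
    · have := (Nat.card_eq_one_iff_unique.1 hN).1
      refine (hz1 ?_).elim
      simpa using congrArg GroupLike.val
        (Subsingleton.elim (⟨z, hz⟩ : GroupLike k (DualHopf k H)) 1)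
  · rcases p.basic_of_card_ne_one hdim hε hN with ⟨w, hw⟩ | ⟨w, hw⟩
    · exact Or.inr (isCopointed_of_basic w hw)
    · exact Or.inl (p.symm.isPointed_of_basic w hw)
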